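/- Let f_1, …, f_k ∈ ℤ[x_1, …, x_n] be nonzero polynomials (k, n ≥ 1), let D = max_i deg(f_i) ≥ 1, and let h = max_i h(f_i), where h(g) denotes the logarithm of the maximum absolute value of the coefficients of g. Then the system f_1 = ⋯ = f_k = 0 has no solution in ℂ^n if and only if there exist polynomials g_1, …, g_k ∈ ℤ[x_1, …, x_n] and a positive integer α satisfying the Bézout identity f_1·g_1 + ⋯ + f_k·g_k = α, with deg(g_i) ≤ 4·n·D^n for all i, and with log α ≤ 4n(n+1)D^n(h + log k + (n+7)·log((n+1)·D)) and h(g_i) ≤ 4n(n+1)D^n(h + log k + (n+7)·log((n+1)·D)) for all i. -/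

import Mathlib

open scoped Classical

noncomputable section

/-- The height of an integer multivariate polynomial: the logarithm of the maximum of the
absolute values of its coefficients. -/
def height {n : ℕ} (g : MvPolynomial (Fin n) ℤ) : ℝ :=
  Real.log ((g.support.sup fun m => (g.coeff m).natAbs : ℕ) : ℝ)

namespace EN

/-! ### Part 1: norms and filtrations -/

structure SN {R : Type*} [CommRing R] (N : R → ℝ) : Prop where
  zero : N 0 = 0
  nonneg : ∀ a, 0 ≤ N a
  one : N 1 ≤ 1
  add : ∀ a b, N (a + b) ≤ N a + N b
  mul : ∀ a b, N (a * b) ≤ N a * N b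
  neg : ∀ a, N (-a) = N a

theorem SN.sum {R : Type*} [CommRing R] {N : R → ℝ} (h : SN N) {ι : Type*} (s : Finset ι)
    (f : ι → R) : N (∑ i ∈ s, f i) ≤ ∑ i ∈ s, N (f i) := by
  induction s using Finset.induction_on with
  | empty => simp [h.zero]
  | insert a s ha ih =>
    rw [Finset.sum_insert ha, Finset.sum_insert ha]
    exact (h.add _ _).trans (by gcongr)

theorem SN.prod {R : Type*} [CommRing R] {N : R → ℝ} (h : SN N) {ι : Type*} (s : Finset ι)
    (f : ι → R) : N (∏ i ∈ s, f i) ≤ ∏ i ∈ s, N (f i) := by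
  induction s using Finset.induction_on with
  | empty => simpa using h.one
  | insert a s ha ih =>
    rw [Finset.prod_insert ha, Finset.prod_insert ha]
    exact (h.mul _ _).trans (mul_le_mul_of_nonneg_left ih (h.nonneg _))

theorem SN.pow {R : Type*} [CommRing R] {N : R → ℝ} (h : SN N) (a : R) (k : ℕ) :
    N (a ^ k) ≤ N a ^ k := by
  have := h.prod (Finset.range k) (fun _ => a)
  simpa using this

theorem SN.det {R : Type*} [CommRing R] {N : R → ℝ} (h : SN N) {ι : Type*} [Fintype ι]
    (M : Matrix ι ι R) (B : ι → ℝ) (hB : ∀ i j, N (M i j) ≤ B j) :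
    N M.det ≤ (Fintype.card ι).factorial * ∏ j, B j := by
  rw [Matrix.det_apply]
  refine (h.sum _ _).trans ?_
  have : ∀ σ ∈ (Finset.univ : Finset (Equiv.Perm ι)),
      N (Equiv.Perm.sign σ • ∏ i, M (σ i) i) ≤ ∏ j, B j := by
    intro σ _
    have e : N (Equiv.Perm.sign σ • ∏ i, M (σ i) i) = N (∏ i, M (σ i) i) := by
      rcases Int.units_eq_one_or (Equiv.Perm.sign σ) with hs | hs <;> simp [hs, h.neg]
    rw [e]
    exact (h.prod _ _).trans (Finset.prod_le_prod (fun i _ => h.nonneg _) (fun i _ => hB _ _))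
  refine (Finset.sum_le_card_nsmul _ _ _ this).trans ?_
  rw [Finset.card_univ, Fintype.card_perm, nsmul_eq_mul]

theorem SN_int : SN (fun a : ℤ => |(a : ℝ)|) where
  zero := by simp
  nonneg a := abs_nonneg _
  one := by simp
  add a b := by push_cast; exact abs_add_le _ _
  mul a b := by push_cast; rw [abs_mul]
  neg a := by simp

def nm {R : Type*} [CommRing R] (N : R → ℝ) {τ : Type*} (P : MvPolynomial τ R) : ℝ :=
  ∑ s ∈ P.support, N (P.coeff s)

theorem nm_eq {R : Type*} [CommRing R] {N : R → ℝ} (h : SN N) {τ : Type*}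
    (P : MvPolynomial τ R) (S : Finset (τ →₀ ℕ)) (hS : P.support ⊆ S) :
    nm N P = ∑ s ∈ S, N (P.coeff s) := by
  refine Finset.sum_subset hS ?_
  intro s _ hs
  rw [MvPolynomial.notMem_support_iff.1 hs, h.zero]

theorem nm_monomial {R : Type*} [CommRing R] {N : R → ℝ} (h : SN N) {τ : Type*}
    (s : τ →₀ ℕ) (a : R) : nm N (MvPolynomial.monomial s a) = N a := by
  rw [nm_eq h _ {s} MvPolynomial.support_monomial_subset]
  simp

theorem nm_add {R : Type*} [CommRing R] {N : R → ℝ} (h : SN N) {τ : Type*}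
    (P Q : MvPolynomial τ R) : nm N (P + Q) ≤ nm N P + nm N Q := by
  rw [nm_eq h P (P.support ∪ Q.support) Finset.subset_union_left,
    nm_eq h Q (P.support ∪ Q.support) Finset.subset_union_right,
    nm_eq h (P + Q) (P.support ∪ Q.support) MvPolynomial.support_add, ← Finset.sum_add_distrib]
  exact Finset.sum_le_sum fun s _ => by rw [MvPolynomial.coeff_add]; exact h.add _ _

theorem nm_sum {R : Type*} [CommRing R] {N : R → ℝ} (h : SN N) {τ ι : Type*} (S : Finset ι)
    (f : ι → MvPolynomial τ R) : nm N (∑ i ∈ S, f i) ≤ ∑ i ∈ S, nm N (f i) := by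
  induction S using Finset.induction_on with
  | empty => simp [nm]
  | insert a s ha ih =>
    rw [Finset.sum_insert ha, Finset.sum_insert ha]
    exact (nm_add h _ _).trans (by gcongr)

theorem SN.nm {R : Type*} [CommRing R] {N : R → ℝ} (h : SN N) {τ : Type*} :
    SN (nm N : MvPolynomial τ R → ℝ) where
  zero := by simp [EN.nm]
  nonneg P := Finset.sum_nonneg fun s _ => h.nonneg _
  one := by
    have := nm_monomial h (0 : τ →₀ ℕ) (1 : R)
    have e : (MvPolynomial.monomial (0 : τ →₀ ℕ) (1 : R)) = 1 := rfl
    rw [e] at this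
    rw [this]; exact h.one
  add := nm_add h
  mul P Q := by
    have e : P * Q = ∑ s ∈ P.support, ∑ t ∈ Q.support,
        MvPolynomial.monomial (s + t) (P.coeff s * Q.coeff t) := by
      conv_lhs => rw [P.as_sum, Q.as_sum, Finset.sum_mul_sum]
      simp [MvPolynomial.monomial_mul]
    rw [e]
    refine (nm_sum h _ _).trans ?_
    unfold EN.nm
    rw [Finset.sum_mul_sum]
    refine Finset.sum_le_sum fun s _ => (nm_sum h _ _).trans (Finset.sum_le_sum fun t _ => ?_)
    rw [nm_monomial h]
    exact h.mul _ _
  neg P := by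
    unfold EN.nm
    rw [MvPolynomial.support_neg]
    exact Finset.sum_congr rfl fun s _ => by rw [MvPolynomial.coeff_neg, h.neg]

theorem nm_C {R : Type*} [CommRing R] {N : R → ℝ} (h : SN N) {τ : Type*} (a : R) :
    nm N (MvPolynomial.C a : MvPolynomial τ R) = N a := nm_monomial h 0 a

theorem nm_X {R : Type*} [CommRing R] {N : R → ℝ} (h : SN N) {τ : Type*} (t : τ) :
    nm N (MvPolynomial.X t : MvPolynomial τ R) ≤ 1 := by
  rw [MvPolynomial.X, nm_monomial h]; exact h.one

theorem le_nm {R : Type*} [CommRing R] {N : R → ℝ} (h : SN N) {τ : Type*}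
    (P : MvPolynomial τ R) (s : τ →₀ ℕ) : N (P.coeff s) ≤ nm N P := by
  by_cases hs : s ∈ P.support
  · exact Finset.single_le_sum (f := fun s => N (P.coeff s)) (fun i _ => h.nonneg _) hs
  · rw [MvPolynomial.notMem_support_iff.1 hs, h.zero]; exact h.nm.nonneg P

/-- integer polynomial 1-norm -/
abbrev n1 {τ : Type*} (P : MvPolynomial τ ℤ) : ℝ := nm (fun a : ℤ => |(a : ℝ)|) P

/-- a multiplicative filtration by additive subgroups -/
structure Fil {R : Type*} [CommRing R] (G : ℕ → AddSubgroup R) : Prop where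
  one : (1 : R) ∈ G 0
  mul : ∀ {m m' : ℕ} {a b : R}, a ∈ G m → b ∈ G m' → a * b ∈ G (m + m')
  mono : ∀ {m m' : ℕ}, m ≤ m' → G m ≤ G m'

theorem Fil.pow {R : Type*} [CommRing R] {G : ℕ → AddSubgroup R} (h : Fil G) {m : ℕ} {a : R}
    (ha : a ∈ G m) (k : ℕ) : a ^ k ∈ G (m * k) := by
  induction k with
  | zero => simpa using h.one
  | succ k ih => rw [pow_succ, mul_add, mul_one]; exact h.mul ih ha

theorem Fil.prod {R : Type*} [CommRing R] {G : ℕ → AddSubgroup R} (h : Fil G) {ι : Type*}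
    (s : Finset ι) (f : ι → R) (m : ι → ℕ) (hf : ∀ i ∈ s, f i ∈ G (m i)) :
    ∏ i ∈ s, f i ∈ G (∑ i ∈ s, m i) := by
  induction s using Finset.induction_on with
  | empty => simpa using h.one
  | insert a s ha ih =>
    rw [Finset.prod_insert ha, Finset.sum_insert ha]
    exact h.mul (hf _ (Finset.mem_insert_self _ _))
      (ih fun i hi => hf i (Finset.mem_insert_of_mem hi))

theorem Fil.det {R : Type*} [CommRing R] {G : ℕ → AddSubgroup R} (h : Fil G) {ι : Type*}
    [Fintype ι] (M : Matrix ι ι R) (hM : ∀ i j, M i j ∈ G 1) :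
    M.det ∈ G (Fintype.card ι) := by
  rw [Matrix.det_apply]
  refine AddSubgroup.sum_mem _ fun σ _ => ?_
  have e : ∏ i, M (σ i) i ∈ G (Fintype.card ι) := by
    have := h.prod Finset.univ (fun i => M (σ i) i) (fun _ => 1) (fun i _ => hM _ _)
    simpa using this
  rcases Int.units_eq_one_or (Equiv.Perm.sign σ) with hs | hs
  · simpa [hs] using e
  · simpa [hs] using e

end EN

namespace EN

/-! ### Part 2: counting -/

def Nf (D n : ℕ) : ℕ := ∑ i ∈ Finset.range (n + 1), D ^ i

/-- exponents of total degree at most `m` -/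
def Sx (τ : Type*) [Fintype τ] (m : ℕ) : Finset (τ →₀ ℕ) :=
  (Finset.range (m + 1)).biUnion fun d => Finset.finsuppAntidiag Finset.univ d

theorem mem_Sx {τ : Type*} [Fintype τ] {m : ℕ} {s : τ →₀ ℕ} : s ∈ Sx τ m ↔ ∑ i, s i ≤ m := by
  simp [Sx]

theorem card_Sx (τ : Type*) [Fintype τ] (m : ℕ) :
    (Sx τ m).card = (m + Fintype.card τ).choose (Fintype.card τ) := by
  rw [Sx, Finset.card_biUnion]
  · simp only [Finset.card_finsuppAntidiag_nat_eq_multichoose, Finset.card_univ]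
    exact Nat.sum_range_multichoose _ _
  · intro a _ b _ hab
    rw [Function.onFun, Finset.disjoint_left]
    intro s hs hs'
    simp only [Finset.mem_finsuppAntidiag] at hs hs'
    exact hab (hs.1.symm.trans hs'.1)

def Ty (n D m : ℕ) : Set (Option (Fin n) →₀ ℕ) :=
  {s | s none ≤ m ∧ ∑ j, s (some j) ≤ m + (D - 1) * s none}

def eTy (n D N : ℕ) : ℕ := ∑ v ∈ Finset.range (N + 1), (N + (D - 1) * v + n).choose n

theorem Ty_injOn (n : ℕ) : Function.Injective
    (fun s : Option (Fin n) →₀ ℕ => (⟨s none, s.some⟩ : (_ : ℕ) × (Fin n →₀ ℕ))) := by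
  intro s t h
  simp only [Sigma.mk.injEq, heq_eq_eq] at h
  ext i
  cases i with
  | none => exact h.1
  | some j => exact DFunLike.congr_fun h.2 j

theorem Ty_finite (n D N : ℕ) : (Ty n D N).Finite := by
  refine Set.Finite.of_finite_image (f := fun s : Option (Fin n) →₀ ℕ =>
    (⟨s none, s.some⟩ : (_ : ℕ) × (Fin n →₀ ℕ))) ?_ (Ty_injOn n).injOn
  refine Set.Finite.subset ((Finset.range (N + 1)).sigma
    fun v => Sx (Fin n) (N + (D - 1) * v)).finite_toSet ?_
  rintro _ ⟨s, hs, rfl⟩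
  simp only [Finset.coe_sigma, Set.mem_sigma_iff, Finset.mem_coe, Finset.mem_range, mem_Sx]
  exact ⟨Nat.lt_succ_of_le hs.1, hs.2⟩

def TyF (n D N : ℕ) : Finset (Option (Fin n) →₀ ℕ) := (Ty_finite n D N).toFinset

theorem mem_TyF {n D N : ℕ} {s : Option (Fin n) →₀ ℕ} : s ∈ TyF n D N ↔ s ∈ Ty n D N := by
  simp [TyF]

theorem card_TyF_le (n D N : ℕ) : (TyF n D N).card ≤ eTy n D N := by
  have : (TyF n D N).card ≤ ((Finset.range (N + 1)).sigma
      fun v => Sx (Fin n) (N + (D - 1) * v)).card := by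
    refine Finset.card_le_card_of_injOn _ ?_ (Ty_injOn n).injOn
    intro s hs
    have hs' := mem_TyF.1 hs
    simp only [Finset.coe_sigma, Set.mem_sigma_iff, Finset.mem_coe, Finset.mem_range, mem_Sx]
    exact ⟨Nat.lt_succ_of_le hs'.1, hs'.2⟩
  rw [Finset.card_sigma] at this
  simpa [card_Sx, eTy] using this

theorem choose_diff (x c m : ℕ) :
    (x + c + m + 1).choose (m + 1) ≤ (x + m + 1).choose (m + 1) + c * (x + c + m).choose m := by
  induction c with
  | zero => simp
  | succ c ih =>
    have e : (x + (c + 1) + m + 1).choose (m + 1)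
        = (x + c + m + 1).choose m + (x + c + m + 1).choose (m + 1) := by
      rw [show x + (c + 1) + m + 1 = (x + c + m + 1) + 1 by ring, Nat.choose_succ_succ']
    rw [e, show x + (c + 1) + m = x + c + m + 1 by ring]
    have : (x + c + m).choose m ≤ (x + c + m + 1).choose m := Nat.choose_le_choose _ (by omega)
    nlinarith

theorem choose_diff' (x c m : ℕ) :
    (x + m + 1).choose (m + 1) + c * (x + m + 1).choose m ≤ (x + c + m + 1).choose (m + 1) := by
  induction c with
  | zero => simp
  | succ c ih =>
    have e : (x + (c + 1) + m + 1).choose (m + 1)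
        = (x + c + m + 1).choose m + (x + c + m + 1).choose (m + 1) := by
      rw [show x + (c + 1) + m + 1 = (x + c + m + 1) + 1 by ring, Nat.choose_succ_succ']
    rw [e]
    have : (x + m + 1).choose m ≤ (x + c + m + 1).choose m := Nat.choose_le_choose _ (by omega)
    nlinarith

theorem choose_mul_le (D M n : ℕ) (hD : 1 ≤ D) (hM : 1 ≤ M) :
    (D * M + n).choose (n + 1) ≤ D ^ (n + 1) * (M + n).choose (n + 1) := by
  have key : ∀ r : ℕ, (D * M).ascFactorial r ≤ D ^ r * M.ascFactorial r := by
    intro r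
    induction r with
    | zero => simp
    | succ r ih =>
      rw [Nat.ascFactorial_succ, Nat.ascFactorial_succ, pow_succ]
      have : D * M + r ≤ D * (M + r) := by nlinarith
      calc (D * M + r) * (D * M).ascFactorial r
          ≤ (D * (M + r)) * (D ^ r * M.ascFactorial r) := Nat.mul_le_mul this ih
        _ = _ := by ring
  have h := key (n + 1)
  have hDM : 1 ≤ D * M := Nat.mul_pos hD hM
  rw [Nat.ascFactorial_eq_factorial_mul_choose', Nat.ascFactorial_eq_factorial_mul_choose'] at h
  rw [show D * M + (n + 1) - 1 = D * M + n by omega, show M + (n + 1) - 1 = M + n by omega] at h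
  have hp := Nat.factorial_pos (n + 1)
  refine Nat.le_of_mul_le_mul_left ?_ hp
  calc _ ≤ _ := h
    _ = _ := by ring

theorem Nf_mul (D n : ℕ) (hD : 1 ≤ D) : (D - 1) * Nf D n + 1 = D ^ (n + 1) := by
  obtain ⟨d, rfl⟩ := Nat.exists_eq_add_of_le hD
  have := geom_sum_mul_add d (n + 1)
  rw [show d + 1 = 1 + d by ring] at this
  rw [← this, Nf, show 1 + d - 1 = d by omega]; ring

theorem eTy_le (n D N : ℕ) (hD : 2 ≤ D) : eTy n D N ≤ Nf D n * (N + n + 1).choose (n + 1) := by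
  obtain ⟨d, rfl⟩ := Nat.exists_eq_add_of_le hD
  have h1 : ∀ M : ℕ, (N + n + 1).choose (n + 1) + (d + 1) *
      ∑ v ∈ Finset.range M, (N + (d + 1) * v + n).choose n ≤
      (N + (d + 1) * M + n + 1).choose (n + 1) := by
    intro M
    induction M with
    | zero => simp
    | succ M ih =>
      rw [Finset.sum_range_succ]
      have := choose_diff' (N + (d + 1) * M) (d + 1) n
      rw [show N + (d + 1) * M + (d + 1) + n + 1 = N + (d + 1) * (M + 1) + n + 1 by ring] at this
      have h2 : (N + (d + 1) * M + n).choose n ≤ (N + (d + 1) * M + n + 1).choose n :=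
        Nat.choose_le_choose _ (by omega)
      nlinarith
  have h2 := h1 (N + 1)
  have h3 := choose_mul_le (2 + d) (N + 1) n (by omega) (by omega)
  rw [show (2 + d) * (N + 1) + n = N + (d + 1) * (N + 1) + n + 1 by ring] at h3
  rw [← Nf_mul (2 + d) n (by omega), show N + 1 + n = N + n + 1 by ring,
    show 2 + d - 1 = d + 1 by omega] at h3
  rw [eTy, show 2 + d - 1 = d + 1 by omega]
  have h4 := h2.trans h3
  refine Nat.le_of_mul_le_mul_left (c := d + 1) ?_ (by omega)
  nlinarith

theorem choose_succ_mul (N m : ℕ) :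
    (m + 1) * (N + m + 1).choose (m + 1) = (N + m + 1) * (N + m).choose m := by
  have := Nat.add_one_mul_choose_eq (N + m) m
  linarith

theorem count_C1 (n D : ℕ) (hD : 2 ≤ D) :
    (TyF n D ((n + 2) * Nf D n)).card < ((n + 2) * Nf D n + (n + 2)).choose (n + 2) := by
  set N := (n + 2) * Nf D n
  have h1 := (card_TyF_le n D N).trans (eTy_le n D N hD)
  have h2 := choose_succ_mul N (n + 1)
  have h3 : 0 < (N + (n + 1)).choose (n + 1) := Nat.choose_pos (by omega)
  refine lt_of_le_of_lt h1 ?_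
  rw [show N + n + 1 = N + (n + 1) by ring]
  rw [show N + (n + 1) + 1 = N + (n + 2) by ring, show n + 1 + 1 = n + 2 by ring] at h2
  refine Nat.lt_of_mul_lt_mul_left (a := n + 2) ?_
  rw [h2]
  have : (n + 2) * (Nf D n * (N + (n + 1)).choose (n + 1)) = N * (N + (n + 1)).choose (n + 1) := by
    simp only [N]; ring
  rw [this]
  exact Nat.mul_lt_mul_of_pos_right (by omega) h3

/-- exponents (a,b) with |a| + (n+1) b ≤ N -/
def UF (n N : ℕ) : Finset ((_ : ℕ) × (Option (Fin n) →₀ ℕ)) :=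
  (Finset.range (N / (n + 1) + 1)).sigma fun b => Sx (Option (Fin n)) (N - (n + 1) * b)

theorem mem_UF {n N : ℕ} {b : ℕ} {a : Option (Fin n) →₀ ℕ} :
    (⟨b, a⟩ : (_ : ℕ) × (Option (Fin n) →₀ ℕ)) ∈ UF n N ↔ ∑ i, a i + (n + 1) * b ≤ N := by
  simp only [UF, Finset.mem_sigma, Finset.mem_range, mem_Sx]
  rw [Nat.lt_succ_iff, Nat.le_div_iff_mul_le (by omega), mul_comm b]
  omega

theorem card_UF (n N : ℕ) : (UF n N).card =
    ∑ b ∈ Finset.range (N / (n + 1) + 1), (N - (n + 1) * b + (n + 1)).choose (n + 1) := by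
  rw [UF, Finset.card_sigma]
  simp [card_Sx]

theorem card_UF_add (n N : ℕ) : (UF n (N + (n + 1))).card =
    (N + (n + 1) + (n + 1)).choose (n + 1) + (UF n N).card := by
  rw [card_UF, card_UF, Nat.add_div_right _ (by omega), Finset.sum_range_succ', add_comm]
  congr 1
  refine Finset.sum_congr rfl fun b _ => ?_
  congr 2
  rw [mul_add]; omega

theorem card_UF_ge (n N : ℕ) : (N + n + 2).choose (n + 2) ≤ (n + 1) * (UF n N).card := by
  induction N using Nat.strong_induction_on with
  | _ N ih =>
    rcases lt_or_ge N (n + 1) with h | h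
    · rw [card_UF, Nat.div_eq_of_lt h]
      have h1 := Nat.sum_range_add_choose N (n + 1)
      simp only [zero_add, Finset.range_one, Finset.sum_singleton, mul_zero, Nat.sub_zero]
      rw [show N + n + 2 = N + (n + 1) + 1 by ring, show n + 2 = n + 1 + 1 by ring, ← h1]
      calc _ ≤ ∑ i ∈ Finset.range (N + 1), (N + (n + 1)).choose (n + 1) :=
            Finset.sum_le_sum fun i hi => Nat.choose_le_choose _
              (by have := Finset.mem_range.1 hi; omega)
        _ = (N + 1) * (N + (n + 1)).choose (n + 1) := by simp
        _ ≤ _ := Nat.mul_le_mul_right _ (by omega)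
    · obtain ⟨M, rfl⟩ := Nat.exists_eq_add_of_le' h
      rw [card_UF_add]
      have h1 := ih M (by omega)
      have h2 := choose_diff M (n + 1) (n + 1)
      rw [show M + (n + 1) + n + 2 = M + (n + 1) + (n + 1) + 1 by ring]
      rw [show M + (n + 1) + 1 = M + n + 2 by ring] at h2
      nlinarith

theorem count_Siegel (n D r : ℕ) (hD : 2 ≤ D) :
    r * (TyF n D (r * ((n + 1) * (n + 2) * Nf D n))).card ≤
      (UF n (r * ((n + 1) * (n + 2) * Nf D n))).card := by
  set N := r * ((n + 1) * (n + 2) * Nf D n) with hN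
  have h1 := (card_TyF_le n D N).trans (eTy_le n D N hD)
  have h2 := card_UF_ge n N
  have h3 := choose_succ_mul N (n + 1)
  rw [show N + (n + 1) + 1 = N + n + 2 by ring, show n + 1 + 1 = n + 2 by ring,
    show N + (n + 1) = N + n + 1 by ring] at h3
  refine Nat.le_of_mul_le_mul_left (c := (n + 1) * (n + 2)) ?_ (by positivity)
  calc (n + 1) * (n + 2) * (r * (TyF n D N).card)
      ≤ (n + 1) * (n + 2) * (r * (Nf D n * (N + n + 1).choose (n + 1))) := by gcongr
    _ = N * (N + n + 1).choose (n + 1) := by rw [hN]; ring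
    _ ≤ (N + n + 2) * (N + n + 1).choose (n + 1) := Nat.mul_le_mul_right _ (by omega)
    _ = (n + 2) * (N + n + 2).choose (n + 2) := h3.symm
    _ ≤ (n + 2) * ((n + 1) * (UF n N).card) := by gcongr
    _ = _ := by ring

theorem card_UF_mul (n N t : ℕ) :
    t * (N + (n + 1)).choose (n + 1) + (UF n N).card ≤ (UF n (N + (n + 1) * t)).card := by
  induction t with
  | zero => simp
  | succ t ih =>
    rw [show N + (n + 1) * (t + 1) = N + (n + 1) * t + (n + 1) by ring, card_UF_add]
    have : (N + (n + 1)).choose (n + 1) ≤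
      (N + (n + 1) * t + (n + 1) + (n + 1)).choose (n + 1) :=
      Nat.choose_le_choose _ (by nlinarith)
    nlinarith

/-- degree contradiction -/
theorem count_deg (n D : ℕ) (hD : 2 ≤ D) : ∃ N : ℕ,
    (TyF n D (N + (n + 1) * (Nf D n + 1))).card + (UF n N).card <
      (UF n (N + (n + 1) * (Nf D n + 1))).card := by
  set c := (n + 1) * (Nf D n + 1) with hc
  set N := (n + 1) * c * (Nf D n + 1) with hN
  refine ⟨N, ?_⟩
  have h1 := (card_TyF_le n D (N + c)).trans (eTy_le n D (N + c) hD)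
  have h2 := card_UF_mul n N (Nf D n + 1)
  rw [← hc] at h2
  refine lt_of_lt_of_le ?_ h2
  refine Nat.add_lt_add_right (lt_of_le_of_lt h1 ?_) _
  have h3 := choose_diff N c n
  have h4 := choose_succ_mul (N + c) n
  -- (n+1) C(N+c+n+1, n+1) = (N+c+n+1) C(N+c+n,n)
  set a := (N + c + n + 1).choose (n + 1)
  set b := (N + n + 1).choose (n + 1)
  set e := (N + c + n).choose n
  have he : 0 < e := Nat.choose_pos (by omega)
  have : (N + (n + 1)).choose (n + 1) = b := by simp only [b]; rfl
  rw [this]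
  -- Nf a < (Nf+1) b ; b ≥ a - c e ; (Nf+1) c e < a
  have h5 : (Nf D n + 1) * (c * e) < a := by
    refine Nat.lt_of_mul_lt_mul_left (a := n + 1) ?_
    rw [h4]
    calc (n + 1) * ((Nf D n + 1) * (c * e)) = N * e := by rw [hN]; ring
      _ < _ := Nat.mul_lt_mul_of_pos_right (by omega) he
  nlinarith

end EN

namespace EN
open MeasureTheory

/-! ### Part 3: Mahler measures -/

def nuC : Measure ℝ := (ENNReal.ofReal (2 * Real.pi))⁻¹ • volume.restrict (Set.Ioc 0 (2 * Real.pi))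

instance : IsProbabilityMeasure nuC := by
  constructor
  have h : (0 : ℝ) < 2 * Real.pi := by positivity
  simp only [nuC, Measure.smul_apply, Measure.restrict_apply MeasurableSet.univ, Set.univ_inter,
    Real.volume_Ioc, sub_zero, smul_eq_mul]
  exact ENNReal.inv_mul_cancel (by simpa using Real.pi_pos) ENNReal.ofReal_ne_top

def cm (θ : ℝ) : ℂ := circleMap 0 1 θ

theorem cm_norm (θ : ℝ) : ‖cm θ‖ = 1 := by simp [cm, circleMap]

theorem cm_meas : Measurable cm := (continuous_circleMap 0 1).measurable

theorem nuC_integral (f : ℂ → ℝ) : ∫ θ, f (cm θ) ∂nuC = Real.circleAverage f 0 1 := by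
  have h : (0 : ℝ) ≤ 2 * Real.pi := by positivity
  rw [nuC, integral_smul_measure, Real.circleAverage_def, intervalIntegral.integral_of_le h]
  congr 1
  rw [ENNReal.toReal_inv, ENNReal.toReal_ofReal h]

theorem nuC_integrable (p : Polynomial ℂ) : Integrable (fun θ => Real.log ‖p.eval (cm θ)‖) nuC := by
  have h : (0 : ℝ) ≤ 2 * Real.pi := by positivity
  have := p.intervalIntegrable_mahlerMeasure
  rw [intervalIntegrable_iff_integrableOn_Ioc_of_le h] at this
  refine Integrable.smul_measure this ?_
  simpa using Real.pi_pos

theorem nuC_ae (p : Polynomial ℂ) (hp : p ≠ 0) : ∀ᵐ θ ∂nuC, p.eval (cm θ) ≠ 0 := by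
  have hac : nuC ≪ volume := by
    refine Measure.AbsolutelyContinuous.trans (Measure.smul_absolutelyContinuous) ?_
    exact Measure.absolutelyContinuous_of_le Measure.restrict_le_self
  refine hac.ae_le ?_
  have hc : {θ : ℝ | p.eval (cm θ) = 0}.Countable := by
    have : {θ : ℝ | p.eval (cm θ) = 0} = cm ⁻¹' (p.roots.toFinset : Set ℂ) := by
      ext θ; simp [hp]
    rw [this]
    refine Set.Countable.preimage_circleMap (Finset.countable_toSet _) _ one_ne_zero
  have := hc.measure_zero volume
  change ∀ᵐ θ : ℝ, p.eval (cm θ) ≠ 0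
  rw [ae_iff]
  simpa using this

theorem mahler_coeff (p : Polynomial ℂ) (a d : ℕ) (hd : p.natDegree ≤ d) (ha : p.coeff a ≠ 0) :
    Real.log ‖p.coeff a‖ - Real.log (d.choose a) ≤ ∫ θ, Real.log ‖p.eval (cm θ)‖ ∂nuC := by
  have hp : p ≠ 0 := by rintro rfl; simp at ha
  rw [nuC_integral (fun z => Real.log ‖p.eval z‖), ← Polynomial.logMahlerMeasure_def,
    Polynomial.logMahlerMeasure_eq_log_MahlerMeasure]
  have h1 := p.norm_coeff_le_choose_mul_mahlerMeasure a
  have h2 := p.mahlerMeasure_pos_of_ne_zero hp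
  have had : a ≤ d := (Polynomial.le_natDegree_of_ne_zero ha).trans hd
  have h3 : (0 : ℝ) < d.choose a := by exact_mod_cast Nat.choose_pos had
  have h4 : ‖p.coeff a‖ ≤ d.choose a * p.mahlerMeasure := by
    refine h1.trans (mul_le_mul_of_nonneg_right ?_ h2.le)
    exact_mod_cast Nat.choose_le_choose _ hd
  have := Real.log_le_log (norm_pos_iff.2 ha) h4
  rw [Real.log_mul h3.ne' h2.ne'] at this
  linarith

structure MG {R : Type*} [CommRing R] {X : Type} [MeasurableSpace X] (μ : Measure X)
    (φ : R →+* (X → ℂ)) : Prop where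
  prob : IsProbabilityMeasure μ
  meas : ∀ r, Measurable (φ r)
  bdd : ∀ r, ∃ K : ℝ, ∀ x, ‖φ r x‖ ≤ K
  ae : ∀ r ≠ 0, ∀ᵐ x ∂μ, φ r x ≠ 0
  int : ∀ r ≠ 0, Integrable (fun x => Real.log ‖φ r x‖) μ
  nn : ∀ r ≠ 0, 0 ≤ ∫ x, Real.log ‖φ r x‖ ∂μ

theorem MG.mul {R : Type*} [CommRing R] {X : Type} [MeasurableSpace X] {μ : Measure X}
    {φ : R →+* (X → ℂ)} (h : MG μ φ) (a b : R) (ha : a ≠ 0) (hb : b ≠ 0) :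
    ∫ x, Real.log ‖φ (a * b) x‖ ∂μ = ∫ x, Real.log ‖φ a x‖ ∂μ + ∫ x, Real.log ‖φ b x‖ ∂μ := by
  rw [← integral_add (h.int a ha) (h.int b hb)]
  refine integral_congr_ae ?_
  filter_upwards [h.ae a ha, h.ae b hb] with x h1 h2
  rw [map_mul, Pi.mul_apply, norm_mul, Real.log_mul (norm_ne_zero_iff.2 h1) (norm_ne_zero_iff.2 h2)]

/-- the extension to one more variable -/
def phiP {R : Type*} [CommRing R] {X : Type} (φ : R →+* (X → ℂ)) :
    Polynomial R →+* (X × ℝ → ℂ) :=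
  RingHom.pi fun z => Polynomial.eval₂RingHom ((Pi.evalRingHom (fun _ => ℂ) z.1).comp φ) (cm z.2)

theorem phiP_apply {R : Type*} [CommRing R] {X : Type} (φ : R →+* (X → ℂ)) (P : Polynomial R)
    (z : X × ℝ) : phiP φ P z =
      (P.map ((Pi.evalRingHom (fun _ => ℂ) z.1).comp φ)).eval (cm z.2) := by
  rw [Polynomial.eval_map]; rfl

theorem phiP_sum {R : Type*} [CommRing R] {X : Type} (φ : R →+* (X → ℂ)) (P : Polynomial R)
    (z : X × ℝ) : phiP φ P z = ∑ a ∈ P.support, φ (P.coeff a) z.1 * cm z.2 ^ a := by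
  rw [phiP_apply, Polynomial.eval_map, Polynomial.eval₂_eq_sum, Polynomial.sum]; rfl

theorem MG.poly_aux {R : Type*} [CommRing R] {X : Type} [MeasurableSpace X] {μ : Measure X}
    {φ : R →+* (X → ℂ)} (h : MG μ φ) (P : Polynomial R) (a d : ℕ) (ha : P.coeff a ≠ 0)
    (hd : P.natDegree ≤ d) :
    Measurable (phiP φ P) ∧ (∃ K : ℝ, ∀ z, ‖phiP φ P z‖ ≤ K) ∧
    (∀ᵐ z ∂(μ.prod nuC), phiP φ P z ≠ 0) ∧
    Integrable (fun z => Real.log ‖phiP φ P z‖) (μ.prod nuC) ∧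
    ∫ x, Real.log ‖φ (P.coeff a) x‖ ∂μ - Real.log (d.choose a) ≤
      ∫ z, Real.log ‖phiP φ P z‖ ∂(μ.prod nuC) := by
  have := h.prob
  have hm : Measurable (phiP φ P) := by
    have : phiP φ P = fun z => ∑ a ∈ P.support, φ (P.coeff a) z.1 * cm z.2 ^ a :=
      funext (phiP_sum φ P)
    rw [this]
    refine Finset.measurable_sum _ fun a _ => ?_
    exact ((h.meas _).comp measurable_fst).mul ((cm_meas.comp measurable_snd).pow_const _)
  choose K hK using h.bdd
  have hb : ∀ z, ‖phiP φ P z‖ ≤ max 1 (∑ a ∈ P.support, K (P.coeff a)) := by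
    intro z
    rw [phiP_sum]
    refine (norm_sum_le _ _).trans (le_trans ?_ (le_max_right _ _))
    refine Finset.sum_le_sum fun a _ => ?_
    rw [norm_mul, norm_pow, cm_norm, one_pow, mul_one]
    exact hK _ _
  set B := max 1 (∑ a ∈ P.support, K (P.coeff a))
  have hB1 : 1 ≤ B := le_max_left _ _
  have hlogB : 0 ≤ Real.log B := Real.log_nonneg hB1
  have hlog : ∀ z, Real.log ‖phiP φ P z‖ ≤ Real.log B := by
    intro z
    rcases (norm_nonneg (phiP φ P z)).eq_or_lt with h0 | h0
    · rw [← h0, Real.log_zero]; exact hlogB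
    · exact Real.log_le_log h0 (hb z)
  let p : X → Polynomial ℂ := fun x => P.map ((Pi.evalRingHom (fun _ => ℂ) x).comp φ)
  have hpc : ∀ x, (p x).coeff a = φ (P.coeff a) x := fun x => by simp [p]
  have hpe : ∀ x θ, phiP φ P (x, θ) = (p x).eval (cm θ) := fun x θ => phiP_apply φ P _
  have hpd : ∀ x, (p x).natDegree ≤ d := fun x => Polynomial.natDegree_map_le.trans hd
  have hae := h.ae _ ha
  have hz : ∀ᵐ z ∂(μ.prod nuC), phiP φ P z ≠ 0 := by
    have hs : MeasurableSet {z | phiP φ P z ≠ 0} := (hm (measurableSet_singleton 0)).compl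
    refine (Measure.ae_prod_mem_iff_ae_ae_mem hs).2 ?_
    filter_upwards [hae] with x hx
    have hpx : p x ≠ 0 := by intro h0; apply hx; rw [← hpc, h0]; simp
    filter_upwards [nuC_ae (p x) hpx] with θ hθ
    simpa [hpe] using hθ
  have hsm : AEStronglyMeasurable (fun z => Real.log ‖phiP φ P z‖) (μ.prod nuC) :=
    (Real.measurable_log.comp hm.norm).aestronglyMeasurable
  have hlow : ∀ᵐ x ∂μ, Real.log ‖φ (P.coeff a) x‖ - Real.log (d.choose a) ≤
      ∫ θ, Real.log ‖phiP φ P (x, θ)‖ ∂nuC := by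
    filter_upwards [hae] with x hx
    have := mahler_coeff (p x) a d (hpd x) (by rwa [hpc])
    simpa [hpe, hpc] using this
  have hin : ∀ x, Integrable (fun θ => Real.log ‖phiP φ P (x, θ)‖) nuC := by
    intro x; simp only [hpe]; exact nuC_integrable _
  have hI : Integrable (fun z => Real.log ‖phiP φ P z‖) (μ.prod nuC) := by
    rw [integrable_prod_iff hsm]
    refine ⟨Filter.Eventually.of_forall hin, ?_⟩
    refine Integrable.mono' (g := fun x => 2 * Real.log B -
      (Real.log ‖φ (P.coeff a) x‖ - Real.log (d.choose a)))
      ((integrable_const _).sub ((h.int _ ha).sub (integrable_const _))) hsm.norm.integral_prod_right' ?_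
    filter_upwards [hlow] with x hx
    have h1 : ∫ θ, ‖Real.log ‖phiP φ P (x, θ)‖‖ ∂nuC ≤
        ∫ θ, (2 * Real.log B - Real.log ‖phiP φ P (x, θ)‖) ∂nuC := by
      refine integral_mono (hin x).norm ((integrable_const _).sub (hin x)) fun θ => ?_
      have := hlog (x, θ)
      simp only [Real.norm_eq_abs]
      rw [abs_le]
      constructor <;> linarith
    rw [integral_sub (integrable_const _) (hin x)] at h1
    simp only [integral_const, probReal_univ, smul_eq_mul, one_mul] at h1
    rw [Real.norm_of_nonneg (integral_nonneg fun θ => norm_nonneg _)]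
    linarith
  refine ⟨hm, ⟨B, hb⟩, hz, hI, ?_⟩
  rw [integral_prod _ hI]
  have : ∫ x, Real.log ‖φ (P.coeff a) x‖ ∂μ - Real.log (d.choose a) =
      ∫ x, (Real.log ‖φ (P.coeff a) x‖ - Real.log (d.choose a)) ∂μ := by
    rw [integral_sub (h.int _ ha) (integrable_const _)]; simp
  rw [this]
  exact integral_mono_ae ((h.int _ ha).sub (integrable_const _)) hI.integral_prod_left hlow

theorem MG.poly {R : Type*} [CommRing R] {X : Type} [MeasurableSpace X] {μ : Measure X}
    {φ : R →+* (X → ℂ)} (h : MG μ φ) : MG (μ.prod nuC) (phiP φ) where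
  prob := by have := h.prob; infer_instance
  meas P := by
    by_cases hP : P = 0
    · rw [hP, map_zero]; exact measurable_const
    · exact (h.poly_aux P _ _ (Polynomial.leadingCoeff_ne_zero.2 hP) le_rfl).1
  bdd P := by
    by_cases hP : P = 0
    · rw [hP, map_zero]; exact ⟨0, by simp⟩
    · exact (h.poly_aux P _ _ (Polynomial.leadingCoeff_ne_zero.2 hP) le_rfl).2.1
  ae P hP := (h.poly_aux P _ _ (Polynomial.leadingCoeff_ne_zero.2 hP) le_rfl).2.2.1
  int P hP := (h.poly_aux P _ _ (Polynomial.leadingCoeff_ne_zero.2 hP) le_rfl).2.2.2.1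
  nn P hP := by
    have h1 := (h.poly_aux P _ _ (Polynomial.leadingCoeff_ne_zero.2 hP) le_rfl).2.2.2.2
    have h2 := h.nn _ (Polynomial.leadingCoeff_ne_zero.2 hP)
    rw [Nat.choose_self, Nat.cast_one, Real.log_one, sub_zero] at h1
    exact h2.trans h1

theorem MG.comp {R S : Type*} [CommRing R] [CommRing S] {X : Type} [MeasurableSpace X]
    {μ : Measure X} {φ : R →+* (X → ℂ)} (h : MG μ φ) (e : S ≃+* R) :
    MG μ (φ.comp (e : S →+* R)) where
  prob := h.prob
  meas r := h.meas _
  bdd r := h.bdd _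
  ae r hr := h.ae _ (by simpa using hr)
  int r hr := h.int _ (by simpa using hr)
  nn r hr := h.nn _ (by simpa using hr)

/-- `L` is a logarithmic Mahler measure on `R`, bounded by the log of the norm `N`. -/
def LMS (R : Type*) [CommRing R] (N : R → ℝ) (L : R → ℝ) : Prop :=
  ∃ (X : Type) (_ : MeasurableSpace X) (μ : Measure X) (φ : R →+* (X → ℂ)),
    MG μ φ ∧ (∀ r x, ‖φ r x‖ ≤ N r) ∧ ∀ r, L r = ∫ x, Real.log ‖φ r x‖ ∂μ

theorem LMS.mul {R : Type*} [CommRing R] {N L : R → ℝ} (h : LMS R N L) (a b : R) (ha : a ≠ 0)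
    (hb : b ≠ 0) : L (a * b) = L a + L b := by
  obtain ⟨X, _, μ, φ, h, -, hL⟩ := h
  rw [hL, hL, hL, h.mul a b ha hb]

theorem LMS.nonneg {R : Type*} [CommRing R] {N L : R → ℝ} (h : LMS R N L) (a : R) (ha : a ≠ 0) :
    0 ≤ L a := by
  obtain ⟨X, _, μ, φ, h, -, hL⟩ := h
  rw [hL]; exact h.nn a ha

theorem LMS.le {R : Type*} [CommRing R] {N L : R → ℝ} (h : LMS R N L) (a : R) (ha : a ≠ 0) :
    L a ≤ Real.log (N a) := by
  obtain ⟨X, _, μ, φ, h, hN, hL⟩ := h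
  have := h.prob
  rw [hL]
  have : Real.log (N a) = ∫ x, Real.log (N a) ∂μ := by simp
  rw [this]
  refine integral_mono_ae (h.int a ha) (integrable_const _) ?_
  filter_upwards [h.ae a ha] with x hx
  exact Real.log_le_log (norm_pos_iff.2 hx) (hN _ _)

theorem LMS_int : LMS ℤ (fun a => |(a : ℝ)|) (fun a => Real.log |(a : ℝ)|) := by
  refine ⟨Unit, inferInstance, Measure.dirac (), RingHom.pi fun _ => Int.castRingHom ℂ, ?_, ?_, ?_⟩
  · constructor
    · infer_instance
    · intro r; exact measurable_const
    · intro r; exact ⟨‖(r : ℂ)‖, fun x => by simp [RingHom.pi_apply]⟩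
    · intro r hr; exact Filter.Eventually.of_forall fun x => by simpa [RingHom.pi_apply] using hr
    · intro r hr; exact integrable_const (μ := Measure.dirac ()) (Real.log ‖(r : ℂ)‖)
    · intro r hr
      simp only [RingHom.pi_apply, eq_intCast, Complex.norm_intCast, integral_const,
        probReal_univ, smul_eq_mul, one_mul]
      refine Real.log_nonneg ?_
      exact_mod_cast Int.one_le_abs hr
  · intro r x; simp [RingHom.pi_apply]
  · intro r; simp [RingHom.pi_apply]

theorem LMS_fin_aux {R : Type*} [CommRing R] {X : Type} [MeasurableSpace X] {μ : Measure X}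
    {φ : R →+* (X → ℂ)} (h : MG μ φ) (m : ℕ) :
    ∃ (X' : Type) (_ : MeasurableSpace X') (μ' : Measure X')
      (φ' : MvPolynomial (Fin m) R →+* (X' → ℂ)),
      MG μ' φ' ∧ (∀ a x, ∃ y, φ' (MvPolynomial.C a) x = φ a y) ∧
      (∀ i x, ‖φ' (MvPolynomial.X i) x‖ ≤ 1) ∧
      ∀ (P : MvPolynomial (Fin m) R) (c : Fin m →₀ ℕ) (d : Fin m → ℕ),
        (∀ i, P.degreeOf i ≤ d i) → P.coeff c ≠ 0 →
        ∫ x, Real.log ‖φ (P.coeff c) x‖ ∂μ ≤ ∫ x, Real.log ‖φ' P x‖ ∂μ' +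
          ∑ i, Real.log ((d i).choose (c i)) := by
  induction m with
  | zero =>
    let e := (MvPolynomial.isEmptyRingEquiv R (Fin 0))
    refine ⟨X, inferInstance, μ, φ.comp (e : MvPolynomial (Fin 0) R →+* R), h.comp e, ?_, ?_, ?_⟩
    have he : ∀ a, e (MvPolynomial.C a) = a := fun a => MvPolynomial.coeff_zero_C a
    · intro a x; exact ⟨x, by simp [he]⟩
    · intro i; exact i.elim0
    · intro P c d hd hc
      have : P = MvPolynomial.C (P.coeff c) := by
        conv_lhs => rw [MvPolynomial.eq_C_of_isEmpty P]
        rw [Subsingleton.elim c 0]; 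
      have h2 : e P = P.coeff c := by
        conv_lhs => rw [this]
        exact MvPolynomial.coeff_zero_C _
      simp [h2]
  | succ m ih =>
    obtain ⟨X', hX', μ', φ', h', hC, hX, hb⟩ := ih
    let e := (MvPolynomial.finSuccEquiv R m).toRingEquiv
    refine ⟨X' × ℝ, inferInstance, μ'.prod nuC,
      (phiP φ').comp (e : MvPolynomial (Fin (m + 1)) R →+* _), h'.poly.comp e, ?_, ?_, ?_⟩
    · intro a z
      obtain ⟨y, hy⟩ := hC a z.1
      refine ⟨y, ?_⟩
      simp [e, phiP_apply, MvPolynomial.finSuccEquiv_apply, ← hy]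
    · intro i z
      refine Fin.cases ?_ ?_ i
      · simp [e, phiP_apply, cm_norm, MvPolynomial.finSuccEquiv_X_zero]
      · intro j
        simpa [e, phiP_apply, MvPolynomial.finSuccEquiv_X_succ] using hX j z.1
    · intro P c d hd hc
      have e1 : ((MvPolynomial.finSuccEquiv R m P).coeff (c 0)).coeff c.tail = P.coeff c := by
        rw [MvPolynomial.finSuccEquiv_coeff_coeff, Finsupp.cons_tail]
      have hne : (MvPolynomial.finSuccEquiv R m P).coeff (c 0) ≠ 0 := by
        intro h0; rw [h0] at e1; apply hc; rw [← e1]; simp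
      have h1 := hb _ c.tail (fun i => d i.succ) (fun i =>
        (MvPolynomial.degreeOf_coeff_finSuccEquiv P i (c 0)).trans (hd _)) (by rwa [e1])
      have h2 := (h'.poly_aux (MvPolynomial.finSuccEquiv R m P) (c 0) (d 0) hne
        (by rw [MvPolynomial.natDegree_finSuccEquiv]; exact hd 0)).2.2.2.2
      rw [e1] at h1
      rw [Fin.sum_univ_succ]
      simp only [Finsupp.tail_apply] at h1
      have e2 : ∀ x, ((phiP φ').comp (e : MvPolynomial (Fin (m + 1)) R →+* _)) P x =
        phiP φ' (MvPolynomial.finSuccEquiv R m P) x := fun x => rfl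
      simp only [e2]
      linarith

theorem LMS.mv {R : Type*} [CommRing R] {N L : R → ℝ} (h : LMS R N L)
    (τ : Type*) [Fintype τ] : ∃ L' : MvPolynomial τ R → ℝ, LMS (MvPolynomial τ R) (nm N) L' ∧
      ∀ (P : MvPolynomial τ R) (c : τ →₀ ℕ) (d : τ → ℕ), (∀ i, P.degreeOf i ≤ d i) →
        P.coeff c ≠ 0 → L (P.coeff c) ≤ L' P + ∑ i, Real.log ((d i).choose (c i)) := by
  obtain ⟨X, _, μ, φ, h, hb, hL⟩ := h
  obtain ⟨X', hX', μ', φ', h', hC, hX, hb'⟩ := LMS_fin_aux h (Fintype.card τ)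
  let f := Fintype.equivFin τ
  let e := (MvPolynomial.renameEquiv R f).toRingEquiv
  refine ⟨fun P => ∫ x, Real.log ‖(φ'.comp (e : MvPolynomial τ R →+* _)) P x‖ ∂μ',
    ⟨X', hX', μ', φ'.comp (e : MvPolynomial τ R →+* _), h'.comp e, ?_, fun _ => rfl⟩, ?_⟩
  · intro P x
    have e1 : ∀ P, (φ'.comp (e : MvPolynomial τ R →+* _)) P x = φ' (MvPolynomial.rename f P) x :=
      fun _ => rfl
    rw [e1]
    conv_lhs => rw [P.as_sum]
    rw [map_sum, map_sum, Finset.sum_apply]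
    refine (norm_sum_le _ _).trans (Finset.sum_le_sum fun s _ => ?_)
    rw [MvPolynomial.rename_monomial, MvPolynomial.monomial_eq, map_mul, Pi.mul_apply, norm_mul]
    obtain ⟨y, hy⟩ := hC (P.coeff s) x
    rw [hy]
    refine (mul_le_of_le_one_right (norm_nonneg _) ?_).trans (hb _ _)
    rw [Finsupp.prod, map_prod, Finset.prod_apply, norm_prod]
    refine Finset.prod_le_one (fun _ _ => norm_nonneg _) fun i _ => ?_
    rw [map_pow, Pi.pow_apply, norm_pow]
    exact pow_le_one₀ (norm_nonneg _) (hX _ _)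
  · intro P c d hd hc
    have h1 := hb' (MvPolynomial.rename f P) (c.mapDomain f) (fun i => d (f.symm i)) ?_ ?_
    · rw [MvPolynomial.coeff_rename_mapDomain _ f.injective, ← hL] at h1
      refine h1.trans (le_of_eq ?_)
      congr 1
      rw [← Equiv.sum_comp f]
      refine Finset.sum_congr rfl fun i _ => ?_
      rw [Finsupp.mapDomain_apply f.injective, Equiv.symm_apply_apply]
    · intro i
      obtain ⟨j, rfl⟩ := f.surjective i
      rw [MvPolynomial.degreeOf_rename_of_injective f.injective, Equiv.symm_apply_apply]
      exact hd j
    · rwa [MvPolynomial.coeff_rename_mapDomain _ f.injective]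

end EN

namespace EN
open MvPolynomial

/-! ### Part 4: integrality -/

theorem deg_eq_sum {τ : Type*} [Fintype τ] (s : τ →₀ ℕ) : s.degree = ∑ i, s i :=
  Finsupp.degree_eq_sum s

theorem exists_shift {τ : Type*} [Fintype τ] (P : MvPolynomial (Option τ) ℚ) (hP : P ≠ 0) (d0 : ℕ)
    (hd : P.totalDegree ≤ d0) {B : Type*} [CommRing B] [Algebra ℚ B] (T : τ → B) (y : B)
    (h : aeval (fun o : Option τ => o.elim y T) P = 0) :
    ∃ c : τ → ℕ, (∀ i, c i ≤ d0) ∧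
      IsIntegral (Algebra.adjoin ℚ (Set.range fun i => T i + (c i : B) * y)) y := by
  set e := P.totalDegree with he
  set S := P.support.filter (fun s => ∑ i, s i = e) with hS
  let H : MvPolynomial τ ℚ := ∑ s ∈ S, monomial s.some (P.coeff s * (-1) ^ (∑ i, s (some i)))
  have hle : ∀ s ∈ P.support, ∑ i, s i ≤ e := by
    intro s hs
    rw [← deg_eq_sum]
    exact le_totalDegree hs
  have hinj : ∀ s ∈ S, ∀ t ∈ S, s.some = t.some → s = t := by
    intro s hs t ht hst
    have h1 := (Finset.mem_filter.1 hs).2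
    have h2 := (Finset.mem_filter.1 ht).2
    have h3 : ∀ i, s (some i) = t (some i) := fun i => DFunLike.congr_fun hst i
    rw [Fintype.sum_option] at h1 h2
    simp only [h3] at h1
    ext i
    cases i with
    | none => omega
    | some i => exact h3 i
  have hH : H ≠ 0 := by
    obtain ⟨s, hs, hse⟩ : ∃ s ∈ P.support, s.degree = e := by
      have hne : P.support.Nonempty := by simpa using hP
      obtain ⟨s, hs, hse⟩ := Finset.exists_mem_eq_sup _ hne (fun s => s.degree)
      exact ⟨s, hs, by rw [he, ← hse]; rfl⟩
    have hsS : s ∈ S := Finset.mem_filter.2 ⟨hs, by rw [← deg_eq_sum, hse]⟩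
    intro h0
    have : H.coeff s.some = P.coeff s * (-1) ^ (∑ i, s (some i)) := by
      simp only [H, coeff_sum, coeff_monomial]
      rw [Finset.sum_eq_single s]
      · simp
      · intro t ht hts
        rw [if_neg]
        intro h'
        exact hts (hinj t ht s hsS h')
      · intro h'; exact absurd hsS h'
    rw [h0, coeff_zero] at this
    have h1 := mem_support_iff.1 hs
    have h2 : P.coeff s * (-1) ^ (∑ i, s (some i)) ≠ 0 := mul_ne_zero h1 (by simp)
    exact h2 this.symm
  have hdegH : ∀ i, H.degreeOf i ≤ d0 := by
    intro i
    rw [degreeOf_le_iff]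
    intro t ht
    have ht' := mem_support_iff.1 ht
    simp only [H, coeff_sum, coeff_monomial] at ht'
    obtain ⟨s, hs, hst⟩ := Finset.exists_ne_zero_of_sum_ne_zero ht'
    have hst : s.some = t := by by_contra h'; simp [h'] at hst
    have h1 := (Finset.mem_filter.1 hs).2
    have h2 : s (some i) ≤ ∑ j, s j := Finset.single_le_sum (fun _ _ => Nat.zero_le _) (Finset.mem_univ _)
    rw [← hst]
    exact h2.trans (h1.le.trans hd)
  obtain ⟨c, hc, hcH⟩ : ∃ c : τ → ℕ, (∀ i, c i ≤ d0) ∧ eval (fun i => (c i : ℚ)) H ≠ 0 := by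
    by_contra! hcon
    apply hH
    refine eq_zero_of_eval_zero_at_prod_finset H
      (fun _ => (Finset.range (d0 + 1)).map Nat.castEmbedding) ?_ ?_
    · intro i; simpa using Nat.lt_succ_of_le (hdegH i)
    · intro x hx
      have : ∀ i, ∃ c : ℕ, c ≤ d0 ∧ (c : ℚ) = x i := by
        intro i
        have := hx i
        simp only [Finset.mem_map, Finset.mem_range] at this
        obtain ⟨a, ha, hax⟩ := this
        exact ⟨a, by omega, hax⟩
      choose c h1 h2 using this
      rw [← funext h2]
      exact hcon c h1
  refine ⟨c, hc, ?_⟩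
  set q := eval (fun i => (c i : ℚ)) H with hq
  let u : Option τ → Polynomial (MvPolynomial τ ℚ) := fun o => o.elim Polynomial.X
    fun i => Polynomial.C (X i) - Polynomial.C (C (c i : ℚ)) * Polynomial.X
  let l : Option τ → ℚ := fun o => o.elim 1 fun i => - (c i : ℚ)
  have hu1 : ∀ o, (u o).natDegree ≤ 1 := by
    intro o
    cases o with
    | none => exact Polynomial.natDegree_X_le
    | some i =>
      refine (Polynomial.natDegree_sub_le _ _).trans (max_le ?_ ?_)
      · simp
      · exact (Polynomial.natDegree_C_mul_le _ _).trans Polynomial.natDegree_X_le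
  have hu2 : ∀ o, (u o).coeff 1 = C (l o) := by
    intro o
    cases o with
    | none => simp [u, l]
    | some i => simp [u, l]
  let mon : (Option τ →₀ ℕ) → Polynomial (MvPolynomial τ ℚ) := fun s => ∏ i, u i ^ s i
  have hm1 : ∀ s, (mon s).natDegree ≤ ∑ i, s i := by
    intro s
    refine (Polynomial.natDegree_prod_le _ _).trans (Finset.sum_le_sum fun i _ => ?_)
    refine Polynomial.natDegree_pow_le.trans ?_
    exact (Nat.mul_le_mul_left _ (hu1 i)).trans (by simp)
  have hm2 : ∀ s, (mon s).coeff (∑ i, s i) = C (∏ i, l i ^ s i) := by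
    have key : ∀ (A : Finset (Option τ)) (s : Option τ →₀ ℕ),
        (∏ i ∈ A, u i ^ s i).natDegree ≤ ∑ i ∈ A, s i ∧
        (∏ i ∈ A, u i ^ s i).coeff (∑ i ∈ A, s i) = C (∏ i ∈ A, l i ^ s i) := by
      intro A s
      induction A using Finset.induction_on with
      | empty => simp
      | insert a A ha ih =>
        have h1 : (u a ^ s a).natDegree ≤ s a :=
          Polynomial.natDegree_pow_le.trans ((Nat.mul_le_mul_left _ (hu1 a)).trans (by simp))
        rw [Finset.prod_insert ha, Finset.sum_insert ha, Finset.prod_insert ha]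
        refine ⟨Polynomial.natDegree_mul_le.trans (add_le_add h1 ih.1), ?_⟩
        rw [Polynomial.coeff_mul_add_eq_of_natDegree_le h1 ih.1, ih.2, C_mul]
        congr 1
        have := Polynomial.coeff_pow_of_natDegree_le (m := s a) (hu1 a)
        rw [mul_one] at this
        rw [this, hu2, C_pow]
    exact fun s => (key Finset.univ s).2
  let Q : Polynomial (MvPolynomial τ ℚ) := aeval u P
  have hQ : Q = ∑ s ∈ P.support, Polynomial.C (C (P.coeff s)) * mon s := by
    simp only [Q]
    rw [aeval_def, eval₂_eq']
    rfl
  have hQ1 : Q.natDegree ≤ e := by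
    rw [hQ]
    refine Polynomial.natDegree_sum_le_of_forall_le _ _ fun s hs => ?_
    exact (Polynomial.natDegree_C_mul_le _ _).trans ((hm1 s).trans (hle s hs))
  have hQ2 : Q.coeff e = C q := by
    rw [hQ, Polynomial.finsetSum_coeff, hq]
    simp only [H, map_sum, hS, Finset.sum_filter]
    refine Finset.sum_congr rfl fun s hs => ?_
    rw [Polynomial.coeff_C_mul]
    split_ifs with hse
    · rw [← hse, hm2, ← C_mul]
      congr 1
      rw [eval_monomial, mul_assoc]
      congr 1
      rw [Fintype.prod_option, Finsupp.prod_fintype _ _ (by simp), ← Finset.prod_pow_eq_pow_sum,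
        ← Finset.prod_mul_distrib]
      simp only [l, Option.elim, one_pow, one_mul]
      refine Finset.prod_congr rfl fun i _ => ?_
      rw [Finsupp.some_apply, ← mul_pow]
      simp
    · rw [Polynomial.coeff_eq_zero_of_natDegree_lt, mul_zero, map_zero, map_zero]
      exact (hm1 s).trans_lt (lt_of_le_of_ne (hle s hs) hse)
  let S' := Algebra.adjoin ℚ (Set.range fun i => T i + (c i : B) * y)
  let j : MvPolynomial τ ℚ →ₐ[ℚ] S' := aeval fun i =>
    ⟨T i + (c i : B) * y, Algebra.subset_adjoin ⟨i, rfl⟩⟩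
  let Q' := Polynomial.C (C q⁻¹) * Q
  have hmon : Q'.Monic := by
    refine Polynomial.monic_of_natDegree_le_of_coeff_eq_one e
      ((Polynomial.natDegree_C_mul_le _ _).trans hQ1) ?_
    rw [Polynomial.coeff_C_mul, hQ2, ← C_mul, inv_mul_cancel₀ hcH, C_1]
  refine ⟨Q'.map j.toRingHom, hmon.map _, ?_⟩
  rw [Polynomial.eval₂_map]
  rw [Polynomial.eval₂_mul]
  have : Polynomial.eval₂ ((algebraMap S' B).comp j.toRingHom) y Q = 0 := by
    rw [← h]
    simp only [Q]
    have e1 : (Polynomial.eval₂RingHom ((algebraMap S' B).comp j.toRingHom) y).comp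
        (aeval u : MvPolynomial (Option τ) ℚ →ₐ[ℚ] _).toRingHom =
        (aeval (fun o : Option τ => o.elim y T) : _ →ₐ[ℚ] B).toRingHom := by
      refine MvPolynomial.ringHom_ext' (Subsingleton.elim _ _) ?_
      intro o
      cases o with
      | none => simp [u]
      | some i =>
        simp only [AlgHom.toRingHom_eq_coe, RingHom.coe_comp, RingHom.coe_coe, Function.comp_apply,
          aeval_X, Polynomial.coe_eval₂RingHom, u, Option.elim_some, Polynomial.eval₂_sub,
          Polynomial.eval₂_C, Polynomial.eval₂_mul, Polynomial.eval₂_X, j]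
        simp
    exact congrArg (fun f => f P) e1
  change _ * Polynomial.eval₂ ((algebraMap S' B).comp j.toRingHom) y Q = 0
  rw [this, mul_zero]


/-! filtrations -/

def sfil {τ R : Type*} [CommRing R] (V : ℕ → Set (τ →₀ ℕ)) (G : ℕ → AddSubgroup R) (m : ℕ) :
    AddSubgroup (MvPolynomial τ R) where
  carrier := {P | ∀ c, P.coeff c ≠ 0 → c ∈ V m ∧ P.coeff c ∈ G m}
  zero_mem' := by intro c hc; simp at hc
  add_mem' := by
    intro P Q hP hQ c hc
    rw [coeff_add] at hc ⊢
    by_cases h1 : P.coeff c = 0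
    · rw [h1, zero_add] at hc ⊢; exact hQ c hc
    · by_cases h2 : Q.coeff c = 0
      · rw [h2, add_zero]; exact hP c h1
      · exact ⟨(hP c h1).1, (G m).add_mem (hP c h1).2 (hQ c h2).2⟩
  neg_mem' := by
    intro P hP c hc
    rw [coeff_neg] at hc ⊢
    have := hP c (by simpa using hc)
    exact ⟨this.1, (G m).neg_mem this.2⟩

theorem mem_sfil {τ R : Type*} [CommRing R] {V : ℕ → Set (τ →₀ ℕ)} {G : ℕ → AddSubgroup R} {m : ℕ}
    {P : MvPolynomial τ R} :
    P ∈ sfil V G m ↔ ∀ c, P.coeff c ≠ 0 → c ∈ V m ∧ P.coeff c ∈ G m := Iff.rfl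

theorem monomial_mem_sfil {τ R : Type*} [CommRing R] {V : ℕ → Set (τ →₀ ℕ)}
    {G : ℕ → AddSubgroup R} {m : ℕ} {c : τ →₀ ℕ} {a : R} (hc : c ∈ V m) (ha : a ∈ G m) :
    monomial c a ∈ sfil V G m := by
  intro c' hc'
  rw [coeff_monomial] at hc' ⊢
  split_ifs at hc' ⊢ with h
  · exact ⟨h ▸ hc, ha⟩
  · exact absurd rfl hc'

theorem Fil.sfil {τ R : Type*} [CommRing R] {V : ℕ → Set (τ →₀ ℕ)} {G : ℕ → AddSubgroup R}
    (hG : Fil G) (h0 : 0 ∈ V 0) (hadd : ∀ {m m' s t}, s ∈ V m → t ∈ V m' → s + t ∈ V (m + m'))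
    (hm : ∀ {m m'}, m ≤ m' → V m ⊆ V m') : Fil (sfil V G) where
  one := monomial_mem_sfil h0 hG.one
  mul := by
    intro m m' P Q hP hQ
    rw [P.as_sum, Q.as_sum, Finset.sum_mul_sum]
    refine AddSubgroup.sum_mem _ fun s hs => AddSubgroup.sum_mem _ fun t ht => ?_
    rw [monomial_mul]
    have h1 := hP s (mem_support_iff.1 hs)
    have h2 := hQ t (mem_support_iff.1 ht)
    exact monomial_mem_sfil (hadd h1.1 h2.1) (hG.mul h1.2 h2.2)
  mono := by
    intro m m' h P hP c hc
    exact ⟨hm h (hP c hc).1, hG.mono h (hP c hc).2⟩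

theorem Fil.top {R : Type*} [CommRing R] : Fil (fun _ => (⊤ : AddSubgroup R)) :=
  ⟨trivial, fun _ _ => trivial, fun _ => le_rfl⟩

def filT (R : Type*) [CommRing R] (n D : ℕ) : ℕ → AddSubgroup (MvPolynomial (Option (Fin n)) R) :=
  sfil (Ty n D) (fun _ => ⊤)

theorem Fil_T (R : Type*) [CommRing R] (n D : ℕ) : Fil (filT R n D) := by
  refine Fil.sfil Fil.top ?_ ?_ ?_
  · simp [Ty]
  · rintro m m' s t ⟨h1, h2⟩ ⟨h3, h4⟩
    refine ⟨?_, ?_⟩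
    · simp only [Finsupp.add_apply]; omega
    · simp only [Finsupp.add_apply, Finset.sum_add_distrib, mul_add]; omega
  · rintro m m' h s ⟨h1, h2⟩
    exact ⟨by omega, by omega⟩

theorem mem_filT {R : Type*} [CommRing R] {n D m : ℕ} {P : MvPolynomial (Option (Fin n)) R} :
    P ∈ filT R n D m ↔ ∀ c, P.coeff c ≠ 0 → c ∈ Ty n D m :=
  ⟨fun h c hc => (h c hc).1, fun h c hc => ⟨h c hc, trivial⟩⟩

theorem filT_C {R : Type*} [CommRing R] {n D : ℕ} (a : R) (m : ℕ) : C a ∈ filT R n D m :=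
  (Fil_T R n D).mono (Nat.zero_le _) (monomial_mem_sfil (by simp [Ty]) trivial)

theorem filT_X {R : Type*} [CommRing R] {n D : ℕ} (j : Fin n) : X (some j) ∈ filT R n D 1 := by
  refine monomial_mem_sfil ⟨?_, ?_⟩ trivial
  · simp
  · simp [Finsupp.single_apply]

/-- `f(ξ) z` has type 1 when `deg f ≤ D` -/
theorem filT_mulz {R : Type*} [CommRing R] {n D : ℕ} (hD : 1 ≤ D) (f : MvPolynomial (Fin n) R)
    (hf : f.totalDegree ≤ D) : rename some f * X none ∈ filT R n D 1 := by
  rw [f.as_sum, map_sum, Finset.sum_mul]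
  refine AddSubgroup.sum_mem _ fun s hs => ?_
  rw [rename_monomial, X, monomial_mul]
  refine monomial_mem_sfil ⟨?_, ?_⟩ trivial
  · have : (Finsupp.mapDomain some s) (none : Option (Fin n)) = 0 :=
      Finsupp.mapDomain_notin_range _ _ (by simp)
    simp [this]
  · have h1 : ∀ j, (Finsupp.mapDomain some s) (some j : Option (Fin n)) = s j := fun j =>
      Finsupp.mapDomain_apply (Option.some_injective _) _ _
    have : (Finsupp.mapDomain some s) (none : Option (Fin n)) = 0 :=
      Finsupp.mapDomain_notin_range _ _ (by simp)
    have h2 : ∑ j, s j ≤ D := by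
      rw [← deg_eq_sum]; exact (le_totalDegree hs).trans hf
    simp [this, h1]
    omega

/-- evaluating a polynomial at elements of a filtration -/
theorem Fil.aeval {R τ : Type*} [CommRing R] {G : ℕ → AddSubgroup R} (hG : Fil G) [Fintype τ]
    {k : Type*} [CommRing k] [Algebra k R] (hk : ∀ a : k, algebraMap k R a ∈ G 0) (w : τ → ℕ)
    (v : τ → R) (hv : ∀ i, v i ∈ G (w i)) (P : MvPolynomial τ k) (N : ℕ)
    (hP : ∀ s, P.coeff s ≠ 0 → ∑ i, w i * s i ≤ N) : MvPolynomial.aeval v P ∈ G N := by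
  rw [MvPolynomial.aeval_def, eval₂_eq']
  refine AddSubgroup.sum_mem _ fun s hs => ?_
  have h1 := hG.prod Finset.univ (fun i => v i ^ s i) (fun i => w i * s i)
    (fun i _ => hG.pow (hv i) _)
  refine hG.mono (hP s (mem_support_iff.1 hs)) ?_
  have := hG.mul (hk (P.coeff s)) h1
  rwa [zero_add] at this

/-- a linear map from a big support space to a small support space has a kernel -/
theorem exists_rel {k : Type*} [Field k] {α β : Type*} {R : Type*} [CommRing R] [Algebra k R]
    (U : Finset α) (E : Finset β) (v : α → R) (h : E.card < U.card)
    (hv : ∃ W : Submodule k R, (∀ a ∈ U, v a ∈ W) ∧ Module.Finite k W ∧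
      Module.finrank k W ≤ E.card) :
    ∃ t : α → k, (∃ a ∈ U, t a ≠ 0) ∧ ∑ a ∈ U, t a • v a = 0 := by
  obtain ⟨W, hW, hfin, hr⟩ := hv
  have hnot : ¬ LinearIndependent k (fun a : U => (⟨v a, hW a a.2⟩ : W)) := by
    intro hli
    have := hli.fintype_card_le_finrank
    rw [Fintype.card_coe] at this
    omega
  rw [Fintype.linearIndependent_iff] at hnot
  push Not at hnot
  obtain ⟨g, hg, a, ha⟩ := hnot
  refine ⟨fun a => if h : a ∈ U then g ⟨a, h⟩ else 0, ⟨a, a.2, by simpa using ha⟩, ?_⟩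
  have := congrArg (Subtype.val) hg
  rw [← Finset.sum_coe_sort]
  simpa [Submodule.coe_sum] using this

end EN

namespace EN
open MvPolynomial

/-! ### Part 5: Nullstellensatz over ℚ and integrality -/

theorem finrank_restrict {k τ : Type*} [Field k] (S : Set (τ →₀ ℕ)) (E : Finset (τ →₀ ℕ))
    (h : ∀ s, s ∈ S ↔ s ∈ E) : Module.Finite k (restrictSupport k S) ∧
      Module.finrank k (restrictSupport k S) = E.card := by
  have hS : S = (E : Set (τ →₀ ℕ)) := Set.ext fun s => by simp [h]
  subst hS
  refine ⟨Module.Finite.of_basis (basisRestrictSupport k _), ?_⟩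
  rw [Module.finrank_eq_card_basis (basisRestrictSupport k (E : Set (τ →₀ ℕ)))]
  simp

theorem filT_restrict {k : Type*} [Field k] {n D m : ℕ} {P : MvPolynomial (Option (Fin n)) k} :
    P ∈ filT k n D m ↔ P ∈ restrictSupport k (Ty n D m) := by
  rw [mem_filT, mem_restrictSupport_iff]
  constructor
  · intro h s hs; exact h s (mem_support_iff.1 hs)
  · intro h s hs; exact h (mem_support_iff.2 hs)

theorem bezout_rat {n k : ℕ} (f : Fin k → MvPolynomial (Fin n) ℤ)
    (h : ∀ x : Fin n → ℂ, ∃ i, aeval x (f i) ≠ 0) :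
    ∃ g : Fin k → MvPolynomial (Fin n) ℚ, ∑ i, g i * map (Int.castRingHom ℚ) (f i) = 1 := by
  set I : Ideal (MvPolynomial (Fin n) ℚ) :=
    Ideal.span (Set.range fun i => map (Int.castRingHom ℚ) (f i)) with hI
  have h1 : zeroLocus ℂ I = ∅ := by
    rw [hI, zeroLocus_span, Set.eq_empty_iff_forall_notMem]
    intro x hx
    obtain ⟨i, hi⟩ := h x
    apply hi
    have := hx _ ⟨i, rfl⟩
    rw [aeval_def, eval₂_map] at this
    rw [aeval_def, ← this]
    congr 1
  have h2 := vanishingIdeal_zeroLocus_eq_radical (K := ℂ) I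
  rw [h1, vanishingIdeal_empty] at h2
  have h3 : I = ⊤ := Ideal.radical_eq_top.1 h2.symm
  have h4 : (1 : MvPolynomial (Fin n) ℚ) ∈ I := h3 ▸ trivial
  rw [hI, Ideal.mem_span_range_iff_exists_fun] at h4
  exact h4

theorem shift_step {n D : ℕ} (hD : 2 ≤ D) (T : Option (Fin n) → MvPolynomial (Option (Fin n)) ℚ)
    (y : MvPolynomial (Option (Fin n)) ℚ) (hT : ∀ i, T i ∈ filT ℚ n D 1) (hy : y ∈ filT ℚ n D 1) :
    ∃ c : Option (Fin n) → ℕ, (∀ i, c i ≤ (n + 2) * Nf D n) ∧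
      IsIntegral (Algebra.adjoin ℚ (Set.range fun i => T i + (c i : MvPolynomial _ ℚ) * y)) y := by
  set d0 := (n + 2) * Nf D n with hd0
  let v : Option (Option (Fin n)) → MvPolynomial (Option (Fin n)) ℚ := fun o => o.elim y T
  obtain ⟨t, ⟨s0, hs0, hts0⟩, ht⟩ := exists_rel (k := ℚ) (Sx (Option (Option (Fin n))) d0)
    (TyF n D d0) (fun s => ∏ i, v i ^ s i) (by
      rw [card_Sx]
      have := count_C1 n D hD
      simpa using this) ⟨restrictSupport ℚ (Ty n D d0), by
        intro s hs
        rw [← filT_restrict]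
        have hG := Fil_T ℚ n D
        have h1 := hG.prod Finset.univ (fun i => v i ^ s i) (fun i => 1 * s i)
          (fun i _ => hG.pow (by cases i <;> simp [v, hy, hT]) _)
        refine hG.mono ?_ h1
        simpa using mem_Sx.1 hs, (finrank_restrict _ _ fun s => mem_TyF.symm).1,
        (finrank_restrict _ _ fun s => mem_TyF.symm).2.le⟩
  let P : MvPolynomial (Option (Option (Fin n))) ℚ := ∑ s ∈ Sx _ d0, monomial s (t s)
  have hc : ∀ s, P.coeff s = if s ∈ Sx _ d0 then t s else 0 := by
    intro s; simp [P, coeff_sum, coeff_monomial]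
  refine exists_shift P ?_ d0 ?_ T y ?_
  · intro h0
    have := hc s0
    rw [h0, if_pos hs0] at this
    exact hts0 (by simpa using this.symm)
  · refine Finset.sup_le fun s hs => ?_
    have h1 := mem_support_iff.1 hs
    rw [hc] at h1
    have h2 : s ∈ Sx _ d0 := by by_contra h'; simp [h'] at h1
    have := mem_Sx.1 h2
    rw [← deg_eq_sum] at this
    exact this
  · rw [← ht]
    simp only [P, map_sum, aeval_monomial, Algebra.smul_def]
    refine Finset.sum_congr rfl fun s _ => ?_
    rw [Finsupp.prod_fintype _ _ (by simp)]

theorem isIntegral_trans_sub {k B : Type*} [CommRing k] [CommRing B] [Algebra k B]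
    (S1 S2 : Subalgebra k B) (h : ∀ x ∈ S1, IsIntegral S2 x) (x : B) (hx : IsIntegral S1 x) :
    IsIntegral S2 x := by
  let j : S1 →+* integralClosure S2 B :=
    { toFun := fun a => ⟨a, h a a.2⟩
      map_one' := rfl
      map_mul' := fun _ _ => rfl
      map_zero' := rfl
      map_add' := fun _ _ => rfl }
  have : IsIntegral (integralClosure S2 B) x := by
    obtain ⟨p, hp, hpx⟩ := hx
    refine ⟨p.map j, hp.map _, ?_⟩
    rw [Polynomial.eval₂_map]
    exact hpx
  exact isIntegral_trans (R := S2) (A := integralClosure S2 B) x this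

theorem isIntegral_mem {k B : Type*} [CommRing k] [CommRing B] [Algebra k B]
    (S : Subalgebra k B) (x : B) (hx : x ∈ S) : IsIntegral S x :=
  isIntegral_algebraMap (R := S) (A := B) (x := ⟨x, hx⟩)

theorem tdeg_map_le {τ R S : Type*} [CommRing R] [CommRing S] (φ : R →+* S) (P : MvPolynomial τ R) :
    (map φ P).totalDegree ≤ P.totalDegree :=
  Finset.sup_mono (support_map_subset φ P)

theorem adjoin_integral {k B ι : Type*} [CommRing k] [CommRing B] [Algebra k B] (T : ι → B)
    (S2 : Subalgebra k B) (h : ∀ i, IsIntegral S2 (T i)) :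
    ∀ x ∈ Algebra.adjoin k (Set.range T), IsIntegral S2 x := by
  intro x hx
  have : Algebra.adjoin k (Set.range T) ≤ (integralClosure S2 B).restrictScalars k := by
    rw [Algebra.adjoin_le_iff]
    rintro _ ⟨i, rfl⟩
    exact h i
  exact this hx

theorem integral_shift {n D k : ℕ} (hD : 2 ≤ D)
    (T0 : Option (Fin n) → MvPolynomial (Option (Fin n)) ℚ) (hT : ∀ i, T0 i ∈ filT ℚ n D 1)
    (y : Fin k → MvPolynomial (Option (Fin n)) ℚ) (hy : ∀ l, y l ∈ filT ℚ n D 1) :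
    ∃ γ : Option (Fin n) → Fin k → ℕ, (∀ i l, γ i l ≤ (n + 2) * Nf D n) ∧
      (∀ i, IsIntegral (Algebra.adjoin ℚ (Set.range fun i => T0 i + ∑ l, (γ i l : MvPolynomial _ ℚ) * y l)) (T0 i)) ∧
      (∀ l, IsIntegral (Algebra.adjoin ℚ (Set.range fun i => T0 i + ∑ l, (γ i l : MvPolynomial _ ℚ) * y l)) (y l)) := by
  have key : ∀ s : Finset (Fin k), ∃ γ : Option (Fin n) → Fin k → ℕ,
      (∀ i l, γ i l ≤ (n + 2) * Nf D n) ∧ (∀ i, ∀ l ∉ s, γ i l = 0) ∧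
      (∀ i, IsIntegral (Algebra.adjoin ℚ (Set.range fun i => T0 i + ∑ l, (γ i l : MvPolynomial _ ℚ) * y l)) (T0 i)) ∧
      (∀ l ∈ s, IsIntegral (Algebra.adjoin ℚ (Set.range fun i => T0 i + ∑ l, (γ i l : MvPolynomial _ ℚ) * y l)) (y l)) := by
    intro s
    induction s using Finset.induction_on with
    | empty =>
      refine ⟨fun _ _ => 0, by simp, by simp, ?_, by simp⟩
      intro i
      exact isIntegral_mem _ _ (Algebra.subset_adjoin ⟨i, by simp⟩)
    | insert m s hm ih =>
      obtain ⟨γ, h1, h2, h3, h4⟩ := ih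
      set T : Option (Fin n) → MvPolynomial (Option (Fin n)) ℚ :=
        fun i => T0 i + ∑ l, (γ i l : MvPolynomial _ ℚ) * y l with hTdef
      have hTf : ∀ i, T i ∈ filT ℚ n D 1 := by
        intro i
        refine AddSubgroup.add_mem _ (hT i) (AddSubgroup.sum_mem _ fun l _ => ?_)
        have := AddSubgroup.nsmul_mem _ (hy l) (γ i l)
        rwa [nsmul_eq_mul] at this
      obtain ⟨c, hc, hci⟩ := shift_step hD T (y m) hTf (hy m)
      let γ' : Option (Fin n) → Fin k → ℕ := fun i => Function.update (γ i) m (c i)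
      have hT' : (fun i => T0 i + ∑ l, (γ' i l : MvPolynomial _ ℚ) * y l) =
          fun i => T i + (c i : MvPolynomial _ ℚ) * y m := by
        funext i
        rw [hTdef]
        simp only []
        rw [add_assoc]
        congr 1
        rw [← Finset.add_sum_erase _ _ (Finset.mem_univ m),
          ← Finset.add_sum_erase (a := m) (f := fun l => (γ i l : MvPolynomial _ ℚ) * y l) _ (Finset.mem_univ m),
          h2 i m hm]
        have : ∑ l ∈ Finset.univ.erase m, (γ' i l : MvPolynomial (Option (Fin n)) ℚ) * y l =
            ∑ l ∈ Finset.univ.erase m, (γ i l : MvPolynomial (Option (Fin n)) ℚ) * y l :=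
          Finset.sum_congr rfl fun l hl => by
            simp [γ', Function.update_of_ne (Finset.ne_of_mem_erase hl)]
        rw [this]
        simp [γ']
        ring
      refine ⟨γ', ?_, ?_, ?_⟩
      · intro i l
        by_cases hl : l = m
        · subst hl; simpa [γ'] using hc i
        · simpa [γ', hl] using h1 i l
      · intro i l hl
        rw [Finset.mem_insert, not_or] at hl
        simp [γ', hl.1, h2 i l hl.2]
      · rw [hT']
        have hTi : ∀ i, IsIntegral (Algebra.adjoin ℚ
            (Set.range fun i => T i + (c i : MvPolynomial _ ℚ) * y m)) (T i) := by
          intro i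
          have e : T i = (T i + (c i : MvPolynomial _ ℚ) * y m) - (c i : MvPolynomial _ ℚ) * y m := by
            ring
          rw [e]
          refine IsIntegral.sub ?_ ?_
          · exact isIntegral_mem _ _ (Algebra.subset_adjoin ⟨i, rfl⟩)
          · rw [← nsmul_eq_mul]; exact hci.nsmul _
        have htr := isIntegral_trans_sub _ _ (adjoin_integral T _ hTi)
        refine ⟨fun i => htr _ (h3 i), ?_⟩
        intro l hl
        rcases Finset.mem_insert.1 hl with rfl | hl
        · exact hci
        · exact htr _ (h4 l hl)
  obtain ⟨γ, h1, -, h3, h4⟩ := key Finset.univ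
  exact ⟨γ, h1, h3, fun l => h4 l (Finset.mem_univ _)⟩

/-- the map `Ψ` -/
def Psi {n : ℕ} {R : Type*} [CommRing R] (F : Option (Fin n) → MvPolynomial (Fin n) R)
    (i : Option (Fin n)) : MvPolynomial (Option (Fin n)) R :=
  rename some (F i) * X none + i.elim 0 (fun j => X (some j))

theorem Psi_map {n : ℕ} {R S : Type*} [CommRing R] [CommRing S] (φ : R →+* S)
    (F : Option (Fin n) → MvPolynomial (Fin n) R) (i : Option (Fin n)) :
    map φ (Psi F i) = Psi (fun i => map φ (F i)) i := by
  cases i <;> simp [Psi, map_rename]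

theorem Psi_fil {n D : ℕ} {R : Type*} [CommRing R] (hD : 1 ≤ D)
    (F : Option (Fin n) → MvPolynomial (Fin n) R) (hF : ∀ i, (F i).totalDegree ≤ D)
    (i : Option (Fin n)) : Psi F i ∈ filT R n D 1 := by
  refine AddSubgroup.add_mem _ (filT_mulz hD _ (hF i)) ?_
  cases i with
  | none => exact AddSubgroup.zero_mem _
  | some j => exact filT_X j

/-- comparison of degrees -/
theorem injective_of_integral {τ : Type} [Fintype τ] (v : τ → MvPolynomial τ ℚ)
    (h : ∀ i, IsIntegral (Algebra.adjoin ℚ (Set.range v)) (X i : MvPolynomial τ ℚ)) :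
    Function.Injective (aeval v : MvPolynomial τ ℚ →ₐ[ℚ] MvPolynomial τ ℚ) ∧
    (aeval v : MvPolynomial τ ℚ →ₐ[ℚ] MvPolynomial τ ℚ).toRingHom.IsIntegral := by
  have hall : ∀ x : MvPolynomial τ ℚ, IsIntegral (Algebra.adjoin ℚ (Set.range v)) x := by
    intro x
    refine adjoin_integral (X : τ → MvPolynomial τ ℚ) _ h x ?_
    rw [MvPolynomial.adjoin_range_X]; trivial
  have hAI : Algebra.IsIntegral (Algebra.adjoin ℚ (Set.range v)) (MvPolynomial τ ℚ) := ⟨hall⟩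
  constructor
  · have : Algebra.IsAlgebraic (Algebra.adjoin ℚ (Set.range v)) (MvPolynomial τ ℚ) := inferInstance
    obtain ⟨t, hts, ht⟩ := exists_isTranscendenceBasis_subset (R := ℚ) (Set.range v)
    have hX := IsTranscendenceBasis.mvPolynomial τ ℚ
    have hcard := ht.lift_cardinalMk_eq hX
    have hfin : t.Finite := (Set.finite_range v).subset hts
    have := hfin.to_subtype
    have hc2 : Nat.card t = Nat.card τ := by
      have := congrArg Cardinal.toNat hcard
      simpa [Nat.card] using this
    have h3 : t.ncard ≤ (Set.range v).ncard := Set.ncard_le_ncard hts (Set.finite_range v)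
    have h4 : (Set.range v).ncard ≤ Nat.card τ := by
      rw [← Set.image_univ]
      refine (Set.ncard_image_le (Set.toFinite _)).trans ?_
      rw [Set.ncard_univ]
    have h5 : t.ncard = Nat.card τ := by rw [← hc2]; rfl
    have hteq : t = Set.range v := Set.eq_of_subset_of_ncard_le hts (by omega) (Set.finite_range v)
    have hvinj : Function.Injective v := by
      have h6 : (v '' Set.univ).ncard = (Set.univ : Set τ).ncard := by
        rw [Set.image_univ, Set.ncard_univ]
        omega
      rw [Set.ncard_image_iff (Set.toFinite _)] at h6
      exact Set.injOn_univ.1 h6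
    subst hteq
    have h7 : AlgebraicIndependent ℚ v :=
      (algebraicIndependent_subtype_range hvinj).1 ht.1
    exact h7
  · intro x
    obtain ⟨p, hp, hpx⟩ := hall x
    have hr : Algebra.adjoin ℚ (Set.range v) = (aeval v : MvPolynomial τ ℚ →ₐ[ℚ] _).range :=
      Algebra.adjoin_range_eq_range_aeval ℚ v
    have hl : p ∈ Polynomial.lifts ((aeval v : MvPolynomial τ ℚ →ₐ[ℚ] _).codRestrict
        (Algebra.adjoin ℚ (Set.range v)) (fun y => by rw [hr]; exact ⟨y, rfl⟩)).toRingHom := by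
      rw [Polynomial.lifts_iff_coeff_lifts]
      intro m
      obtain ⟨y, hy⟩ := hr.le (p.coeff m).2
      exact ⟨y, Subtype.ext hy⟩
    obtain ⟨q, hq, -, hqm⟩ := Polynomial.lifts_and_natDegree_eq_and_monic hl hp
    refine ⟨q, hqm, ?_⟩
    rw [← hpx, ← hq, Polynomial.eval₂_map]
    rfl

theorem exists_gamma {n D k : ℕ} (hD : 2 ≤ D) (f : Fin k → MvPolynomial (Fin n) ℤ)
    (hf : ∀ l, (f l).totalDegree ≤ D) (h : ∀ x : Fin n → ℂ, ∃ i, aeval x (f i) ≠ 0) :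
    ∃ γ : Option (Fin n) → Fin k → ℕ, (∀ i l, γ i l ≤ (n + 2) * Nf D n) ∧
      ∀ i, IsIntegral (Algebra.adjoin ℚ (Set.range
        (Psi fun i => map (Int.castRingHom ℚ) (∑ l, (γ i l : MvPolynomial _ ℤ) * f l))))
        (X i : MvPolynomial (Option (Fin n)) ℚ) := by
  obtain ⟨g, hg⟩ := bezout_rat f h
  let fq : Fin k → MvPolynomial (Fin n) ℚ := fun l => map (Int.castRingHom ℚ) (f l)
  have hfq : ∀ l, (fq l).totalDegree ≤ D := fun l =>
    (tdeg_map_le (Int.castRingHom ℚ) (f l)).trans (hf l)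
  let T0 : Option (Fin n) → MvPolynomial (Option (Fin n)) ℚ := fun i => i.elim 0 fun j => X (some j)
  obtain ⟨γ, h1, h2, h3⟩ := integral_shift hD T0 (by
      intro i
      cases i with
      | none => exact AddSubgroup.zero_mem _
      | some j => exact filT_X j) (fun l => rename some (fq l) * X none)
    (fun l => filT_mulz (by omega) _ (hfq l))
  have hP : (Psi fun i => map (Int.castRingHom ℚ) (∑ l, (γ i l : MvPolynomial _ ℤ) * f l)) =
      fun i => T0 i + ∑ l, (γ i l : MvPolynomial _ ℚ) * (rename some (fq l) * X none) := by
    funext i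
    simp only [Psi, map_sum, map_mul, map_natCast, T0, Finset.sum_mul, fq, mul_assoc]
    rw [add_comm]
  refine ⟨γ, h1, ?_⟩
  rw [hP]
  have hx : ∀ j, IsIntegral (Algebra.adjoin ℚ (Set.range fun i => T0 i +
      ∑ l, (γ i l : MvPolynomial _ ℚ) * (rename some (fq l) * X none)))
      (X (some j) : MvPolynomial (Option (Fin n)) ℚ) := fun j => h2 (some j)
  generalize Algebra.adjoin ℚ (Set.range fun i => T0 i +
      ∑ l, (γ i l : MvPolynomial _ ℚ) * (rename some (fq l) * X none)) = S at hx h3 ⊢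
  intro i
  cases i with
  | some j => exact hx j
  | none =>
    have e : (X none : MvPolynomial (Option (Fin n)) ℚ) =
        ∑ l, rename some (g l) * (rename some (fq l) * X none) := by
      simp only [← mul_assoc, ← map_mul, ← Finset.sum_mul, ← map_sum]
      rw [hg, map_one, one_mul]
    rw [e]
    refine IsIntegral.sum _ fun l _ => ?_
    have h5 : IsIntegral S (rename some (fq l) * X none : MvPolynomial (Option (Fin n)) ℚ) := h3 l
    suffices h6 : IsIntegral S (rename some (g l) : MvPolynomial (Option (Fin n)) ℚ) from h6.mul h5
    refine adjoin_integral (fun j => (X (some j) : MvPolynomial (Option (Fin n)) ℚ)) _ hx _ ?_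
    rw [Algebra.adjoin_range_eq_range_aeval]
    refine ⟨g l, ?_⟩
    change aeval _ (g l) = _
    have h7 : (aeval fun j => (X (some j) : MvPolynomial (Option (Fin n)) ℚ)) =
        (rename some : MvPolynomial (Fin n) ℚ →ₐ[ℚ] _) := MvPolynomial.algHom_ext (by simp)
    rw [h7]

end EN

namespace EN
open MvPolynomial

/-! ### Part 6: points of the generic fibre and residues -/

theorem ext_inj {A B L : Type*} [CommRing A] [IsDomain A] [CommRing B] [IsDomain B] [Field L]
    [IsAlgClosed L] (f : A →+* B) (hf : Function.Injective f) (hi : f.IsIntegral) (g : A →+* L)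
    (hg : Function.Injective g) : ∃ h : B →+* L, Function.Injective h ∧ ∀ a, h (f a) = g a := by
  letI := f.toAlgebra
  letI := g.toAlgebra
  have h1 : Algebra.IsIntegral A B := ⟨hi⟩
  have h2 : FaithfulSMul A B := (faithfulSMul_iff_algebraMap_injective A B).2 hf
  have h3 : FaithfulSMul A L := (faithfulSMul_iff_algebraMap_injective A L).2 hg
  let h : B →ₐ[A] L := IsAlgClosed.lift
  refine ⟨h.toRingHom, ?_, fun a => h.commutes a⟩
  rw [RingHom.injective_iff_ker_eq_bot]
  refine Ideal.eq_bot_of_comap_eq_bot (R := A) ?_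
  rw [eq_bot_iff]
  intro a ha
  have : h (f a) = 0 := ha
  have h4 : h (f a) = g a := h.commutes a
  rw [h4] at this
  exact hg (by rw [this, map_zero])

theorem sep_poly {A B L : Type*} [CommRing A] [IsDomain A] [CharZero A] [IsIntegrallyClosed A]
    [CommRing B] [IsDomain B] [Field L] (f : A →+* B) (hf : Function.Injective f)
    (g : A →+* L) (hg : Function.Injective g) (b : B) (hb : f.IsIntegralElem b) :
    ∃ φ : Polynomial A, φ.Monic ∧ φ.eval₂ f b = 0 ∧ (φ.map g).Separable := by
  letI := f.toAlgebra
  have h2 : FaithfulSMul A B := (faithfulSMul_iff_algebraMap_injective A B).2 hf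
  have hb' : IsIntegral A b := hb
  refine ⟨minpoly A b, minpoly.monic hb', minpoly.aeval A b, ?_⟩
  have hirr := ((minpoly.monic hb').irreducible_iff_irreducible_map_fraction_map
    (K := FractionRing A)).1 (minpoly.irreducible hb')
  have : CharZero (FractionRing A) :=
    charZero_of_injective_algebraMap (IsFractionRing.injective A (FractionRing A))
  have hsep := hirr.separable
  have := hsep.map (f := IsFractionRing.lift hg)
  rw [Polynomial.map_map] at this
  have e : (IsFractionRing.lift hg).comp (algebraMap A (FractionRing A)) = g :=
    RingHom.ext fun a => IsFractionRing.lift_algebraMap hg a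
  rw [e] at this
  exact this

theorem sum_roots {A L : Type*} [CommRing A] [Nontrivial A] [Field L] [IsAlgClosed L] (g : A →+* L)
    (φ : Polynomial A) (hm : φ.Monic) (hs : (φ.map g).Separable) (e : ℕ) :
    ∃ a, ∑ r ∈ (φ.map g).roots.toFinset, r ^ e / (φ.map g).derivative.eval r = g a := by
  set S := (φ.map g).roots.toFinset with hS
  have hmm : (φ.map g).Monic := hm.map g
  have hnod : (φ.map g).roots.Nodup := Polynomial.nodup_roots hs
  have hprod : φ.map g = Lagrange.nodal S id := by
    have h1 := (IsAlgClosed.splits (φ.map g)).eq_prod_roots_of_monic hmm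
    conv_lhs => rw [h1]
    rw [Lagrange.nodal_eq, Finset.prod, hS, Multiset.toFinset_val, hnod.dedup]
    rfl
  have hcard : S.card = φ.natDegree := by
    have := congrArg Polynomial.natDegree hprod
    rw [Lagrange.natDegree_nodal, hm.natDegree_map] at this
    exact this.symm
  let q := Polynomial.X ^ e %ₘ φ
  have hq : ∀ r ∈ S, r ^ e = (q.map g).eval r := by
    intro r hr
    have h1 := Polynomial.modByMonic_add_div (Polynomial.X ^ e) φ
    have h2 := congrArg (fun p => (p.map g).eval r) h1
    have hr0 : (φ.map g).eval r = 0 := by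
      have := Multiset.mem_toFinset.1 hr
      exact (Polynomial.mem_roots'.1 this).2
    simp only [Polynomial.map_add, Polynomial.map_mul, Polynomial.eval_add, Polynomial.eval_mul,
      hr0, zero_mul, add_zero, Polynomial.map_pow, Polynomial.map_X, Polynomial.eval_pow,
      Polynomial.eval_X] at h2
    exact h2.symm
  have hdeg : (q.map g).degree < S.card := by
    rw [hcard]
    refine Polynomial.degree_map_le.trans_lt ?_
    rw [← Polynomial.degree_eq_natDegree hm.ne_zero]
    exact Polynomial.degree_modByMonic_lt _ hm
  have h3 := Lagrange.coeff_eq_sum (s := S) (v := id) (Set.injOn_id _) hdeg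
  refine ⟨q.coeff (S.card - 1), ?_⟩
  rw [← Polynomial.coeff_map, h3]
  refine Finset.sum_congr rfl fun r hr => ?_
  rw [hq r hr, hprod]
  have := Lagrange.eval_nodal_derivative_eval_node_eq (s := S) (v := (id : L → L)) hr
  simp only [id] at this ⊢
  rw [this, Lagrange.eval_nodal]
  rfl

/-- Jacobian -/
def Jac {τ R : Type*} [Fintype τ] [CommRing R] (v : τ → MvPolynomial τ R) : MvPolynomial τ R :=
  (Matrix.of fun i j => pderiv j (v i)).det

/-- lift to the kernel ideal -/
theorem mem_graph {τ k : Type*} [Fintype τ] [CommRing k] (v : τ → MvPolynomial τ k)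
    (P : MvPolynomial τ (MvPolynomial τ k))
    (hP : eval₂ (aeval v : MvPolynomial τ k →ₐ[k] _).toRingHom X P = 0) :
    ∃ a : τ → MvPolynomial τ (MvPolynomial τ k), P = ∑ i, a i * (map C (v i) - C (X i)) := by
  set I : Ideal (MvPolynomial τ (MvPolynomial τ k)) :=
    Ideal.span (Set.range fun i => map C (v i) - C (X i)) with hI
  suffices h : P ∈ I by
    rw [hI, Ideal.mem_span_range_iff_exists_fun] at h
    obtain ⟨c, hc⟩ := h
    exact ⟨c, hc.symm⟩
  have key : (Ideal.Quotient.mk I) = ((Ideal.Quotient.mk I).comp (map C)).comp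
      (eval₂Hom (aeval v : MvPolynomial τ k →ₐ[k] _).toRingHom X) := by
    refine ringHom_ext' (ringHom_ext' ?_ ?_) ?_
    · ext a; simp
    · intro i
      simp only [RingHom.coe_comp, Function.comp_apply, coe_eval₂Hom, eval₂_C]
      rw [Ideal.Quotient.eq]
      have : (C (X i) : MvPolynomial τ (MvPolynomial τ k)) - map C (v i) ∈ I := by
        rw [← neg_mem_iff, neg_sub]
        exact Ideal.subset_span ⟨i, rfl⟩
      simpa using this
    · intro i; simp
  rw [← Ideal.Quotient.eq_zero_iff_mem, key]
  simp only [RingHom.coe_comp, Function.comp_apply, coe_eval₂Hom, hP, map_zero]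

theorem sum_pi_roots {τ A L : Type*} [Fintype τ] [CommRing A] [Field L] (g : A →+* L)
    (S : τ → Finset L) (w : τ → L → L) (h : ∀ j e, ∃ a, ∑ r ∈ S j, r ^ e * w j r = g a)
    (H : MvPolynomial τ A) :
    ∃ a, ∑ ρ ∈ Fintype.piFinset S, eval₂ g ρ H * ∏ j, w j (ρ j) = g a := by
  choose a ha using h
  refine ⟨∑ s ∈ H.support, H.coeff s * ∏ j, a j (s j), ?_⟩
  simp only [eval₂_eq', Finset.sum_mul, map_sum, map_mul, map_prod, ← ha, Finset.prod_univ_sum]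
  rw [Finset.sum_comm]
  refine Finset.sum_congr rfl fun s _ => ?_
  rw [Finset.mul_sum]
  refine Finset.sum_congr rfl fun ρ _ => ?_
  rw [Finset.prod_mul_distrib, mul_assoc]

theorem residue_in {τ L : Type} [Fintype τ] [Field L] [IsAlgClosed L] [CharZero L]
    (v : τ → MvPolynomial τ ℚ)
    (hinj : Function.Injective (aeval v : MvPolynomial τ ℚ →ₐ[ℚ] MvPolynomial τ ℚ))
    (hint : (aeval v : MvPolynomial τ ℚ →ₐ[ℚ] MvPolynomial τ ℚ).toRingHom.IsIntegral)
    (g : MvPolynomial τ ℚ →+* L) (hg : Function.Injective g) :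
    ∃ Sg : Finset (τ → L), (∀ ρ, ρ ∈ Sg ↔ ∀ i, aeval ρ (v i) = g (X i)) ∧
      (∀ ρ ∈ Sg, aeval ρ (Jac v) ≠ 0) ∧
      ∀ Q : MvPolynomial τ ℚ, ∃ a, ∑ ρ ∈ Sg, aeval ρ Q / aeval ρ (Jac v) = g a := by
  have hX := fun j => sep_poly (aeval v : MvPolynomial τ ℚ →ₐ[ℚ] MvPolynomial τ ℚ).toRingHom hinj g hg
    (X j) (hint (X j))
  choose φ hφm hφ0 hφs using hX
  have hmem : ∀ j, ∃ a : τ → MvPolynomial τ (MvPolynomial τ ℚ),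
      Polynomial.aeval (X j : MvPolynomial τ (MvPolynomial τ ℚ)) (φ j) =
        ∑ i, a i * (map C (v i) - C (X i)) := by
    intro j
    apply mem_graph
    rw [← hφ0 j, Polynomial.aeval_def, ← coe_eval₂Hom, Polynomial.hom_eval₂]
    congr 1
    · ext a <;> simp
    · simp
  choose Am hAm using hmem
  let ev : (τ → L) → MvPolynomial τ (MvPolynomial τ ℚ) →+* L := fun ρ => eval₂Hom g ρ
  have hev1 : ∀ ρ (P : MvPolynomial τ ℚ), ev ρ (map C P) = aeval ρ P := by
    intro ρ P
    simp only [ev, coe_eval₂Hom, eval₂_map, aeval_def]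
    congr 1
    exact Subsingleton.elim _ _
  have hev2 : ∀ ρ (a : MvPolynomial τ ℚ), ev ρ (C a) = g a := fun ρ a => by simp [ev]
  have hev3 : ∀ ρ j (p : Polynomial (MvPolynomial τ ℚ)),
      ev ρ (Polynomial.aeval (X j) p) = (p.map g).eval (ρ j) := by
    intro ρ j p
    rw [Polynomial.aeval_def, Polynomial.hom_eval₂, Polynomial.eval_map]
    congr 1
    · ext a <;> simp [ev]
    · simp [ev]
  let S : τ → Finset L := fun j => ((φ j).map g).roots.toFinset
  have hSmem : ∀ j r, r ∈ S j ↔ ((φ j).map g).eval r = 0 := by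
    intro j r
    simp only [S, Multiset.mem_toFinset, Polynomial.mem_roots', Polynomial.IsRoot.def]
    exact and_iff_right ((hφm j).map g).ne_zero
  have hAρ : ∀ ρ j, ((φ j).map g).eval (ρ j) =
      ∑ i, ev ρ (Am j i) * (aeval ρ (v i) - g (X i)) := by
    intro ρ j
    rw [← hev3, hAm, map_sum]
    simp only [map_mul, map_sub, hev1, hev2]
  let Sg := (Fintype.piFinset S).filter fun ρ => ∀ i, aeval ρ (v i) = g (X i)
  have hSg : ∀ ρ, ρ ∈ Sg ↔ ∀ i, aeval ρ (v i) = g (X i) := by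
    intro ρ
    simp only [Sg, Finset.mem_filter, Fintype.mem_piFinset]
    refine ⟨fun h => h.2, fun h => ⟨fun j => ?_, h⟩⟩
    rw [hSmem, hAρ]
    simp [h]
  let dA : MvPolynomial τ (MvPolynomial τ ℚ) := (Matrix.of fun j i => Am j i).det
  have hdA : ∀ ρ, ev ρ dA = (Matrix.of fun j i => ev ρ (Am j i)).det := by
    intro ρ
    simp only [dA, RingHom.map_det]
    rfl
  have hJ : ∀ ρ : τ → L, aeval ρ (Jac v) = (Matrix.of fun i l => (aeval ρ (pderiv l (v i)) : L)).det := by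
    intro ρ
    simp only [Jac]
    rw [AlgHom.map_det]
    rfl
  have hder : ∀ ρ ∈ Sg, ev ρ dA * aeval ρ (Jac v) =
      ∏ j, ((φ j).map g).derivative.eval (ρ j) := by
    intro ρ hρ
    have hρ' := (hSg ρ).1 hρ
    rw [hdA, hJ, ← Matrix.det_mul, ← Matrix.det_diagonal]
    congr 1
    ext j l
    simp only [Matrix.mul_apply, Matrix.of_apply, Matrix.diagonal_apply]
    have h1 := congrArg (fun P => ev ρ (pderiv l P)) (hAm j)
    simp only [map_sum] at h1
    have h2 : ∀ i, ev ρ (pderiv l (Am j i * (map C (v i) - C (X i)))) =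
        ev ρ (Am j i) * aeval ρ (pderiv l (v i)) := by
      intro i
      rw [Derivation.leibniz, map_add]
      simp only [smul_eq_mul, map_mul, map_sub, hev1, hev2, hρ', sub_self, zero_mul, add_zero]
      rw [pderiv_C, map_zero, sub_zero, pderiv_map, hev1]
    simp only [h2] at h1
    rw [← h1]
    have h3 : pderiv l (Polynomial.aeval (X j : MvPolynomial τ (MvPolynomial τ ℚ)) (φ j)) =
        Polynomial.aeval (X j) (Polynomial.derivative (φ j)) * pderiv l (X j) := by
      have h5 := Derivation.comp_aeval_eq (X j : MvPolynomial τ (MvPolynomial τ ℚ))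
        (pderiv l : Derivation (MvPolynomial τ ℚ) (MvPolynomial τ (MvPolynomial τ ℚ)) _) (φ j)
      exact h5
    rw [h3, map_mul, hev3, pderiv_X, Pi.single_apply, Polynomial.derivative_map]
    by_cases hjl : j = l
    · simp [hjl]
    · simp [hjl, Ne.symm hjl]
  have hdne : ∀ j, ∀ r ∈ S j, ((φ j).map g).derivative.eval r ≠ 0 := by
    intro j r hr
    exact (hφs j).eval₂_derivative_ne_zero (RingHom.id L) (by simpa using (hSmem j r).1 hr)
  have hprodne : ∀ ρ ∈ Fintype.piFinset S, ∏ j, ((φ j).map g).derivative.eval (ρ j) ≠ 0 := by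
    intro ρ hρ
    rw [Finset.prod_ne_zero_iff]
    intro j _
    exact hdne j _ (Fintype.mem_piFinset.1 hρ j)
  have hJne : ∀ ρ ∈ Sg, aeval ρ (Jac v) ≠ 0 := by
    intro ρ hρ h0
    have h1 := hder ρ hρ
    rw [h0, mul_zero] at h1
    exact hprodne ρ (Finset.mem_filter.1 hρ).1 h1.symm
  refine ⟨Sg, hSg, hJne, ?_⟩
  intro Q
  obtain ⟨a, ha⟩ := sum_pi_roots g S (fun j r => (((φ j).map g).derivative.eval r)⁻¹)
    (fun j e => by
      obtain ⟨a, ha⟩ := sum_roots g (φ j) (hφm j) (hφs j) e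
      exact ⟨a, by simpa [div_eq_mul_inv] using ha⟩) (map C Q * dA)
  refine ⟨a, ?_⟩
  rw [← ha]
  simp only [Sg, Finset.sum_filter]
  refine Finset.sum_congr rfl fun ρ hρ => ?_
  have h1 : eval₂ g ρ (map C Q * dA) = aeval ρ Q * ev ρ dA := by
    rw [← hev1, ← map_mul]; rfl
  rw [h1, Finset.prod_inv_distrib]
  split_ifs with h
  · have hρ' := (hSg ρ).2 h
    rw [← hder ρ hρ']
    have h2 := hJne ρ hρ'
    have h3 : ev ρ dA ≠ 0 := by
      intro h0
      have := hder ρ hρ'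
      rw [h0, zero_mul] at this
      exact hprodne ρ hρ this.symm
    field_simp
  · have h3 : ev ρ dA = 0 := by
      rw [hdA, ← Matrix.exists_mulVec_eq_zero_iff]
      refine ⟨fun i => aeval ρ (v i) - g (X i), ?_, ?_⟩
      · intro h0
        apply h
        intro i
        exact sub_eq_zero.1 (congrFun h0 i)
      · funext j
        simp only [Matrix.mulVec, dotProduct, Matrix.of_apply, Pi.zero_apply]
        rw [← hAρ, ← hSmem]
        exact Fintype.mem_piFinset.1 hρ j
    rw [h3]; simp

end EN

namespace EN
open MvPolynomial

/-! ### Part 7: divided differences and the element Y -/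

abbrev Pa (n : ℕ) := Option (Fin n) ⊕ Fin n
abbrev XZ (n : ℕ) := MvPolynomial (Option (Fin n)) ℤ
abbrev RR (n : ℕ) := MvPolynomial (Pa n) (XZ n)

def Vp (n D m : ℕ) : Set (Pa n →₀ ℕ) :=
  {c | ∑ i, c (Sum.inl i) ≤ m ∧ ∑ j, c (Sum.inr j) ≤ (D - 1) * m}

def filP (n D : ℕ) : ℕ → AddSubgroup (RR n) := sfil (Vp n D) (filT ℤ n D)

theorem Fil_P (n D : ℕ) : Fil (filP n D) := by
  refine Fil.sfil (Fil_T ℤ n D) ?_ ?_ ?_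
  · simp [Vp]
  · rintro m m' s t ⟨h1, h2⟩ ⟨h3, h4⟩
    refine ⟨?_, ?_⟩
    · simp only [Finsupp.add_apply, Finset.sum_add_distrib]; omega
    · simp only [Finsupp.add_apply, Finset.sum_add_distrib, mul_add]; omega
  · rintro m m' hm s ⟨h1, h2⟩
    exact ⟨h1.trans hm, h2.trans (Nat.mul_le_mul_left _ hm)⟩

theorem filP_C {n D m : ℕ} {a : XZ n} (ha : a ∈ filT ℤ n D m) : C a ∈ filP n D m :=
  monomial_mem_sfil (by simp [Vp]) ha

def filI (n : ℕ) : ℕ → AddSubgroup (XZ n) :=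
  sfil (fun m => {s | s none = 0 ∧ ∑ j, s (some j) ≤ m}) (fun _ => ⊤)

def filH (n : ℕ) : ℕ → AddSubgroup (RR n) :=
  sfil (fun m => {c | ∑ i, c (Sum.inl i) = 0 ∧ ∑ j, c (Sum.inr j) ≤ m}) (filI n)

theorem Fil_I (n : ℕ) : Fil (filI n) := by
  refine Fil.sfil Fil.top ?_ ?_ ?_
  · simp
  · rintro m m' s t ⟨h1, h2⟩ ⟨h3, h4⟩
    refine ⟨?_, ?_⟩
    · simp only [Finsupp.add_apply]; omega
    · simp only [Finsupp.add_apply, Finset.sum_add_distrib]; omega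
  · rintro m m' hm s ⟨h1, h2⟩
    exact ⟨h1, h2.trans hm⟩

theorem Fil_H (n : ℕ) : Fil (filH n) := by
  refine Fil.sfil (Fil_I n) ?_ ?_ ?_
  · simp
  · rintro m m' s t ⟨h1, h2⟩ ⟨h3, h4⟩
    refine ⟨?_, ?_⟩
    · simp only [Finsupp.add_apply, Finset.sum_add_distrib]; omega
    · simp only [Finsupp.add_apply, Finset.sum_add_distrib]; omega
  · rintro m m' hm s ⟨h1, h2⟩
    exact ⟨h1, h2.trans hm⟩

theorem filH_zmul {n D : ℕ} (hD : 1 ≤ D) {a : RR n} (ha : a ∈ filH n (D - 1)) :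
    C (X none) * a ∈ filP n D 1 := by
  intro c hc
  rw [coeff_C_mul] at hc ⊢
  have hc' : a.coeff c ≠ 0 := fun h => hc (by rw [h, mul_zero])
  obtain ⟨⟨h1, h2⟩, h3⟩ := ha c hc'
  refine ⟨⟨by omega, by omega⟩, ?_⟩
  rw [mem_filT]
  intro s hs
  have hs' : s ∈ (X none * a.coeff c).support := mem_support_iff.2 hs
  rw [support_X_mul] at hs'
  obtain ⟨t, ht, rfl⟩ := Finset.mem_map.1 hs'
  obtain ⟨⟨h4, h5⟩, -⟩ := h3 t (mem_support_iff.1 ht)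
  simp only [addLeftEmbedding_apply, Ty, Set.mem_setOf_eq, Finsupp.add_apply, Finsupp.single_apply,
    if_true, reduceCtorEq, if_false, zero_add, h4]
  omega

theorem filH_x {n : ℕ} (j : Fin n) : (X (Sum.inr j) : RR n) ∈ filH n 1 := by
  refine monomial_mem_sfil ⟨?_, ?_⟩ ((Fil_I n).mono (Nat.zero_le 1) (Fil_I n).one)
  · simp [Finsupp.single_apply]
  · simp [Finsupp.single_apply]

theorem filH_xi {n : ℕ} (s : Fin n →₀ ℕ) :
    (C (rename some (monomial s 1)) : RR n) ∈ filH n s.degree := by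
  refine monomial_mem_sfil (by simp) ?_
  rw [rename_monomial]
  refine monomial_mem_sfil ⟨?_, ?_⟩ trivial
  · exact Finsupp.mapDomain_notin_range _ _ (by simp)
  · rw [deg_eq_sum]
    refine le_of_eq (Finset.sum_congr rfl fun j _ => ?_)
    exact Finsupp.mapDomain_apply (Option.some_injective _) _ _

theorem SN_RR (n : ℕ) : SN (nm n1 : RR n → ℝ) := SN_int.nm.nm

theorem Delta_mono (n : ℕ) : ∀ (m : ℕ) (s : Fin n →₀ ℕ), s.degree = m → ∃ Δ : Fin n → RR n,
    (∑ j, (X (Sum.inr j) - C (X (some j))) * Δ j =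
      rename Sum.inr (monomial s 1) - C (rename some (monomial s 1))) ∧
    (∀ j, Δ j ∈ filH n (m - 1)) ∧ ∀ j, nm n1 (Δ j) ≤ m := by
  intro m
  induction m with
  | zero =>
    intro s hs
    have : s = 0 := (Finsupp.degree_eq_zero_iff s).1 hs
    subst this
    refine ⟨fun _ => 0, ?_, fun j => zero_mem _, fun j => ?_⟩
    · simp
    · rw [(SN_RR n).zero]; simp
  | succ m ih =>
    intro s hs
    have h1 : ∃ l, s l ≠ 0 := by
      by_contra h
      push Not at h
      have : s = 0 := Finsupp.ext h
      rw [this] at hs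
      simp at hs
    obtain ⟨l, hl⟩ := h1
    obtain ⟨t, rfl⟩ : ∃ t, s = t + Finsupp.single l 1 := by
      refine ⟨s - Finsupp.single l 1, ?_⟩
      rw [tsub_add_cancel_of_le]
      rw [Finsupp.single_le_iff]
      omega
    rw [map_add, Finsupp.degree_single] at hs
    have ht : t.degree = m := by omega
    obtain ⟨Δ, e, hm, hn⟩ := ih t ht
    refine ⟨fun j => (if j = l then C (rename some (monomial t 1)) else 0) + X (Sum.inr l) * Δ j,
      ?_, ?_, ?_⟩
    · have e1 : ∀ j, (X (Sum.inr j) - C (X (some j)) : RR n) *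
          ((if j = l then C (rename some (monomial t 1)) else 0) + X (Sum.inr l) * Δ j) =
          (if j = l then (X (Sum.inr j) - C (X (some j))) * C (rename some (monomial t 1)) else 0) +
          X (Sum.inr l) * ((X (Sum.inr j) - C (X (some j))) * Δ j) := by
        intro j
        split_ifs <;> ring
      rw [Finset.sum_congr rfl fun j _ => e1 j, Finset.sum_add_distrib, ← Finset.mul_sum, e]
      rw [Finset.sum_ite_eq' Finset.univ l, if_pos (Finset.mem_univ _)]
      have e2 : ∀ {R : Type} [CommRing R], (monomial (t + Finsupp.single l 1) (1 : R)) =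
          monomial t 1 * X l := by
        intro R _
        rw [X, monomial_mul, mul_one]
      rw [e2, e2, map_mul, map_mul, map_mul, rename_X, rename_X]
      ring
    · intro j
      refine AddSubgroup.add_mem _ ?_ ?_
      · split_ifs
        · have := filH_xi t
          rw [ht] at this
          exact this
        · exact zero_mem _
      · rcases Nat.eq_zero_or_pos m with h0 | h0
        · have h3 : Δ j = 0 := by
            have h4 := hn j
            rw [h0] at h4
            have h5 := (SN_RR n).nonneg (Δ j)
            have h6 : nm n1 (Δ j) = 0 := le_antisymm (by simpa using h4) h5
            by_contra h7
            obtain ⟨c, hc⟩ := ne_zero_iff.1 h7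
            obtain ⟨s, hs⟩ := ne_zero_iff.1 hc
            have h8 := le_nm SN_int.nm (Δ j) c
            have h9 := le_nm SN_int ((Δ j).coeff c) s
            have h10 : (0 : ℝ) < |((coeff s ((Δ j).coeff c) : ℤ) : ℝ)| := abs_pos.2 (by exact_mod_cast hs)
            have h11 : nm n1 (Δ j) = nm (nm fun a : ℤ => |(a : ℝ)|) (Δ j) := rfl
            rw [h11] at h6
            linarith
          rw [h3, mul_zero]
          exact zero_mem _
        · have := (Fil_H n).mul (filH_x l) (hm j)
          have e3 : 1 + (m - 1) = m + 1 - 1 := by omega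
          rw [e3] at this
          exact this
    · intro j
      refine ((SN_RR n).add _ _).trans ?_
      push_cast
      rw [add_comm]
      refine add_le_add ?_ ?_
      · refine ((SN_RR n).mul _ _).trans ?_
        have h2 := nm_X (N := (n1 : XZ n → ℝ)) SN_int.nm (Sum.inr l : Pa n)
        have h3 := (SN_RR n).nonneg (Δ j)
        nlinarith [hn j]
      · split_ifs
        · rw [nm_C SN_int.nm, rename_monomial, nm_monomial SN_int]; simp
        · rw [(SN_RR n).zero]; simp

theorem evx {n : ℕ} {L : Type} [CommRing L] (ρ : Option (Fin n) → L) (y : Option (Fin n) → L)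
    (x : Fin n → L) (P : MvPolynomial (Fin n) ℤ) :
    eval₂Hom (aeval ρ : XZ n →ₐ[ℤ] L).toRingHom (Sum.elim y x) (rename Sum.inr (map C P)) =
      aeval x P := by
  have : (((eval₂Hom (aeval ρ : XZ n →ₐ[ℤ] L).toRingHom (Sum.elim y x)).comp
    (rename Sum.inr : MvPolynomial (Fin n) (XZ n) →ₐ[XZ n] RR n).toRingHom).comp (map C)) =
      (aeval x : MvPolynomial (Fin n) ℤ →ₐ[ℤ] L).toRingHom := by
    refine ringHom_ext' (Subsingleton.elim _ _) ?_
    intro i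
    simp
  exact congrArg (fun f => f P) this

theorem evxi {n : ℕ} {L : Type} [CommRing L] (ρ : Option (Fin n) → L)
    (P : MvPolynomial (Fin n) ℤ) :
    aeval ρ (rename some P) = aeval (fun j => ρ (some j)) P := by
  rw [aeval_rename]; rfl

theorem exists_Delta {n D : ℕ} (hD : 1 ≤ D) (F : MvPolynomial (Fin n) ℤ) (hF : F.totalDegree ≤ D) :
    ∃ Δ : Fin n → RR n,
    (∑ j, (X (Sum.inr j) - C (X (some j))) * Δ j =
      rename Sum.inr (map C F) - C (rename some F)) ∧
    (∀ j, Δ j ∈ filH n (D - 1)) ∧ (∀ j, nm n1 (Δ j) ≤ D * n1 F) ∧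
    ∀ (L : Type) [CommRing L] (ρ y : Option (Fin n) → L) (j : Fin n),
      eval₂Hom (aeval ρ : XZ n →ₐ[ℤ] L).toRingHom (Sum.elim y fun j => ρ (some j)) (Δ j) =
        aeval (fun j => ρ (some j)) (pderiv j F) := by
  choose Δ e hm hn using fun s : Fin n →₀ ℕ => Delta_mono n s.degree s rfl
  have hdeg : ∀ s ∈ F.support, s.degree ≤ D := fun s hs => by
    refine le_trans ?_ hF
    rw [deg_eq_sum]
    have := le_totalDegree hs
    rwa [Finsupp.sum_fintype _ _ (fun _ => rfl)] at this
  let Δ' : Fin n → RR n := fun j => ∑ s ∈ F.support, C (C (F.coeff s)) * Δ s j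
  have hid : ∑ j, (X (Sum.inr j) - C (X (some j))) * Δ' j =
      rename Sum.inr (map C F) - C (rename some F) := by
    have h1 : ∑ j, (X (Sum.inr j) - C (X (some j))) * Δ' j =
        ∑ s ∈ F.support, C (C (F.coeff s)) * ∑ j, (X (Sum.inr j) - C (X (some j))) * Δ s j := by
      simp only [Δ', Finset.mul_sum]
      rw [Finset.sum_comm]
      refine Finset.sum_congr rfl fun s _ => Finset.sum_congr rfl fun j _ => by ring
    rw [h1]
    conv_rhs => rw [F.as_sum]
    simp only [e, mul_sub, Finset.sum_sub_distrib, map_sum]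
    congr 1
    · refine Finset.sum_congr rfl fun s _ => ?_
      rw [map_monomial, rename_monomial, rename_monomial, C_mul_monomial, mul_one]
    · refine Finset.sum_congr rfl fun s _ => ?_
      rw [← C_mul, rename_monomial, rename_monomial, C_mul_monomial, mul_one]
  refine ⟨Δ', hid, ?_, ?_, ?_⟩
  · intro j
    refine AddSubgroup.sum_mem _ fun s hs => ?_
    have h2 : (C (C (F.coeff s)) : RR n) ∈ filH n 0 :=
      monomial_mem_sfil (by simp) (monomial_mem_sfil (by simp) trivial)
    have := (Fil_H n).mul h2 (hm s j)
    refine (Fil_H n).mono ?_ this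
    have := hdeg s hs
    omega
  · intro j
    refine ((SN_RR n).sum _ _).trans ?_
    have h3 : (D : ℝ) * n1 F = ∑ s ∈ F.support, |((F.coeff s : ℤ) : ℝ)| * D := by
      rw [← Finset.sum_mul, mul_comm]; rfl
    rw [h3]
    refine Finset.sum_le_sum fun s hs => ?_
    refine ((SN_RR n).mul _ _).trans ?_
    rw [nm_C SN_int.nm, nm_C SN_int]
    refine mul_le_mul_of_nonneg_left ((hn s j).trans ?_) (abs_nonneg _)
    exact_mod_cast hdeg s hs
  · intro L _ ρ y j
    have h4 := congrArg (fun P => eval₂Hom (aeval ρ : XZ n →ₐ[ℤ] L).toRingHom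
      (Sum.elim y fun j => ρ (some j)) (pderiv (Sum.inr j) P)) hid
    simp only [map_sum, map_sub, Derivation.leibniz, smul_eq_mul, map_add, map_mul, pderiv_C,
      pderiv_X, map_zero, sub_zero] at h4
    rw [pderiv_rename Sum.inr_injective, pderiv_map, evx] at h4
    rw [← h4, Finset.sum_eq_single j]
    · simp
    · intro l _ hl
      have : (Pi.single (Sum.inr j) 1 : Pa n → RR n) (Sum.inr l) = 0 := by
        rw [Pi.single_apply, if_neg]
        simpa using hl
      simp [this]
    · simp

theorem totalDegree_pderiv_le' {n D : ℕ} (F : MvPolynomial (Fin n) ℤ) (hF : F.totalDegree ≤ D)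
    (j : Fin n) : (pderiv j F).totalDegree ≤ D := by
  rw [totalDegree]
  refine Finset.sup_le ?_
  intro s hs
  rw [mem_support_iff, coeff_pderiv] at hs
  have h1 : F.coeff (s + Finsupp.single j 1) ≠ 0 := by
    intro h; apply hs; simp [h]
  have h2 := le_totalDegree (mem_support_iff.2 h1)
  rw [Finsupp.sum_fintype _ _ (fun _ => rfl)] at h2 ⊢
  simp only [Finsupp.add_apply, Finset.sum_add_distrib] at h2
  omega

theorem n1_pderiv_le {n D : ℕ} (F : MvPolynomial (Fin n) ℤ) (hF : F.totalDegree ≤ D)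
    (j : Fin n) : n1 (pderiv j F) ≤ D * n1 F := by
  have h3 : (D : ℝ) * n1 F = ∑ s ∈ F.support, |((F.coeff s : ℤ) : ℝ)| * D := by
    rw [← Finset.sum_mul, mul_comm]; rfl
  rw [h3]
  conv_lhs => rw [F.as_sum, map_sum]
  refine (nm_sum SN_int _ _).trans (Finset.sum_le_sum fun s hs => ?_)
  rw [pderiv_monomial, nm_monomial SN_int]
  push_cast
  rw [abs_mul, Nat.abs_cast]
  refine mul_le_mul_of_nonneg_left ?_ (abs_nonneg _)
  have h2 := (le_totalDegree hs).trans hF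
  rw [Finsupp.sum_fintype _ _ (fun _ => rfl)] at h2
  have h4 := Finset.single_le_sum (f := fun i => s i) (fun i _ => Nat.zero_le _) (Finset.mem_univ j)
  exact_mod_cast h4.trans h2

theorem n1_rename {n : ℕ} (F : MvPolynomial (Fin n) ℤ) : n1 (rename some F) ≤ n1 F := by
  conv_lhs => rw [F.as_sum, map_sum]
  refine (nm_sum SN_int _ _).trans (Finset.sum_le_sum fun s hs => ?_)
  rw [rename_monomial, nm_monomial SN_int]

theorem pderiv_Psi_none {n : ℕ} (F : Option (Fin n) → MvPolynomial (Fin n) ℤ) (i) :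
    pderiv none (Psi F i) = rename some (F i) := by
  have h : pderiv none (rename some (F i) : XZ n) = 0 := by
    refine pderiv_eq_zero_of_notMem_vars ?_
    intro h
    have := vars_rename some (F i) h
    simp at this
  rw [Psi, map_add, Derivation.leibniz, h, pderiv_X_self]
  cases i with
  | none => simp
  | some j => simp [pderiv_X_of_ne]

theorem pderiv_Psi_some {n : ℕ} (F : Option (Fin n) → MvPolynomial (Fin n) ℤ) (i) (j : Fin n) :
    pderiv (some j) (Psi F i) = rename some (pderiv j (F i)) * X none + if i = some j then 1 else 0 := by
  rw [Psi, map_add, Derivation.leibniz, pderiv_rename (Option.some_injective _),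
    pderiv_X_of_ne (by simp)]
  cases i with
  | none => simp [mul_comm]
  | some l =>
    simp only [Option.elim, pderiv_X, Pi.single_apply, smul_zero, smul_eq_mul, Option.some_inj]
    rw [mul_zero, zero_add, mul_comm]

theorem Fil.det2 {R : Type*} [CommRing R] {G : ℕ → AddSubgroup R} (h : Fil G) {ι : Type*}
    [Fintype ι] [DecidableEq ι] (M : Matrix ι ι R) (hM : ∀ i j, M i j ∈ G 1) :
    M.det ∈ G (Fintype.card ι) := by
  have := h.det M hM
  convert this

theorem SN.det2 {R : Type*} [CommRing R] {N : R → ℝ} (h : SN N) {ι : Type*} [Fintype ι]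
    [DecidableEq ι] (M : Matrix ι ι R) (B : ι → ℝ) (hB : ∀ i j, N (M i j) ≤ B j) :
    N M.det ≤ (Fintype.card ι).factorial * ∏ j, B j := by
  have := h.det M B hB
  convert this

theorem Jac_eq {τ R : Type*} [Fintype τ] [DecidableEq τ] [CommRing R] (v : τ → MvPolynomial τ R) :
    Jac v = (Matrix.of fun i j => pderiv j (v i)).det := by
  unfold Jac
  congr

theorem zJac_fil {n D : ℕ} (hD : 1 ≤ D) (F : Option (Fin n) → MvPolynomial (Fin n) ℤ)
    (hF : ∀ i, (F i).totalDegree ≤ D) : X none * Jac (Psi F) ∈ filT ℤ n D (n + 1) := by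
  have e : X none * Jac (Psi F) = ((Matrix.of fun i j => pderiv j (Psi F i)).updateCol none
      ((X none : XZ n) • fun i => pderiv none (Psi F i))).det := by
    rw [Matrix.det_updateCol_smul, Jac]
    congr 2
    exact (Matrix.updateCol_eq_self (Matrix.of fun i j => pderiv j (Psi F i)) none).symm
  rw [e]
  have hc : Fintype.card (Option (Fin n)) = n + 1 := by simp
  rw [← hc]
  refine (Fil_T ℤ n D).det2 _ ?_
  intro i j
  cases j with
  | none =>
    rw [Matrix.updateCol_self]
    simp only [Pi.smul_apply, smul_eq_mul, pderiv_Psi_none]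
    rw [mul_comm]
    exact filT_mulz hD _ (hF i)
  | some j =>
    rw [Matrix.updateCol_ne (by simp)]
    simp only [Matrix.of_apply, pderiv_Psi_some]
    refine AddSubgroup.add_mem _ (filT_mulz hD _ (totalDegree_pderiv_le' _ (hF i) j)) ?_
    split_ifs
    · exact (Fil_T ℤ n D).mono (Nat.zero_le _) (Fil_T ℤ n D).one
    · exact zero_mem _

theorem zJac_n1 {n D : ℕ} (F : Option (Fin n) → MvPolynomial (Fin n) ℤ)
    (hF : ∀ i, (F i).totalDegree ≤ D) (Φ : ℝ) (hΦ : ∀ i, n1 (F i) ≤ Φ) :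
    n1 (X none * Jac (Psi F)) ≤ (n + 1).factorial * (Φ * (D * Φ + 1) ^ n) := by
  have hS : SN (n1 : XZ n → ℝ) := SN_int.nm
  have h1 : n1 (Jac (Psi F)) ≤ (n + 1).factorial * (Φ * (D * Φ + 1) ^ n) := by
    have := hS.det2 (Matrix.of fun i j => pderiv j (Psi F i))
      (fun j => j.elim Φ fun _ => D * Φ + 1) ?_
    · rw [Fintype.prod_option] at this
      rw [Jac_eq]
      simpa using this
    · intro i j
      cases j with
      | none =>
        simp only [Matrix.of_apply, pderiv_Psi_none, Option.elim]
        exact (n1_rename _).trans (hΦ i)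
      | some j =>
        simp only [Matrix.of_apply, pderiv_Psi_some, Option.elim]
        refine (hS.add _ _).trans (add_le_add ?_ ?_)
        · refine (hS.mul _ _).trans ?_
          have h2 := (n1_rename (pderiv j (F i))).trans (n1_pderiv_le (F i) (hF i) j)
          have h3 : (D : ℝ) * n1 (F i) ≤ D * Φ :=
            mul_le_mul_of_nonneg_left (hΦ i) (Nat.cast_nonneg _)
          have h4 : n1 (X none : XZ n) ≤ 1 := nm_X SN_int _
          have h5 := hS.nonneg (rename some (pderiv j (F i)))
          nlinarith
        · split_ifs
          · exact hS.one
          · rw [hS.zero]; simp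
  refine (hS.mul _ _).trans ?_
  have h4 : n1 (X none : XZ n) ≤ 1 := nm_X SN_int _
  have h5 := hS.nonneg (Jac (Psi F))
  nlinarith

theorem Y_num {n D : ℕ} (hD : 1 ≤ D) (Φ : ℝ) (h0 : 0 ≤ Φ) :
    ((n + 1).factorial : ℝ) * (Φ * (D * Φ + 1) ^ n) + (n + 1).factorial * (1 * (D * Φ + 1) ^ n) ≤
      ((n + 1) * (D * (Φ + 1))) ^ (n + 1) := by
  have h1 : ((n + 1).factorial : ℝ) ≤ ((n : ℝ) + 1) ^ (n + 1) := by
    exact_mod_cast Nat.factorial_le_pow (n + 1)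
  have hD' : (1 : ℝ) ≤ D := by exact_mod_cast hD
  have h2 : ((D : ℝ) * Φ + 1) ^ n ≤ (D * (Φ + 1)) ^ n := by
    gcongr; linarith
  have h3 : Φ + 1 ≤ D * (Φ + 1) := by nlinarith
  calc _ = ((n + 1).factorial : ℝ) * ((Φ + 1) * (D * Φ + 1) ^ n) := by ring
    _ ≤ ((n : ℝ) + 1) ^ (n + 1) * ((D * (Φ + 1)) * (D * (Φ + 1)) ^ n) := by
      gcongr
    _ = _ := by rw [mul_pow ((n : ℝ) + 1), pow_succ ((D : ℝ) * (Φ + 1))]; ring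

def filY (n : ℕ) : ℕ → AddSubgroup (RR n) :=
  sfil (fun _ => {c : Pa n →₀ ℕ | ∑ i, c (Sum.inl i) = 0}) (fun _ => ⊤)

theorem Fil_Y (n : ℕ) : Fil (filY n) := by
  refine Fil.sfil Fil.top (by simp) ?_ (fun _ => le_rfl)
  intro m m' s t hs ht
  simp only [Set.mem_setOf_eq, Finsupp.add_apply, Finset.sum_add_distrib] at hs ht ⊢
  omega

theorem exists_Y1 {n D : ℕ} (hD : 1 ≤ D) (F : Option (Fin n) → MvPolynomial (Fin n) ℤ)
    (hF : ∀ i, (F i).totalDegree ≤ D) (Φ : ℝ) (hΦ : ∀ i, n1 (F i) ≤ Φ) :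
    ∃ Y1 : RR n, (∀ c, Y1.coeff c ≠ 0 → ∑ i, c (Sum.inl i) = 1) ∧
      C (X none) * Y1 ∈ filP n D (n + 1) ∧
      C (X none * Jac (Psi F)) ∈ filP n D (n + 1) ∧
      nm n1 (C (X none * Jac (Psi F)) + C (X none) * Y1) ≤ ((n + 1) * (D * (Φ + 1))) ^ (n + 1) ∧
      ∀ (L : Type) [Field L] (ρ ρ0 : Option (Fin n) → L),
        (∀ i, aeval ρ (Psi F i) = aeval ρ0 (Psi F i)) →
        eval₂Hom (aeval ρ : XZ n →ₐ[ℤ] L).toRingHom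
          (Sum.elim (fun i => aeval (fun j => ρ0 (some j)) (F i)) fun j => ρ0 (some j)) Y1 =
          if ρ = ρ0 then aeval ρ (Jac (Psi F)) else 0 := by
  choose Δ hid hfil hnm hdiag using fun i => exists_Delta hD (F i) (hF i)
  let M : (Option (Fin n) → RR n) → Matrix (Option (Fin n)) (Option (Fin n)) (RR n) := fun y =>
    Matrix.of fun i j => j.elim (y i) fun j => C (X none) * Δ i j + if i = some j then 1 else 0
  have hMup : ∀ y, M y = (M 0).updateCol none y := by
    intro y
    ext1 i j
    cases j <;> simp [M, Matrix.updateCol_apply]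
  have hΦ0 : 0 ≤ Φ := (SN_int.nm.nonneg _).trans (hΦ none)
  have hone : (1 : RR n) ∈ filP n D 1 := (Fil_P n D).mono (Nat.zero_le _) (Fil_P n D).one
  have hcol : ∀ i j, C (X none) * Δ i j + (if i = some j then 1 else 0) ∈ filP n D 1 := by
    intro i j
    refine AddSubgroup.add_mem _ (filH_zmul hD (hfil i j)) ?_
    split_ifs
    · exact hone
    · exact zero_mem _
  have hz : nm n1 (C (X none) : RR n) ≤ 1 := by
    rw [nm_C SN_int.nm]; exact nm_X SN_int _
  have hcoln : ∀ i j, nm n1 (C (X none) * Δ i j + (if i = some j then 1 else 0) : RR n)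
      ≤ D * Φ + 1 := by
    intro i j
    refine ((SN_RR n).add _ _).trans (add_le_add ?_ ?_)
    · refine ((SN_RR n).mul _ _).trans ?_
      have h1 := hnm i j
      have h2 : (D : ℝ) * n1 (F i) ≤ D * Φ := mul_le_mul_of_nonneg_left (hΦ i) (Nat.cast_nonneg _)
      have h3 := (SN_RR n).nonneg (Δ i j)
      nlinarith
    · split_ifs
      · exact (SN_RR n).one
      · rw [(SN_RR n).zero]; simp
  have hY1 : (M fun i => X (Sum.inl i)).det =
      ∑ i, X (Sum.inl i) * (M (Pi.single i 1)).det := by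
    have h1 : ∀ y, (M y).det = (M 0).cramer y none := by
      intro y
      rw [Matrix.cramer_apply, ← hMup]
    simp only [h1]
    have h2 : (fun i => X (Sum.inl i) : Option (Fin n) → RR n) =
        ∑ i, (X (Sum.inl i) : RR n) • (Pi.single i 1 : Option (Fin n) → RR n) := by
      ext1 j
      simp [Finset.sum_apply, Pi.single_apply]
    conv_lhs => rw [h2]
    simp [map_sum, Finset.sum_apply]
  have hzM : ∀ y, C (X none) * (M y).det = (M (fun i => C (X none) * y i)).det := by
    intro y
    have h1 : ∀ y, (M y).det = (M 0).cramer y none := by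
      intro y
      rw [Matrix.cramer_apply, ← hMup]
    rw [h1, h1]
    have h2 : (fun i => C (X none) * y i) = (C (X none) : RR n) • y := rfl
    rw [h2, map_smul]; rfl
  refine ⟨(M fun i => X (Sum.inl i)).det, ?_, ?_, ?_, ?_, ?_⟩
  · intro c hc
    rw [hY1, coeff_sum] at hc
    obtain ⟨i, -, hi⟩ := Finset.exists_ne_zero_of_sum_ne_zero hc
    have hmem : (M (Pi.single i 1)).det ∈ filY n (Fintype.card (Option (Fin n))) := by
      have hfl := Fil_Y n
      refine hfl.det2 _ ?_
      intro i' j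
      cases j with
      | none =>
        simp only [M, Matrix.of_apply, Option.elim, Pi.single_apply]
        split_ifs
        · exact hfl.mono (Nat.zero_le _) hfl.one
        · exact zero_mem _
      | some j =>
        simp only [M, Matrix.of_apply, Option.elim]
        refine AddSubgroup.add_mem _ ?_ ?_
        · intro c hc
          rw [coeff_C_mul] at hc
          have hc' : (Δ i' j).coeff c ≠ 0 := fun h => hc (by rw [h, mul_zero])
          exact ⟨(hfil i' j c hc').1.1, trivial⟩
        · split_ifs
          · exact hfl.mono (Nat.zero_le _) hfl.one
          · exact zero_mem _
    have hs' : c ∈ (X (Sum.inl i) * (M (Pi.single i 1)).det).support := mem_support_iff.2 hi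
    rw [support_X_mul] at hs'
    obtain ⟨t, ht, rfl⟩ := Finset.mem_map.1 hs'
    have := (hmem t (mem_support_iff.1 ht)).1
    simp only [Set.mem_setOf_eq] at this
    simp only [addLeftEmbedding_apply, Finsupp.add_apply, Finset.sum_add_distrib, this]
    simp [Finsupp.single_apply]
  · rw [hzM]
    have hc : Fintype.card (Option (Fin n)) = n + 1 := by simp
    rw [← hc]
    refine (Fil_P n D).det2 _ ?_
    intro i j
    cases j with
    | none =>
      simp only [M, Matrix.of_apply, Option.elim]
      rw [C_mul_X_eq_monomial]
      refine monomial_mem_sfil ⟨?_, ?_⟩ ?_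
      · simp [Finsupp.single_apply]
      · simp [Finsupp.single_apply]
      · have := filT_mulz hD (1 : MvPolynomial (Fin n) ℤ) (by simp)
        simpa using this
    | some j => exact hcol i j
  · exact filP_C (zJac_fil hD F hF)
  · refine ((SN_RR n).add _ _).trans (le_trans (add_le_add ?_ ?_) (Y_num hD Φ hΦ0))
    · rw [nm_C SN_int.nm]
      exact zJac_n1 F hF Φ hΦ
    · rw [hzM]
      have := (SN_RR n).det2 (M fun i => C (X none) * X (Sum.inl i))
        (fun j => j.elim 1 fun _ => D * Φ + 1) ?_
      · rw [Fintype.prod_option] at this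
        simpa using this
      · intro i j
        cases j with
        | none =>
          simp only [M, Matrix.of_apply, Option.elim]
          refine ((SN_RR n).mul _ _).trans ?_
          have h2 := nm_X (N := (n1 : XZ n → ℝ)) SN_int.nm (Sum.inl i : Pa n)
          have h3 := (SN_RR n).nonneg (X (Sum.inl i))
          have h4 := (SN_RR n).nonneg (C (X none))
          nlinarith
        | some j => exact hcoln i j
  · intro L _ ρ ρ0 hρ
    set E := eval₂Hom (aeval ρ : XZ n →ₐ[ℤ] L).toRingHom
          (Sum.elim (fun i => aeval (fun j => ρ0 (some j)) (F i)) fun j => ρ0 (some j)) with hE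
    have hEC : ∀ a, E (C a) = aeval ρ a := fun a => by simp [hE]
    have hdet : E (M fun i => X (Sum.inl i)).det = (Matrix.of fun i j : Option (Fin n) =>
        j.elim (aeval (fun j => ρ0 (some j)) (F i)) fun j =>
          ρ none * E (Δ i j) + if i = some j then 1 else 0).det := by
      rw [RingHom.map_det]
      congr 1
      ext i j
      cases j with
      | none => simp [M, hE]
      | some j =>
        simp only [M, RingHom.mapMatrix_apply, Matrix.map_apply, Matrix.of_apply, Option.elim,
          map_add, map_mul, hEC, aeval_X]
        split_ifs <;> simp
    rw [hdet]
    split_ifs with h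
    · subst h
      rw [Jac_eq, AlgHom.map_det]
      congr 1
      ext i j
      cases j with
      | none =>
        simp only [Matrix.of_apply, Option.elim, AlgHom.mapMatrix_apply, Matrix.map_apply,
          pderiv_Psi_none, evxi]
      | some j =>
        simp only [Matrix.of_apply, Option.elim, AlgHom.mapMatrix_apply, Matrix.map_apply,
          pderiv_Psi_some, map_add, map_mul, evxi, aeval_X]
        rw [hE, hdiag i L ρ _ j, mul_comm]
        split_ifs <;> simp
    · rw [← Matrix.exists_mulVec_eq_zero_iff]
      refine ⟨fun i => ρ0 i - ρ i, ?_, ?_⟩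
      · intro h0
        apply h
        ext i
        exact (sub_eq_zero.1 (congrFun h0 i)).symm
      · funext i
        simp only [Matrix.mulVec, dotProduct, Matrix.of_apply, Pi.zero_apply]
        rw [Fintype.sum_option]
        simp only [Option.elim]
        have h1 := congrArg E (hid i)
        simp only [map_sum, map_mul, map_sub, hEC, aeval_X] at h1
        rw [hE, evx, ← hE, evxi] at h1
        have h2 : ∀ j : Fin n, E (X (Sum.inr j)) = ρ0 (some j) := fun j => by simp [hE]
        simp only [h2] at h1
        have h3 : ∑ j : Fin n, (ρ none * E (Δ i j) + if i = some j then 1 else 0) *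
            (ρ0 (some j) - ρ (some j)) = ρ none * ∑ j, (ρ0 (some j) - ρ (some j)) * E (Δ i j) +
              i.elim 0 (fun j => ρ0 (some j) - ρ (some j)) := by
          rw [Finset.mul_sum]
          simp only [add_mul, Finset.sum_add_distrib]
          congr 1
          · exact Finset.sum_congr rfl fun j _ => by ring
          · cases i with
            | none => simp
            | some l => simp
        rw [h3, h1]
        have h4 := hρ i
        simp only [Psi, map_add, map_mul, aeval_X, evxi] at h4
        have h5 : ∀ r : Option (Fin n) → L, aeval r (i.elim (0 : XZ n) fun j => X (some j)) =
            i.elim 0 fun j => r (some j) := by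
          intro r; cases i <;> simp
        rw [h5, h5] at h4
        have h6 : i.elim (0 : L) (fun j => ρ0 (some j) - ρ (some j)) =
            i.elim 0 (fun j => ρ0 (some j)) - i.elim 0 (fun j => ρ (some j)) := by
          cases i <;> simp
        rw [h6]
        linear_combination -h4

end EN

namespace EN
open MvPolynomial

/-! ### Part 8: the characteristic polynomial of Y -/

theorem newton_mem {ι R : Type*} [Fintype ι] [CommRing R] (K : Subring R) (y : ι → R)
    (hdiv : ∀ (k : ℕ) (x : R), k ≠ 0 → (k : R) * x ∈ K → x ∈ K)
    (hp : ∀ k, ∑ i, y i ^ k ∈ K) (k : ℕ) : (Finset.univ.val.map y).esymm k ∈ K := by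
  rw [← aeval_esymm_eq_multiset_esymm ι ℤ k y]
  induction k using Nat.strong_induction_on with
  | _ k ih =>
    rcases Nat.eq_zero_or_pos k with h0 | h0
    · subst h0; simp
    · apply hdiv k _ h0.ne'
      have h1 := congrArg (aeval y) (mul_esymm_eq_sum ι ℤ k)
      simp only [map_mul, map_natCast, map_pow, map_neg, map_one, map_sum] at h1
      rw [h1]
      refine K.mul_mem (K.pow_mem (K.neg_mem K.one_mem) _) (K.sum_mem fun a ha => ?_)
      refine K.mul_mem (K.mul_mem (K.pow_mem (K.neg_mem K.one_mem) _) (ih _ ?_)) ?_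
      · exact (Finset.mem_filter.1 ha).2
      · have := hp a.2
        simpa [psum] using this

theorem charpoly_lift {ι A R : Type*} [CommRing A] [CommRing R] (f : A →+* R)
    (S : Finset ι) (y : ι → R)
    (hdiv : ∀ (k : ℕ) (x : R), k ≠ 0 → (k : R) * x ∈ f.range → x ∈ f.range)
    (hp : ∀ k, ∑ i ∈ S, y i ^ k ∈ f.range) :
    ∃ q : Polynomial A, q.map f = ∏ i ∈ S, (Polynomial.X - Polynomial.C (y i)) ∧ q.Monic := by
  have hmon : (∏ i ∈ S, (Polynomial.X - Polynomial.C (y i))).Monic :=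
    Polynomial.monic_prod_of_monic _ _ fun i _ => Polynomial.monic_X_sub_C _
  have hl : (∏ i ∈ S, (Polynomial.X - Polynomial.C (y i))) ∈ Polynomial.lifts f := by
    have h1 : ∏ i ∈ S, (Polynomial.X - Polynomial.C (y i)) =
        ((Finset.univ.val.map fun i : S => y i).map fun t => Polynomial.X - Polynomial.C t).prod := by
      rw [← Finset.prod_coe_sort, Multiset.map_map]; rfl
    rw [h1, Multiset.prod_X_sub_X_eq_sum_esymm, Polynomial.lifts_iff_coeff_lifts]
    intro m
    show _ ∈ f.range
    rw [Polynomial.finset_sum_coeff]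
    refine Subring.sum_mem _ fun j _ => ?_
    have h2 := newton_mem f.range (fun i : S => y i) hdiv (fun k => by
      rw [Finset.sum_coe_sort S (fun i => y i ^ k)]; exact hp k) j
    have h3 : ((-1) ^ j * (Polynomial.C ((Finset.univ.val.map fun i : S => y i).esymm j) *
        Polynomial.X ^ (Multiset.card (Finset.univ.val.map fun i : S => y i) - j)) :
        Polynomial R).coeff m =
        (-1) ^ j * ((Finset.univ.val.map fun i : S => y i).esymm j * if m =
          (Multiset.card (Finset.univ.val.map fun i : S => y i) - j) then 1 else 0) := by
      have : ((-1) ^ j : Polynomial R) = Polynomial.C ((-1) ^ j) := by simp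
      rw [this, Polynomial.coeff_C_mul, Polynomial.coeff_C_mul, Polynomial.coeff_X_pow]
    rw [h3]
    refine Subring.mul_mem _ (Subring.pow_mem _ (Subring.neg_mem _ (Subring.one_mem _)) _)
      (Subring.mul_mem _ h2 ?_)
    split_ifs
    · exact Subring.one_mem _
    · exact Subring.zero_mem _
  obtain ⟨q, h1, -, h2⟩ := Polynomial.lifts_and_natDegree_eq_and_monic hl hmon
  exact ⟨q, h1, h2⟩

/-- y-degree at least m -/
def Eb (n : ℕ) (L : Type*) [CommRing L] (m : ℕ) : AddSubgroup (MvPolynomial (Pa n) L) where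
  carrier := {P | ∀ c, P.coeff c ≠ 0 → m ≤ ∑ i, c (Sum.inl i)}
  zero_mem' := by intro c hc; simp at hc
  add_mem' := by
    intro P Q hP hQ c hc
    rw [coeff_add] at hc
    by_cases h : P.coeff c = 0
    · exact hQ c (by rwa [h, zero_add] at hc)
    · exact hP c h
  neg_mem' := by
    intro P hP c hc
    rw [coeff_neg] at hc
    exact hP c (neg_ne_zero.1 hc)

theorem Eb_mul {n : ℕ} {L : Type*} [CommRing L] {a b : ℕ} {P Q : MvPolynomial (Pa n) L}
    (hP : P ∈ Eb n L a) (hQ : Q ∈ Eb n L b) : P * Q ∈ Eb n L (a + b) := by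
  intro c hc
  rw [coeff_mul] at hc
  obtain ⟨⟨s, t⟩, hst, h⟩ := Finset.exists_ne_zero_of_sum_ne_zero hc
  have h1 := hP s (left_ne_zero_of_mul h)
  have h2 := hQ t (right_ne_zero_of_mul h)
  rw [← Finset.HasAntidiagonal.mem_antidiagonal.1 hst]
  simp only [Finsupp.add_apply, Finset.sum_add_distrib]
  omega

theorem prod_one_add {n : ℕ} {L ι : Type*} [CommRing L] (S : Finset ι)
    (w : ι → MvPolynomial (Pa n) L) (hw : ∀ i ∈ S, w i ∈ Eb n L 1) :
    ∏ i ∈ S, (1 + w i) - (1 + ∑ i ∈ S, w i) ∈ Eb n L 2 := by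
  induction S using Finset.induction_on with
  | empty => simpa using (Eb n L 2).zero_mem
  | insert a s ha ih =>
    rw [Finset.prod_insert ha, Finset.sum_insert ha]
    have h1 := ih fun i hi => hw i (Finset.mem_insert_of_mem hi)
    have h2 := hw a (Finset.mem_insert_self a s)
    have h3 : ∑ i ∈ s, w i ∈ Eb n L 1 :=
      AddSubgroup.sum_mem _ fun i hi => hw i (Finset.mem_insert_of_mem hi)
    have e : (1 + w a) * ∏ i ∈ s, (1 + w i) - (1 + (w a + ∑ i ∈ s, w i)) =
      (1 + w a) * (∏ i ∈ s, (1 + w i) - (1 + ∑ i ∈ s, w i)) + w a * ∑ i ∈ s, w i := by ring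
    rw [e]
    refine AddSubgroup.add_mem _ ?_ (Eb_mul h2 h3)
    have h4 : (1 + w a) ∈ Eb n L 0 := fun c _ => Nat.zero_le _
    have := Eb_mul h4 h1
    rwa [zero_add] at this

theorem residue_mv {ι A XX L τ : Type*} [CommRing A] [CommRing XX] [Field L] (g : A →+* L)
    (S : Finset ι) (e : ι → XX →+* L) (J : ι → L)
    (h : ∀ Q, ∃ a, ∑ ρ ∈ S, e ρ Q / J ρ = g a) (P : MvPolynomial τ XX) :
    ∃ a : MvPolynomial τ A, ∑ ρ ∈ S, C (J ρ)⁻¹ * map (e ρ) P = map g a ∧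
      (Function.Injective g → ∀ c, a.coeff c ≠ 0 → P.coeff c ≠ 0) := by
  choose a ha using h
  have hmain : ∑ ρ ∈ S, C (J ρ)⁻¹ * map (e ρ) P =
    map g (∑ s ∈ P.support, monomial s (a (P.coeff s))) := by
    ext c
    rw [coeff_sum, map_sum, coeff_sum]
    simp only [coeff_C_mul, coeff_map, map_monomial, coeff_monomial, ← ha]
    rw [Finset.sum_ite_eq']
    split_ifs with hc
    · exact Finset.sum_congr rfl fun ρ _ => by rw [div_eq_inv_mul]
    · rw [notMem_support_iff.1 hc]; simp
  refine ⟨_, hmain, ?_⟩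
  intro hg c hc hP
  apply hc
  apply hg
  rw [← coeff_map, ← hmain, coeff_sum, map_zero]
  exact Finset.sum_eq_zero fun ρ _ => by rw [coeff_C_mul, coeff_map, hP, map_zero, mul_zero]

theorem exists_nat_pt {τ L : Type*} [Finite τ] [Field L] [CharZero L] (P : MvPolynomial τ L)
    (hP : P ≠ 0) : ∃ p : τ → ℕ, eval (fun i => (p i : L)) P ≠ 0 := by
  by_contra h
  push Not at h
  apply hP
  refine funext_set (fun _ => Set.range (Nat.cast : ℕ → L)) (fun _ => ?_) ?_
  · exact Set.infinite_range_of_injective Nat.cast_injective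
  · intro x hx
    choose p hp using fun i => hx i trivial
    have : x = fun i => (p i : L) := funext fun i => (hp i).symm
    rw [this, h, map_zero]

theorem prod_dvd {ι R : Type*} [CommRing R] [IsDomain R] (S : Finset ι) (y : ι → R)
    (hy : Set.InjOn y S) (W : Polynomial R) (h : ∀ i ∈ S, W.eval (y i) = 0) :
    ∏ i ∈ S, (Polynomial.X - Polynomial.C (y i)) ∣ W := by
  induction S using Finset.induction_on generalizing W with
  | empty => simp
  | insert a s ha ih =>
    rw [Finset.prod_insert ha]
    obtain ⟨V, rfl⟩ := Polynomial.dvd_iff_isRoot.2 (h a (Finset.mem_insert_self _ _))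
    refine mul_dvd_mul_left _ (ih (hy.mono (by simp)) V ?_)
    intro i hi
    have h1 := h i (Finset.mem_insert_of_mem hi)
    rw [Polynomial.eval_mul] at h1
    rcases mul_eq_zero.1 h1 with h2 | h2
    · exfalso
      simp only [Polynomial.eval_sub, Polynomial.eval_X, Polynomial.eval_C, sub_eq_zero] at h2
      have := hy (Finset.mem_coe.2 (Finset.mem_insert_of_mem hi))
        (Finset.mem_coe.2 (Finset.mem_insert_self _ _)) h2
      exact ha (this ▸ hi)
    · exact h2

end EN

namespace EN
open MvPolynomial

/-! ### Part 9: the characteristic polynomial -/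

theorem charpoly_abs {ι A XX L τ : Type} [Finite τ] [CommRing A] [IsDomain A] [Algebra ℚ A] [CommRing XX]
    [Field L] [CharZero L] (g : A →+* L) (hg : Function.Injective g) (S : Finset ι)
    (e : ι → XX →+* L) (ψ : A →+* XX) (hψ : ∀ ρ ∈ S, ∀ a, e ρ (ψ a) = g a) (J : XX)
    (hJ : ∀ ρ ∈ S, e ρ J ≠ 0)
    (hres : ∀ Q, ∃ a, ∑ ρ ∈ S, e ρ Q / e ρ J = g a) (Y : MvPolynomial τ XX)
    (hY : Set.InjOn (fun ρ => map (e ρ) Y) S) :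
    ∃ M : Polynomial (MvPolynomial τ A), M.Monic ∧
      M.map (map g) = ∏ ρ ∈ S, (Polynomial.X - Polynomial.C (map (e ρ) Y)) ∧
      (∀ W : Polynomial (MvPolynomial τ A), W.eval₂ (map ψ) Y = 0 → M ∣ W) ∧
      ∀ q : MvPolynomial τ A, q ≠ 0 → ∃ p : τ → ℕ, eval (fun i => (p i : A)) q ≠ 0 ∧
        ∀ W : Polynomial A, W.eval₂ ψ (eval (fun i => (p i : XX)) Y) = 0 →
          M.map (eval fun i => (p i : A)) ∣ W := by
  have hmg : Function.Injective (map g : MvPolynomial τ A →+* MvPolynomial τ L) := map_injective g hg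
  obtain ⟨M, hM, hmon⟩ := charpoly_lift (map g : MvPolynomial τ A →+* MvPolynomial τ L) S
    (fun ρ => map (e ρ) Y) (by
      rintro k x hk ⟨a, ha⟩
      refine ⟨C (algebraMap ℚ A (1 / k)) * a, ?_⟩
      have hgk : g (algebraMap ℚ A (1 / k)) * (k : L) = 1 := by
        rw [← map_natCast g, ← map_natCast (algebraMap ℚ A), ← map_mul, ← map_mul]
        simp [hk]
      rw [map_mul, ha, map_C, ← mul_assoc, ← map_natCast (C : L →+* MvPolynomial τ L), ← C_mul, hgk,
        C_1, one_mul]) (by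
      intro k
      obtain ⟨a, ha, -⟩ := residue_mv g S e (fun ρ => e ρ J) hres (C J * Y ^ k)
      refine ⟨a, ?_⟩
      rw [← ha]
      refine Finset.sum_congr rfl fun ρ hρ => ?_
      rw [map_mul, map_C, map_pow, ← mul_assoc, ← C_mul, inv_mul_cancel₀ (hJ ρ hρ), C_1, one_mul])
  refine ⟨M, hmon, hM, ?_, ?_⟩
  · intro W hW
    rw [← Polynomial.map_dvd_map _ hmg hmon, hM]
    refine prod_dvd S _ hY _ fun ρ hρ => ?_
    have h1 := congrArg (map (e ρ)) hW
    rw [Polynomial.hom_eval₂, map_zero] at h1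
    rw [Polynomial.eval_map]
    have hcomp : (map (e ρ)).comp (map ψ) = (map g : MvPolynomial τ A →+* MvPolynomial τ L) := by
      refine ringHom_ext (fun a => ?_) (fun i => ?_)
      · simp [hψ ρ hρ]
      · simp
    rwa [hcomp] at h1
  · intro q hq
    have hq' : map g q ≠ 0 := fun h => hq (hmg (by rw [h, map_zero]))
    have hP : map g q * ∏ r ∈ S.offDiag, (map (e r.1) Y - map (e r.2) Y) ≠ 0 := by
      refine mul_ne_zero hq' (Finset.prod_ne_zero_iff.2 fun r hr => ?_)
      obtain ⟨h1, h2, h3⟩ := Finset.mem_offDiag.1 hr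
      exact fun h => h3 (hY h1 h2 (sub_eq_zero.1 h))
    obtain ⟨p, hp⟩ := exists_nat_pt _ hP
    rw [map_mul, map_prod] at hp
    have hnat : ∀ {B : Type} [CommRing B] (f : B →+* L) (Q : MvPolynomial τ B),
        eval (fun i => (p i : L)) (map f Q) = f (eval (fun i => (p i : B)) Q) := by
      intro B _ f Q
      have : (eval (fun i => (p i : L))).comp (map f) = f.comp (eval (fun i => (p i : B))) := by
        refine ringHom_ext (fun a => ?_) (fun i => ?_)
        · simp
        · simp
      exact congrArg (fun f => f Q) this
    have hinj : Set.InjOn (fun ρ => e ρ (eval (fun i => (p i : XX)) Y)) S := by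
      intro r hr r' hr' h
      by_contra hne
      have := Finset.prod_ne_zero_iff.1 (right_ne_zero_of_mul hp) (r, r')
        (Finset.mem_offDiag.2 ⟨hr, hr', hne⟩)
      apply this
      simp only [map_sub, hnat]
      exact sub_eq_zero.2 h
    refine ⟨p, fun h => left_ne_zero_of_mul hp (by rw [hnat, h, map_zero]), fun W hW => ?_⟩
    rw [← Polynomial.map_dvd_map g hg (hmon.map _)]
    have hm : (M.map (eval fun i => (p i : A))).map g =
        ∏ ρ ∈ S, (Polynomial.X - Polynomial.C (e ρ (eval (fun i => (p i : XX)) Y))) := by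
      have := congrArg (Polynomial.map (eval fun i => (p i : L))) hM
      rw [Polynomial.map_map, Polynomial.map_prod] at this
      rw [Polynomial.map_map]
      have hcomp : g.comp (eval fun i => (p i : A)) = (eval fun i => (p i : L)).comp (map g) := by
        refine ringHom_ext (fun a => ?_) (fun i => ?_)
        · simp
        · simp
      rw [hcomp, this]
      refine Finset.prod_congr rfl fun ρ _ => ?_
      rw [Polynomial.map_sub, Polynomial.map_X, Polynomial.map_C, hnat]
    rw [hm]
    refine prod_dvd S _ hinj _ fun ρ hρ => ?_
    have h1 := congrArg (e ρ) hW
    rw [Polynomial.hom_eval₂, map_zero] at h1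
    rw [Polynomial.eval_map]
    have hcomp : (e ρ).comp ψ = g := RingHom.ext (hψ ρ hρ)
    rwa [hcomp] at h1

theorem const_abs {n D : ℕ} {ι A XX L : Type} [CommRing A] [CommRing XX] [Field L] (g : A →+* L)
    (hg : Function.Injective g) (S : Finset ι) (e : ι → XX →+* L) (J z : XX)
    (hJ : ∀ ρ ∈ S, e ρ J ≠ 0) (hz : ∀ ρ ∈ S, e ρ z ≠ 0)
    (hres : ∀ Q, ∃ a, ∑ ρ ∈ S, e ρ Q / e ρ J = g a) (Y1 : MvPolynomial (Pa n) XX)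
    (hY1 : ∀ c, Y1.coeff c ≠ 0 → ∑ i, c (Sum.inl i) = 1 ∧ ∑ i, c (Sum.inr i) ≤ (D - 1) * (n + 1))
    (M : Polynomial (MvPolynomial (Pa n) A))
    (hM : M.map (map g) = ∏ ρ ∈ S, (Polynomial.X - Polynomial.C (map (e ρ) (C (z * J) + C z * Y1))))
    (hmon : M.Monic) :
    ∃ a1 : MvPolynomial (Pa n) A, (M.coeff 0).coeff 0 ≠ 0 ∧
      (∀ c : Pa n →₀ ℕ, ∑ i, c (Sum.inl i) = 1 →
        (M.coeff 0).coeff c = (M.coeff 0).coeff 0 * a1.coeff c) ∧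
      (∀ c, a1.coeff c ≠ 0 → ∑ i, c (Sum.inl i) = 1 ∧ ∑ i, c (Sum.inr i) ≤ (D - 1) * (n + 1)) ∧
      (∀ c, (M.coeff 0).coeff c ≠ 0 → c ∈ Vp n D ((n + 1) * M.natDegree)) ∧
      ∑ ρ ∈ S, C (e ρ J)⁻¹ * map (e ρ) Y1 = map g a1 := by
  obtain ⟨a1, ha1, hsup⟩ := residue_mv g S e (fun ρ => e ρ J) hres Y1
  have hc0 : map g (M.coeff 0) = ∏ ρ ∈ S, (-(map (e ρ) (C (z * J) + C z * Y1))) := by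
    rw [← Polynomial.coeff_map, hM, Polynomial.coeff_zero_eq_eval_zero, Polynomial.eval_prod]
    simp
  set κ := ∏ ρ ∈ S, (-(e ρ z * e ρ J)) with hκ
  have hκ0 : κ ≠ 0 := Finset.prod_ne_zero_iff.2 fun ρ hρ =>
    neg_ne_zero.2 (mul_ne_zero (hz ρ hρ) (hJ ρ hρ))
  let w : ι → MvPolynomial (Pa n) L := fun ρ => C (e ρ J)⁻¹ * map (e ρ) Y1
  have hc1 : map g (M.coeff 0) = C κ * ∏ ρ ∈ S, (1 + w ρ) := by
    rw [hc0, hκ, map_prod, ← Finset.prod_mul_distrib]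
    refine Finset.prod_congr rfl fun ρ hρ => ?_
    have : (C (e ρ J) * C (e ρ J)⁻¹ : MvPolynomial (Pa n) L) = 1 := by
      rw [← C_mul, mul_inv_cancel₀ (hJ ρ hρ), C_1]
    simp only [w, map_add, map_mul, map_C, map_neg]
    linear_combination (C (e ρ z) * map (e ρ) Y1) * this
  have hw : ∀ ρ ∈ S, w ρ ∈ Eb n L 1 := by
    intro ρ _ c hc
    simp only [w, coeff_C_mul, coeff_map] at hc
    exact (hY1 c fun h => hc (by rw [h, map_zero, mul_zero])).1.ge
  have hw0 := prod_one_add S w hw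
  have hsum : ∑ ρ ∈ S, w ρ = map g a1 := ha1
  rw [hsum] at hw0
  have key : ∀ c : Pa n →₀ ℕ, ∑ i, c (Sum.inl i) < 2 →
      g ((M.coeff 0).coeff c) = κ * (coeff c 1 + g (a1.coeff c)) := by
    intro c hc
    rw [← coeff_map, hc1, coeff_C_mul]
    congr 1
    have h1 : coeff c (∏ ρ ∈ S, (1 + w ρ) - (1 + map g a1)) = 0 := by
      by_contra h
      have := hw0 c h
      omega
    rw [coeff_sub, sub_eq_zero] at h1
    rw [h1, coeff_add, coeff_map]
  have ha1s : ∀ c, a1.coeff c ≠ 0 → ∑ i, c (Sum.inl i) = 1 ∧ ∑ i, c (Sum.inr i) ≤ (D - 1) * (n + 1) :=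
    fun c hc => hY1 c (hsup hg c hc)
  have ha10 : a1.coeff 0 = 0 := by
    by_contra h
    have := (ha1s 0 h).1
    simp at this
  have hk0 : g ((M.coeff 0).coeff 0) = κ := by
    rw [key 0 (by simp), ha10]; simp
  refine ⟨a1, fun h => hκ0 (by rw [← hk0, h, map_zero]), ?_, ha1s, ?_, ha1⟩
  · intro c hc
    apply hg
    rw [key c (by omega), map_mul, hk0]
    have : coeff c (1 : MvPolynomial (Pa n) L) = 0 := by
      rw [coeff_one, if_neg]
      rintro rfl
      simp at hc
    rw [this, zero_add]
  · have hfil : Fil (sfil (Vp n D) (fun _ => (⊤ : AddSubgroup L))) := by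
      refine Fil.sfil Fil.top ?_ ?_ ?_
      · simp [Vp]
      · rintro m m' s t ⟨h1, h2⟩ ⟨h3, h4⟩
        refine ⟨?_, ?_⟩
        · simp only [Finsupp.add_apply, Finset.sum_add_distrib]; omega
        · simp only [Finsupp.add_apply, Finset.sum_add_distrib, mul_add]; omega
      · rintro m m' hm s ⟨h1, h2⟩
        exact ⟨h1.trans hm, h2.trans (Nat.mul_le_mul_left _ hm)⟩
    have hdeg : M.natDegree = S.card := by
      by_cases hL : Nontrivial (MvPolynomial (Pa n) A)
      · rw [← hmon.natDegree_map (map g : MvPolynomial (Pa n) A →+* _), hM,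
          Polynomial.natDegree_prod_of_monic _ _ fun ρ _ => Polynomial.monic_X_sub_C _]
        simp only [Polynomial.natDegree_X_sub_C]
        simp
      · exfalso
        rw [not_nontrivial_iff_subsingleton] at hL
        have : map g (1 : MvPolynomial (Pa n) A) = map g 0 := by rw [Subsingleton.elim 1 (0 : MvPolynomial (Pa n) A)]
        simp at this
    intro c hc
    have hmem : map g (M.coeff 0) ∈ sfil (Vp n D) (fun _ => (⊤ : AddSubgroup L)) (∑ ρ ∈ S, (n + 1)) := by
      rw [hc0]
      refine hfil.prod S _ _ fun ρ hρ => ?_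
      refine AddSubgroup.neg_mem _ ?_
      rw [mem_sfil]
      intro c hc
      refine ⟨?_, trivial⟩
      simp only [map_add, map_mul, map_C, coeff_add, coeff_C_mul, coeff_map] at hc
      by_cases h0 : Y1.coeff c = 0
      · rw [h0, map_zero, mul_zero, add_zero, coeff_C] at hc
        have : c = 0 := by
          by_contra h
          exact hc (by rw [if_neg fun h' => h h'.symm, mul_zero])
        subst this
        simp [Vp]
      · have := hY1 c h0
        exact ⟨by omega, this.2⟩
    rw [Finset.sum_const, smul_eq_mul, mul_comm] at hmem
    rw [hdeg]
    refine ((mem_sfil).1 hmem c ?_).1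
    rw [coeff_map]
    exact fun h => hc (hg (by rw [h, map_zero]))

end EN

namespace EN
open MvPolynomial

/-! ### Part 10: the characteristic polynomial, concretely -/

abbrev XQ (n : ℕ) := MvPolynomial (Option (Fin n)) ℚ
abbrev cq (n : ℕ) : XZ n →+* XQ n := map (Int.castRingHom ℚ)
abbrev FQ {n : ℕ} (F : Option (Fin n) → MvPolynomial (Fin n) ℤ) : Option (Fin n) → MvPolynomial (Fin n) ℚ :=
  fun i => map (Int.castRingHom ℚ) (F i)
abbrev psi {n : ℕ} (F : Option (Fin n) → MvPolynomial (Fin n) ℤ) : XQ n →+* XQ n :=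
  (aeval (Psi (FQ F)) : XQ n →ₐ[ℚ] XQ n).toRingHom

theorem Jac_map {n : ℕ} (F : Option (Fin n) → MvPolynomial (Fin n) ℤ) :
    Jac (Psi (FQ F)) = cq n (Jac (Psi F)) := by
  rw [Jac_eq, Jac_eq, RingHom.map_det]
  congr 1
  ext1 i j
  simp only [Matrix.of_apply, RingHom.mapMatrix_apply, Matrix.map_apply]
  rw [← pderiv_map, Psi_map]

theorem aeval_cq {τ L : Type} [Field L] [CharZero L] (ρ : τ → L)
    (P : MvPolynomial τ ℤ) : aeval ρ (map (Int.castRingHom ℚ) P) = aeval ρ P := by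
  rw [aeval_def, eval₂_map, aeval_def]
  congr 1
  exact Subsingleton.elim _ _

theorem exists_M_aux {n D : ℕ} {L : Type} [Field L] [IsAlgClosed L] [CharZero L]
    (g : XQ n →+* L) (hg : Function.Injective g)
    (F : Option (Fin n) → MvPolynomial (Fin n) ℤ)
    (hint : ∀ i, IsIntegral (Algebra.adjoin ℚ (Set.range (Psi (FQ F)))) (X i : XQ n))
    (Y1 : RR n) (hY1 : ∀ c, Y1.coeff c ≠ 0 → ∑ i, c (Sum.inl i) = 1)
    (hfil : C (X none) * Y1 ∈ filP n D (n + 1))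
    (hev : ∀ (ρ ρ0 : Option (Fin n) → L),
        (∀ i, aeval ρ (Psi F i) = aeval ρ0 (Psi F i)) →
        eval₂Hom (aeval ρ : XZ n →ₐ[ℤ] L).toRingHom
          (Sum.elim (fun i => aeval (fun j => ρ0 (some j)) (F i)) fun j => ρ0 (some j)) Y1 =
          if ρ = ρ0 then aeval ρ (Jac (Psi F)) else 0) :
    ∃ (M : Polynomial (MvPolynomial (Pa n) (XQ n))) (a1 : MvPolynomial (Pa n) (XQ n)), M.Monic ∧
      (∀ W : Polynomial (MvPolynomial (Pa n) (XQ n)), W.eval₂ (map (psi F))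
        (map (cq n) (C (X none * Jac (Psi F)) + C (X none) * Y1)) = 0 → M ∣ W) ∧
      (∀ q : MvPolynomial (Pa n) (XQ n), q ≠ 0 → ∃ p : Pa n → ℕ,
        eval (fun i => (p i : XQ n)) q ≠ 0 ∧
        ∀ W : Polynomial (XQ n), W.eval₂ (psi F) (eval (fun i => (p i : XQ n))
          (map (cq n) (C (X none * Jac (Psi F)) + C (X none) * Y1))) = 0 →
          M.map (eval fun i => (p i : XQ n)) ∣ W) ∧
      (M.coeff 0).coeff 0 ≠ 0 ∧
      (∀ c : Pa n →₀ ℕ, ∑ i, c (Sum.inl i) = 1 →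
        (M.coeff 0).coeff c = (M.coeff 0).coeff 0 * a1.coeff c) ∧
      (∀ c, a1.coeff c ≠ 0 → ∑ i, c (Sum.inl i) = 1 ∧ ∑ i, c (Sum.inr i) ≤ (D - 1) * (n + 1)) ∧
      (∀ c, (M.coeff 0).coeff c ≠ 0 → c ∈ Vp n D ((n + 1) * M.natDegree)) ∧
      eval₂ (aeval (fun i : Option (Fin n) => i.elim 0 X) : XQ n →ₐ[ℚ] MvPolynomial (Fin n) ℚ).toRingHom
        (Sum.elim (FQ F) X) a1 = 1 := by
  obtain ⟨hinj, hint'⟩ := injective_of_integral (Psi (FQ F)) hint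
  obtain ⟨S, hS, hJ, hres⟩ := residue_in (Psi (FQ F)) hinj hint' g hg
  obtain ⟨h, hh, hhg⟩ := ext_inj (psi F) hinj hint' g hg
  set J := Jac (Psi (FQ F)) with hJdef
  let e : (Option (Fin n) → L) → XQ n →+* L := fun ρ => (aeval ρ : XQ n →ₐ[ℚ] L).toRingHom
  have he : ∀ ρ (P : XZ n), e ρ (cq n P) = aeval ρ P := fun ρ P => aeval_cq ρ P
  have hψ : ∀ ρ ∈ S, ∀ a, e ρ (psi F a) = g a := by
    intro ρ hρ a
    have : (e ρ).comp (psi F) = g := by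
      refine ringHom_ext' (Subsingleton.elim _ _) fun i => ?_
      have := (hS ρ).1 hρ i
      simpa [e, psi] using this
    exact congrArg (fun f => f a) this
  have hz : ∀ ρ ∈ S, e ρ (X none) ≠ 0 := by
    intro ρ hρ h0
    have h1 := (hS ρ).1 hρ none
    have h2 : aeval ρ (X none : XQ n) = 0 := h0
    simp only [Psi, map_add, map_mul, h2, Option.elim, map_zero, mul_zero, add_zero] at h1
    exact X_ne_zero (R := ℚ) (none : Option (Fin n)) (hg (by rw [← h1, map_zero]))
  have hPsi : ∀ ρ ∈ S, ∀ ρ' ∈ S, ∀ i, aeval ρ (Psi F i) = aeval ρ' (Psi F i) := by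
    intro ρ hρ ρ' hρ' i
    rw [← aeval_cq, ← aeval_cq, Psi_map]
    exact ((hS ρ).1 hρ i).trans ((hS ρ').1 hρ' i).symm
  let pt : (Option (Fin n) → L) → Pa n → L := fun ρ0 =>
    Sum.elim (fun i => aeval (fun j => ρ0 (some j)) (F i)) fun j => ρ0 (some j)
  have hpt : ∀ ρ ∈ S, ∀ ρ0 ∈ S, eval (pt ρ0) (map (e ρ) (map (cq n) Y1)) =
      if ρ = ρ0 then e ρ J else 0 := by
    intro ρ hρ ρ0 hρ0
    rw [map_map, eval_map]
    have h1 : (e ρ).comp (cq n) = (aeval ρ : XZ n →ₐ[ℤ] L).toRingHom := RingHom.ext (he ρ)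
    rw [h1, hJdef, Jac_map, he]
    exact hev ρ ρ0 (hPsi ρ hρ ρ0 hρ0)
  have hY1' : ∀ c, Y1.coeff c ≠ 0 → ∑ i, c (Sum.inl i) = 1 ∧ ∑ i, c (Sum.inr i) ≤ (D - 1) * (n + 1) := by
    intro c hc
    refine ⟨hY1 c hc, ?_⟩
    have := ((mem_sfil).1 hfil c (by
      rw [coeff_C_mul]; exact mul_ne_zero (X_ne_zero _) hc)).1
    exact this.2
  have hY1q : ∀ c, (map (cq n) Y1).coeff c ≠ 0 →
      ∑ i, c (Sum.inl i) = 1 ∧ ∑ i, c (Sum.inr i) ≤ (D - 1) * (n + 1) := by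
    intro c hc
    rw [coeff_map] at hc
    exact hY1' c fun h => hc (by rw [h, map_zero])
  have hYeq : map (cq n) (C (X none * Jac (Psi F)) + C (X none) * Y1) =
      C (X none * J) + C (X none) * map (cq n) Y1 := by
    simp only [map_add, map_mul, map_C, hJdef, Jac_map]
    simp
  rw [hYeq]
  obtain ⟨M, hmon, hM, hdvd, hspec⟩ := charpoly_abs g hg S e (psi F) hψ J hJ hres
    (C (X none * J) + C (X none) * map (cq n) Y1) (by
      intro ρ hρ ρ' hρ' heq
      by_contra hne
      have h0 : ∀ ρ, coeff 0 (map (e ρ) (C (X none * J) + C (X none) * map (cq n) Y1)) =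
          e ρ (X none) * e ρ J := by
        intro ρ
        have : (map (cq n) Y1).coeff 0 = 0 := by
          by_contra h
          have := (hY1q 0 h).1
          simp at this
        rw [coeff_map, coeff_add, coeff_C_mul, this, mul_zero, add_zero, coeff_C, if_pos rfl, map_mul]
      have h1 := congrArg (coeff 0) heq
      simp only [h0] at h1
      have h2 := congrArg (eval (pt ρ)) heq
      simp only [map_add, map_mul, map_C, eval_C, hpt ρ hρ ρ hρ, hpt ρ' hρ' ρ hρ, if_true,
        if_neg (Ne.symm hne), mul_zero, add_zero] at h2
      rw [← h1] at h2
      exact mul_ne_zero (hz ρ hρ) (hJ ρ hρ) (by linear_combination h2))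
  obtain ⟨a1, h1, h2, h3, h4, h5⟩ := const_abs (D := D) g hg S e J (X none) hJ hz hres (map (cq n) Y1) hY1q M
    hM hmon
  refine ⟨M, a1, hmon, hdvd, hspec, h1, h2, h3, h4, ?_⟩
  -- the generic point
  let ρ0 : Option (Fin n) → L := fun i => h (X i)
  have hρh : e ρ0 = h := by
    refine ringHom_ext' (Subsingleton.elim _ _) fun i => ?_
    simp [e, ρ0]
  have hρ0 : ρ0 ∈ S := by
    rw [hS]
    intro i
    have : e ρ0 (psi F (X i)) = g (X i) := by rw [hρh, hhg]
    simpa [e, psi] using this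
  have h6 := congrArg (eval (pt ρ0)) h5
  rw [map_sum, eval_map] at h6
  have h7 : ∑ ρ ∈ S, eval (pt ρ0) (C (e ρ J)⁻¹ * map (e ρ) (map (cq n) Y1)) = 1 := by
    rw [Finset.sum_eq_single ρ0]
    · rw [map_mul, eval_C, hpt _ hρ0 _ hρ0, if_pos rfl]
      exact inv_mul_cancel₀ (hJ _ hρ0)
    · intro ρ hρ hne
      rw [map_mul, hpt _ hρ _ hρ0, if_neg hne, mul_zero]
    · exact fun hn => absurd hρ0 hn
  rw [h7] at h6
  have h8 : eval₂ (psi F) (Sum.elim (fun i => rename some (FQ F i)) fun j => X (some j)) a1 = 1 := by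
    apply hh
    rw [map_one, h6]
    have hcomp : h.comp (psi F) = g := RingHom.ext hhg
    rw [← hcomp]
    rw [← coe_eval₂Hom, ← coe_eval₂Hom]
    have : h.comp (eval₂Hom (psi F) (Sum.elim (fun i => rename some (FQ F i)) fun j => X (some j))) =
        eval₂Hom (h.comp (psi F)) (pt ρ0) := by
      refine ringHom_ext (fun a => ?_) (fun i => ?_)
      · simp
      · rcases i with i | j
        · simp only [RingHom.comp_apply, eval₂Hom_X', Sum.elim_inl, pt]
          rw [← hρh]
          show aeval ρ0 (rename some (FQ F i)) = _
          rw [aeval_rename, aeval_cq]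
          rfl
        · simp [pt, ρ0]
    exact congrArg (fun f => f a1) this
  have h9 := congrArg (aeval (fun i : Option (Fin n) => i.elim 0 X) : XQ n →ₐ[ℚ] MvPolynomial (Fin n) ℚ).toRingHom h8
  rw [map_one] at h9
  rw [← h9, ← coe_eval₂Hom, ← coe_eval₂Hom]
  generalize hθ : (aeval (fun i : Option (Fin n) => i.elim 0 X) : XQ n →ₐ[ℚ] MvPolynomial (Fin n) ℚ).toRingHom = θ
  have hθX : ∀ i, θ (X i) = i.elim 0 X := by intro i; rw [← hθ]; simp
  have hθr : ∀ P : MvPolynomial (Fin n) ℚ, θ (rename some P) = P := by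
    intro P
    rw [← hθ]
    show aeval _ (rename some P) = _
    rw [aeval_rename]
    exact aeval_X_left_apply P
  have : θ.comp (eval₂Hom (psi F) (Sum.elim (fun i => rename some (FQ F i)) fun j => X (some j))) =
        eval₂Hom θ (Sum.elim (FQ F) X) := by
    refine ringHom_ext (fun a => ?_) (fun i => ?_)
    · simp only [RingHom.comp_apply, eval₂Hom_C]
      have : θ.comp (psi F) = θ := by
        refine ringHom_ext' (Subsingleton.elim _ _) fun i => ?_
        simp only [RingHom.comp_apply]
        have : psi F (X i) = Psi (FQ F) i := by simp [psi]
        rw [this, Psi, map_add, map_mul, hθX none]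
        cases i <;> simp [hθX]
      exact congrArg (fun f => f a) this
    · rcases i with i | j
      · simp [hθr]
      · simp [hθX]
  exact (congrArg (fun f => f a1) this).symm

theorem exists_M {n D : ℕ}
    (F : Option (Fin n) → MvPolynomial (Fin n) ℤ)
    (hint : ∀ i, IsIntegral (Algebra.adjoin ℚ (Set.range (Psi (FQ F)))) (X i : XQ n))
    (Y1 : RR n) (hY1 : ∀ c, Y1.coeff c ≠ 0 → ∑ i, c (Sum.inl i) = 1)
    (hfil : C (X none) * Y1 ∈ filP n D (n + 1))
    (hev : ∀ (L : Type) [Field L] (ρ ρ0 : Option (Fin n) → L),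
        (∀ i, aeval ρ (Psi F i) = aeval ρ0 (Psi F i)) →
        eval₂Hom (aeval ρ : XZ n →ₐ[ℤ] L).toRingHom
          (Sum.elim (fun i => aeval (fun j => ρ0 (some j)) (F i)) fun j => ρ0 (some j)) Y1 =
          if ρ = ρ0 then aeval ρ (Jac (Psi F)) else 0) :
    ∃ (M : Polynomial (MvPolynomial (Pa n) (XQ n))) (a1 : MvPolynomial (Pa n) (XQ n)), M.Monic ∧
      (∀ W : Polynomial (MvPolynomial (Pa n) (XQ n)), W.eval₂ (map (psi F))
        (map (cq n) (C (X none * Jac (Psi F)) + C (X none) * Y1)) = 0 → M ∣ W) ∧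
      (∀ q : MvPolynomial (Pa n) (XQ n), q ≠ 0 → ∃ p : Pa n → ℕ,
        eval (fun i => (p i : XQ n)) q ≠ 0 ∧
        ∀ W : Polynomial (XQ n), W.eval₂ (psi F) (eval (fun i => (p i : XQ n))
          (map (cq n) (C (X none * Jac (Psi F)) + C (X none) * Y1))) = 0 →
          M.map (eval fun i => (p i : XQ n)) ∣ W) ∧
      (M.coeff 0).coeff 0 ≠ 0 ∧
      (∀ c : Pa n →₀ ℕ, ∑ i, c (Sum.inl i) = 1 →
        (M.coeff 0).coeff c = (M.coeff 0).coeff 0 * a1.coeff c) ∧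
      (∀ c, a1.coeff c ≠ 0 → ∑ i, c (Sum.inl i) = 1 ∧ ∑ i, c (Sum.inr i) ≤ (D - 1) * (n + 1)) ∧
      (∀ c, (M.coeff 0).coeff c ≠ 0 → c ∈ Vp n D ((n + 1) * M.natDegree)) ∧
      eval₂ (aeval (fun i : Option (Fin n) => i.elim 0 X) : XQ n →ₐ[ℚ] MvPolynomial (Fin n) ℚ).toRingHom
        (Sum.elim (FQ F) X) a1 = 1 := by
  let K := FractionRing (XQ n)
  let g : XQ n →+* AlgebraicClosure K := (algebraMap K (AlgebraicClosure K)).comp (algebraMap (XQ n) K)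
  have hg : Function.Injective g :=
    (algebraMap K (AlgebraicClosure K)).injective.comp (IsFractionRing.injective (XQ n) K)
  haveI : CharZero (AlgebraicClosure K) := charZero_of_injective_ringHom hg
  exact exists_M_aux g hg F hint Y1 hY1 hfil (hev _)

end EN

namespace EN
open MvPolynomial

/-! ### Part 11: degree bound -/

def wE (n : ℕ) : Polynomial (XQ n) →+* MvPolynomial (Option (Option (Fin n))) ℚ :=
  (optionEquivLeft ℚ (Option (Fin n))).symm.toRingEquiv.toRingHom.comp
    (Polynomial.expand (XQ n) (n + 1)).toRingHom

theorem wE_inj (n : ℕ) : Function.Injective (wE n) :=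
  (optionEquivLeft ℚ (Option (Fin n))).symm.injective.comp
    (Polynomial.expand_injective (Nat.succ_pos n))

theorem wE_coeff {n : ℕ} (P : Polynomial (XQ n)) (s : Option (Option (Fin n)) →₀ ℕ) :
    (wE n P).coeff s = ((Polynomial.expand (XQ n) (n + 1) P).coeff (s none)).coeff s.some := by
  rw [← optionEquivLeft_coeff_some_coeff_none]
  simp [wE]

theorem tdeg_le_iff {τ R : Type*} [Fintype τ] [CommRing R] (P : MvPolynomial τ R) (N : ℕ) :
    P.totalDegree ≤ N ↔ ∀ s, P.coeff s ≠ 0 → ∑ i, s i ≤ N := by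
  rw [totalDegree, Finset.sup_le_iff]
  refine forall_congr' fun s => ?_
  rw [mem_support_iff, Finsupp.sum_fintype _ _ fun _ => rfl]

theorem wE_le {n N : ℕ} (P : Polynomial (XQ n)) : (wE n P).totalDegree ≤ N ↔
    ∀ b c, (P.coeff b).coeff c ≠ 0 → ∑ i, c i + (n + 1) * b ≤ N := by
  rw [tdeg_le_iff]
  constructor
  · intro h b c hc
    have := h (c.optionElim ((n + 1) * b)) (by
      rw [wE_coeff]
      simpa [Polynomial.coeff_expand_mul'] using hc)
    rw [Fintype.sum_option] at this
    simp only [Finsupp.optionElim_apply_none, Finsupp.optionElim_apply_some] at this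
    omega
  · intro h s hs
    rw [wE_coeff, Polynomial.coeff_expand (Nat.succ_pos n)] at hs
    split_ifs at hs with hd
    · have := h _ _ hs
      rw [Nat.mul_div_cancel' hd] at this
      rw [Fintype.sum_option]
      simp only [Finsupp.some_apply] at this
      omega
    · simp at hs

def pol (n N : ℕ) : (UF n N → ℚ) →ₗ[ℚ] Polynomial (XQ n) :=
  Fintype.linearCombination ℚ (fun x : UF n N => Polynomial.monomial x.1.1 (monomial x.1.2 (1 : ℚ)))

theorem pol_coeff {n N : ℕ} (t : UF n N → ℚ) (b : ℕ) (a : Option (Fin n) →₀ ℕ) :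
    ((pol n N t).coeff b).coeff a = if h : (⟨b, a⟩ : (_ : ℕ) × (Option (Fin n) →₀ ℕ)) ∈ UF n N then t ⟨_, h⟩ else 0 := by
  rw [pol, Fintype.linearCombination_apply, Polynomial.finset_sum_coeff, coeff_sum]
  have h1 : ∀ x : UF n N, coeff a ((t x • Polynomial.monomial x.1.1 (monomial x.1.2 (1 : ℚ)) :
      Polynomial (XQ n)).coeff b) = if x.1 = ⟨b, a⟩ then t x else 0 := by
    rintro ⟨⟨b', a'⟩, hx⟩
    rw [Polynomial.coeff_smul, coeff_smul, Polynomial.coeff_monomial]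
    by_cases hb : b' = b
    · subst hb
      by_cases ha : a' = a
      · subst ha; simp
      · simp [ha]
    · simp [hb]
  simp only [h1]
  split_ifs with h
  · rw [Finset.sum_eq_single ⟨_, h⟩]
    · simp
    · intro x _ hx
      rw [if_neg fun h' => hx (Subtype.ext h')]
    · simp
  · refine Finset.sum_eq_zero fun x _ => if_neg ?_
    intro h'
    exact h (h' ▸ x.2)

theorem pol_inj (n N : ℕ) : Function.Injective (pol n N) := by
  intro t t' h
  ext ⟨⟨b, a⟩, hx⟩
  have := congrArg (fun P => (Polynomial.coeff P b).coeff a) h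
  simpa [pol_coeff, hx] using this

theorem pol_range {n N : ℕ} (Q : Polynomial (XQ n)) (h : (wE n Q).totalDegree ≤ N) :
    Q ∈ LinearMap.range (pol n N) := by
  rw [wE_le] at h
  refine ⟨fun x => (Q.coeff x.1.1).coeff x.1.2, ?_⟩
  ext b a
  rw [pol_coeff]
  split_ifs with h'
  · rfl
  · by_contra hne
    exact h' (mem_UF.2 (h b a (Ne.symm hne)))

theorem deg_bound {n D : ℕ} (hD : 2 ≤ D) (v : Option (Fin n) → XQ n) (hv : ∀ i, v i ∈ filT ℚ n D 1)
    (u : XQ n) (hu : u ∈ filT ℚ n D (n + 1)) (μ : Polynomial (XQ n)) (hμ : μ.Monic)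
    (hdvd : ∀ W : Polynomial (XQ n), W.eval₂ (aeval v : XQ n →ₐ[ℚ] XQ n).toRingHom u = 0 → μ ∣ W)
    (b : ℕ) (c : Option (Fin n) →₀ ℕ) (hc : (μ.coeff b).coeff c ≠ 0) :
    ∑ i, c i + (n + 1) * b < (n + 1) * (Nf D n + 1) := by
  set w := (n + 1) * (Nf D n + 1) with hw
  obtain ⟨N, hN⟩ := count_deg n D hD
  rw [← hw] at hN
  by_contra hlt
  have hwμ : w ≤ (wE n μ).totalDegree := by
    have := (wE_le μ).1 le_rfl b c hc
    omega
  let ev : Polynomial (XQ n) →ₗ[ℚ] XQ n :=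
    { toFun := fun W => W.eval₂ (aeval v : XQ n →ₐ[ℚ] XQ n).toRingHom u
      map_add' := fun _ _ => Polynomial.eval₂_add _ _
      map_smul' := by
        intro r W
        rw [← algebraMap_smul (XQ n) r W, Polynomial.eval₂_smul, Algebra.smul_def]
        simp [MvPolynomial.algebraMap_eq] }
  let φ := ev.comp (pol n (N + w))
  have hrk := φ.finrank_range_add_finrank_ker
  have h1 : Module.finrank ℚ (LinearMap.range φ) ≤ (TyF n D (N + w)).card := by
    obtain ⟨h1, h2⟩ := finrank_restrict (k := ℚ) (Ty n D (N + w)) _ fun s => mem_TyF.symm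
    rw [← h2]
    refine Submodule.finrank_mono ?_
    rintro _ ⟨t, rfl⟩
    rw [← filT_restrict]
    have : φ t = ∑ x : UF n (N + w), t x • (aeval v (monomial x.1.2 (1 : ℚ)) * u ^ x.1.1) := by
      simp only [φ, LinearMap.comp_apply, pol, Fintype.linearCombination_apply, map_sum, map_smul]
      refine Finset.sum_congr rfl fun x _ => ?_
      congr 1
      exact Polynomial.eval₂_monomial _ _
    rw [this]
    refine AddSubgroup.sum_mem _ fun x _ => ?_
    rw [filT_restrict]
    refine Submodule.smul_mem _ _ ?_
    rw [← filT_restrict]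
    have hx := mem_UF.1 x.2
    refine (Fil_T ℚ n D).mono hx ((Fil_T ℚ n D).mul ?_ ((Fil_T ℚ n D).pow hu _))
    refine (Fil_T ℚ n D).aeval (fun a => filT_C a 0) (fun _ => 1) v hv _ _ ?_
    intro s hs
    rw [coeff_monomial] at hs
    have : x.1.2 = s := by
      by_contra h
      exact hs (if_neg h)
    subst this
    simp
  have h2 : Module.finrank ℚ (LinearMap.ker φ) ≤ (UF n N).card := by
    rw [(Submodule.equivMapOfInjective _ (pol_inj n (N + w)) (LinearMap.ker φ)).finrank_eq]
    have h3 : (LinearMap.ker φ).map (pol n (N + w)) ≤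
        (LinearMap.range (pol n N)).map (LinearMap.mulLeft ℚ μ) := by
      rintro _ ⟨t, ht, rfl⟩
      obtain ⟨Q, hQ⟩ := hdvd _ ht
      refine ⟨Q, pol_range Q ?_, hQ.symm⟩
      by_cases h0 : Q = 0
      · simp [h0]
      · have h4 : (wE n (pol n (N + w) t)).totalDegree ≤ N + w := by
          rw [wE_le]
          intro b a h
          rw [pol_coeff] at h
          split_ifs at h with h'
          · exact mem_UF.1 h'
          · simp at h
        rw [hQ, map_mul, totalDegree_mul_of_isDomain
          (fun h => hμ.ne_zero (wE_inj n (by rw [h, map_zero])))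
          (fun h => h0 (wE_inj n (by rw [h, map_zero])))] at h4
        omega
    refine (Submodule.finrank_mono h3).trans ((Submodule.finrank_map_le _ _).trans
      ((LinearMap.finrank_range_le _).trans ?_))
    simp
  have h3 : Module.finrank ℚ (UF n (N + w) → ℚ) = (UF n (N + w)).card := by simp
  omega

theorem M_deg {n D : ℕ} (hD : 2 ≤ D) (F : Option (Fin n) → MvPolynomial (Fin n) ℤ)
    (hF : ∀ i, (F i).totalDegree ≤ D) (Y : RR n) (hY : Y ∈ filP n D (n + 1))
    (M : Polynomial (MvPolynomial (Pa n) (XQ n))) (hmon : M.Monic)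
    (hspec : ∀ q : MvPolynomial (Pa n) (XQ n), q ≠ 0 → ∃ p : Pa n → ℕ,
        eval (fun i => (p i : XQ n)) q ≠ 0 ∧
        ∀ W : Polynomial (XQ n), W.eval₂ (psi F) (eval (fun i => (p i : XQ n))
          (map (cq n) Y)) = 0 →
          M.map (eval fun i => (p i : XQ n)) ∣ W) :
    M.natDegree ≤ Nf D n ∧ ∀ c a, ((M.coeff 0).coeff c).coeff a ≠ 0 →
      ∑ i, a i < (n + 1) * (Nf D n + 1) := by
  have hv : ∀ i, Psi (FQ F) i ∈ filT ℚ n D 1 := fun i =>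
    Psi_fil (by omega) _ (fun i => (tdeg_map_le _ _).trans (hF i)) i
  have hu : ∀ p : Pa n → ℕ, eval (fun i => (p i : XQ n)) (map (cq n) Y) ∈ filT ℚ n D (n + 1) := by
    intro p
    rw [eval_map, eval₂_eq']
    refine AddSubgroup.sum_mem _ fun c hc => ?_
    have h1 := ((mem_sfil).1 hY c (mem_support_iff.1 hc)).2
    have h2 : cq n (Y.coeff c) ∈ filT ℚ n D (n + 1) := by
      rw [mem_filT] at h1 ⊢
      intro s hs
      rw [coeff_map] at hs
      exact h1 s fun h => hs (by rw [h, map_zero])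
    have h3 : ∏ i, (p i : XQ n) ^ c i = C (∏ i, (p i : ℚ) ^ c i) := by simp
    rw [h3]
    have := (Fil_T ℚ n D).mul h2 (filT_C (∏ i, (p i : ℚ) ^ c i) 0)
    rwa [add_zero] at this
  constructor
  · obtain ⟨p, -, hp⟩ := hspec 1 one_ne_zero
    have := deg_bound hD _ hv _ (hu p) _ (hmon.map _) hp M.natDegree 0 (by
      rw [Polynomial.coeff_map, hmon.coeff_natDegree]; simp)
    simp at this
    omega
  · intro c a hca
    let q : MvPolynomial (Pa n) (XQ n) :=
      ∑ s ∈ (M.coeff 0).support, monomial s (C (((M.coeff 0).coeff s).coeff a))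
    have hq : q ≠ 0 := by
      intro h
      have := congrArg (coeff c) h
      simp only [q, coeff_sum, coeff_monomial, Finset.sum_ite_eq', coeff_zero] at this
      rw [if_pos] at this
      · exact hca (C_eq_zero.1 this)
      · rw [mem_support_iff]
        intro h; rw [h] at hca; simp at hca
    obtain ⟨p, h1, hp⟩ := hspec q hq
    have h3 : ∀ s : Pa n →₀ ℕ, ∏ i, (p i : XQ n) ^ s i = C (∏ i, (p i : ℚ) ^ s i) := by simp
    have h2 : eval (fun i => (p i : XQ n)) q = C ((eval (fun i => (p i : XQ n)) (M.coeff 0)).coeff a) := by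
      rw [eval_eq' _ (M.coeff 0)]
      simp only [q, map_sum, eval_monomial, coeff_sum, h3]
      refine Finset.sum_congr rfl fun s _ => ?_
      rw [mul_comm (coeff s _), coeff_C_mul, C_mul, ← h3, mul_comm]
      congr 1
      rw [Finsupp.prod_fintype]
      simp
    have := deg_bound hD _ hv _ (hu p) _ (hmon.map _) hp 0 a (by
      rw [Polynomial.coeff_map]
      intro h
      exact h1 (by rw [h2, h, C_0]))
    simpa using this

end EN

namespace EN
open MvPolynomial

/-! ### Part 12: Siegel lemma -/

theorem siegel31 {α β : Type} [Fintype α] [Fintype β] (A : Matrix α β ℤ)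
    (h31 : 31 * Fintype.card α ≤ Fintype.card β) (hm : 0 < Fintype.card α) (B : ℝ) (hB : 1 ≤ B)
    (hA : ∀ i j, |((A i j : ℤ) : ℝ)| ≤ B) :
    ∃ t : β → ℤ, t ≠ 0 ∧ A.mulVec t = 0 ∧
      ∀ j, |((t j : ℤ) : ℝ)| ≤ ((Fintype.card β : ℝ) * B) ^ ((1 : ℝ) / 30) := by
  obtain ⟨t, h1, h2, h3⟩ := Int.Matrix.exists_ne_zero_int_vec_norm_le A (by omega) hm
  refine ⟨t, h1, h2, fun j => ?_⟩
  have h4 := (norm_le_pi_norm t j).trans h3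
  rw [Int.norm_eq_abs] at h4
  refine h4.trans ?_
  have h31' : (31 : ℝ) * Fintype.card α ≤ Fintype.card β := by exact_mod_cast h31
  have hm' : (1 : ℝ) ≤ Fintype.card α := by exact_mod_cast hm
  have h5 := (Matrix.norm_le_iff (A := A) (zero_le_one.trans hB)).2 (fun i j => by
    rw [Int.norm_eq_abs]; exact hA i j)
  refine (Real.rpow_le_rpow_of_exponent_le (y := (Fintype.card α : ℝ) / (Fintype.card β - Fintype.card α))
    (z := (1 : ℝ) / 30) ?_ ?_).trans (Real.rpow_le_rpow ?_ ?_ (by norm_num))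
  · have : (1 : ℝ) ≤ Fintype.card β := by linarith
    exact one_le_mul_of_one_le_of_one_le this (le_max_left _ _)
  · rw [div_le_div_iff₀ (by linarith) (by norm_num)]
    linarith
  · positivity
  · exact mul_le_mul_of_nonneg_left (max_le hB h5) (by positivity)

theorem bern (q G E : ℕ) (hG : 32 * (q * E) ≤ G) : 31 * (G + E) ^ q ≤ 32 * G ^ q := by
  rcases Nat.eq_zero_or_pos (G + E) with h0 | h0
  · have : G = 0 ∧ E = 0 := by omega
    rw [this.1, this.2]
    cases q <;> simp
  have hpos : (0 : ℝ) < G + E := by exact_mod_cast h0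
  have hx : (E : ℝ) / (G + E) ≤ 1 := by
    rw [div_le_one hpos]; have : (0 : ℝ) ≤ G := by positivity
    linarith
  have h1 := one_add_mul_le_pow (a := -((E : ℝ) / (G + E))) (by linarith) q
  have h2 : (1 : ℝ) + -((E : ℝ) / (G + E)) = G / (G + E) := by field_simp; ring
  rw [h2, div_pow] at h1
  have h3 : (q : ℝ) * (E / (G + E)) ≤ 1 / 32 := by
    rw [mul_div_assoc', div_le_iff₀ hpos]
    have : (32 : ℝ) * (q * E) ≤ G := by exact_mod_cast hG
    have : (0 : ℝ) ≤ E := by positivity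
    linarith
  have h4 : (31 / 32 : ℝ) ≤ G ^ q / (G + E) ^ q := by linarith
  rw [le_div_iff₀ (by positivity)] at h4
  have h5 : (31 : ℝ) * (G + E) ^ q ≤ 32 * G ^ q := by linarith
  exact_mod_cast h5

abbrev fs {n K : ℕ} (c : Pa n → Fin K) : Pa n →₀ ℕ :=
  Finsupp.equivFunOnFinite.symm fun i => (c i : ℕ)

abbrev psiZ {n : ℕ} (F : Option (Fin n) → MvPolynomial (Fin n) ℤ) : XZ n →+* XZ n :=
  (aeval (Psi F) : XZ n →ₐ[ℤ] XZ n).toRingHom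

theorem siegel_W {n D : ℕ} (hD : 2 ≤ D) (F : Option (Fin n) → MvPolynomial (Fin n) ℤ)
    (hF : ∀ i, (F i).totalDegree ≤ D) (Y : RR n) (hY : Y ∈ filP n D (n + 1)) (hY0 : Y ≠ 0) (Λ : ℝ)
    (hΛ : 1 ≤ Λ) (hF1 : ∀ i, n1 (Psi F i) ≤ Λ) (hY1 : nm n1 Y ≤ Λ ^ (n + 1)) (N K U : ℕ)
    (hN : N = 32 * ((n + 1) * (n + 2) * Nf D n)) (hK : K = 32 * ((2 * n + 1) * (D * N)))
    (hU : U = (UF n N).card * K ^ (2 * n + 1)) :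
    ∃ W : Polynomial (RR n), W.eval₂ (map (psiZ F)) Y = 0 ∧ W.coeff 0 ≠ 0 ∧
      nm n1 (W.coeff 0) ≤ U * ((U : ℝ) * Λ ^ N) ^ ((1 : ℝ) / 30) := by
  have hNpos : 0 < N := by
    have : 0 < Nf D n := by
      unfold Nf
      exact Finset.sum_pos (fun i _ => by positivity) (by simp)
    rw [hN]; positivity
  have hKpos : 0 < K := by
    rw [hK]
    have : 0 < D := by omega
    positivity
  let β := UF n N × (Pa n → Fin K)
  let α := TyF n D N × (Pa n → Fin (K + D * N))
  have hcPa : Fintype.card (Pa n) = 2 * n + 1 := by simp [Pa]; ring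
  have hβ : Fintype.card β = U := by
    rw [Fintype.card_prod, Fintype.card_fun, Fintype.card_fin, hcPa, Fintype.card_coe, hU]
  have hα : Fintype.card α = (TyF n D N).card * (K + D * N) ^ (2 * n + 1) := by
    rw [Fintype.card_prod, Fintype.card_fun, Fintype.card_fin, hcPa, Fintype.card_coe]
  let m : β → RR n := fun x => monomial (fs x.2) (monomial x.1.1.2 1)
  let v : β → RR n := fun x => map (psiZ F) (m x) * Y ^ x.1.1.1
  have hv0 : ∀ x, v x = monomial (fs x.2) 1 * (C (psiZ F (monomial x.1.1.2 1)) * Y ^ x.1.1.1) := by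
    intro x
    simp only [v, m, map_monomial]
    rw [← mul_assoc, mul_comm (monomial _ _) (C _), C_mul_monomial, mul_one]
  have hpsi : ∀ a : Option (Fin n) →₀ ℕ, psiZ F (monomial a 1) = ∏ i, Psi F i ^ a i := by
    intro a
    show aeval (Psi F) (monomial a (1 : ℤ)) = _
    rw [aeval_monomial, Finsupp.prod_fintype _ _ (fun _ => pow_zero _)]
    simp
  have hfil : ∀ x : β, C (psiZ F (monomial x.1.1.2 1)) * Y ^ x.1.1.1 ∈ filP n D N := by
    intro x
    have hx := mem_UF.1 x.1.2
    refine (Fil_P n D).mono hx ((Fil_P n D).mul ?_ ((Fil_P n D).pow hY _))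
    refine filP_C ?_
    rw [hpsi]
    refine (Fil_T ℤ n D).prod Finset.univ _ _ fun i _ => ?_
    have := (Fil_T ℤ n D).pow (Psi_fil (by omega) F hF i) (x.1.1.2 i)
    rwa [one_mul] at this
  have hnm : ∀ x, nm n1 (v x) ≤ Λ ^ N := by
    intro x
    have hx := mem_UF.1 x.1.2
    have h1 : nm n1 (C (psiZ F (monomial x.1.1.2 1)) : RR n) ≤ Λ ^ (∑ i, x.1.1.2 i) := by
      rw [nm_C SN_int.nm, hpsi]
      refine (SN_int.nm.prod _ _).trans ?_
      rw [← Finset.prod_pow_eq_pow_sum]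
      refine Finset.prod_le_prod (fun i _ => SN_int.nm.nonneg _) fun i _ => ?_
      exact (SN_int.nm.pow _ _).trans (pow_le_pow_left₀ (SN_int.nm.nonneg _) (hF1 i) _)
    have h2 : nm n1 (Y ^ x.1.1.1) ≤ Λ ^ ((n + 1) * x.1.1.1) := by
      rw [pow_mul]
      exact ((SN_RR n).pow _ _).trans (pow_le_pow_left₀ ((SN_RR n).nonneg _) hY1 _)
    have h3 : nm n1 (monomial (fs x.2) 1 : RR n) ≤ 1 := by
      rw [nm_monomial SN_int.nm]; exact SN_int.nm.one
    rw [hv0]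
    calc _ ≤ 1 * (Λ ^ (∑ i, x.1.1.2 i) * Λ ^ ((n + 1) * x.1.1.1)) := by
            refine ((SN_RR n).mul _ _).trans (mul_le_mul h3 ?_ ((SN_RR n).nonneg _) zero_le_one)
            exact ((SN_RR n).mul _ _).trans (mul_le_mul h1 h2 ((SN_RR n).nonneg _) (by positivity))
      _ ≤ Λ ^ N := by rw [one_mul, ← pow_add]; exact pow_le_pow_right₀ hΛ hx
  let A : Matrix α β ℤ := Matrix.of fun e x => ((v x).coeff (fs e.2)).coeff e.1.1
  obtain ⟨t, ht0, htA, htn⟩ := siegel31 A (by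
      rw [hα, hβ, hU]
      have h1 := count_Siegel n D 32 hD
      rw [← hN] at h1
      have h2 := bern (2 * n + 1) K (D * N) hK.ge
      have := Nat.mul_le_mul h1 h2
      nlinarith) (by
      rw [hα]
      have : 0 < (TyF n D N).card := Finset.card_pos.2 ⟨0, mem_TyF.2 (by simp [Ty])⟩
      have : 0 < K + D * N := by omega
      positivity) (Λ ^ N) (one_le_pow₀ hΛ) (by
      intro e x
      exact ((le_nm SN_int _ _).trans (le_nm SN_int.nm _ _)).trans (hnm x))
  rw [hβ] at htn
  let W : Polynomial (RR n) := ∑ x, t x • Polynomial.monomial x.1.1.1 (m x)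
  have hWc : ∀ b, W.coeff b = ∑ x, if x.1.1.1 = b then t x • m x else 0 := by
    intro b
    simp only [W, Polynomial.finset_sum_coeff, Polynomial.coeff_smul, Polynomial.coeff_monomial,
      smul_ite, smul_zero]
  have hWe : W.eval₂ (map (psiZ F)) Y = 0 := by
    have h1 : W.eval₂ (map (psiZ F)) Y = ∑ x, t x • v x := by
      simp only [W, Polynomial.eval₂_finset_sum]
      refine Finset.sum_congr rfl fun x _ => ?_
      have h2 : (t x • Polynomial.monomial x.1.1.1 (m x) : Polynomial (RR n))
          = Polynomial.monomial x.1.1.1 (t x • m x) := by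
        rw [Polynomial.smul_monomial]
      rw [h2, Polynomial.eval₂_monomial, map_zsmul, smul_mul_assoc]
    rw [h1]
    ext c s
    rw [coeff_sum, coeff_sum]
    simp only [coeff_smul, coeff_zero]
    have hsup : ∀ x, ((v x).coeff c).coeff s ≠ 0 → s ∈ TyF n D N ∧ ∀ i, c i < K + D * N := by
      intro x hx
      rw [hv0, coeff_monomial_mul'] at hx
      split_ifs at hx with hle
      · rw [one_mul] at hx
        have h2 := (mem_sfil).1 (hfil x) (c - fs x.2) (by
          intro h; rw [h] at hx; simp at hx)
        refine ⟨mem_TyF.2 ((mem_filT).1 h2.2 s hx), ?_⟩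
        obtain ⟨⟨h3, h4⟩, -⟩ := h2
        have hc : ∀ i, (c - fs x.2) i ≤ D * N := by
          rintro (i | j)
          · have := (Finset.single_le_sum (f := fun i => (c - fs x.2) (Sum.inl i))
              (fun i _ => Nat.zero_le _) (Finset.mem_univ i)).trans h3
            exact this.trans (Nat.le_mul_of_pos_left _ (by omega))
          · have := (Finset.single_le_sum (f := fun j => (c - fs x.2) (Sum.inr j))
              (fun i _ => Nat.zero_le _) (Finset.mem_univ j)).trans h4
            exact this.trans (Nat.mul_le_mul_right _ (by omega))
        intro i
        have h5 := hc i
        have h6 : fs x.2 i < K := (x.2 i).2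
        rw [Finsupp.tsub_apply] at h5
        omega
      · simp at hx
    by_cases hcs : s ∈ TyF n D N ∧ ∀ i, c i < K + D * N
    · have h2 := congrFun htA (⟨s, hcs.1⟩, fun i => ⟨c i, hcs.2 i⟩)
      rw [Matrix.mulVec, dotProduct] at h2
      have hfs : fs (fun i => (⟨c i, hcs.2 i⟩ : Fin (K + D * N))) = c := by
        ext i; simp [fs]
      simp only [A, Matrix.of_apply, hfs, Pi.zero_apply] at h2
      rw [← h2]
      exact Finset.sum_congr rfl fun x _ => by rw [smul_eq_mul, mul_comm]
    · refine Finset.sum_eq_zero fun x _ => ?_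
      by_contra h
      exact hcs (hsup x fun h' => h (by rw [h', smul_zero]))
  have hW0 : W ≠ 0 := by
    obtain ⟨x0, hx0⟩ := Function.ne_iff.1 ht0
    intro h
    apply hx0
    have h1 := congrArg (fun P => ((Polynomial.coeff P x0.1.1.1).coeff (fs x0.2)).coeff x0.1.1.2) h
    simp only [hWc, coeff_sum, Polynomial.coeff_zero, coeff_zero] at h1
    rw [Finset.sum_eq_single x0] at h1
    · simp only [m, if_true, coeff_smul, coeff_monomial, smul_eq_mul, mul_one] at h1
      exact h1
    · rintro ⟨⟨⟨b, a⟩, hx⟩, c⟩ _ hne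
      by_cases hb : b = x0.1.1.1
      · rw [if_pos hb]
        simp only [m, coeff_smul, coeff_monomial]
        by_cases hc : fs c = fs x0.2
        · rw [if_pos hc, coeff_monomial, if_neg, smul_zero]
          rintro rfl
          apply hne
          subst hb
          have : c = x0.2 := by
            funext i
            have := DFunLike.congr_fun hc i
            exact Fin.ext (by simpa [fs] using this)
          subst this
          rfl
        · rw [if_neg hc]; simp
      · rw [if_neg hb]; simp
    · simp
  have hWn : ∀ b, nm n1 (W.coeff b) ≤ U * ((U : ℝ) * Λ ^ N) ^ ((1 : ℝ) / 30) := by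
    intro b
    rw [hWc]
    refine ((SN_RR n).sum _ _).trans ?_
    rw [← hβ, ← nsmul_eq_mul]
    refine Finset.sum_le_card_nsmul _ _ _ fun x _ => ?_
    rw [hβ]
    split_ifs
    · refine le_trans ?_ (htn x)
      have : t x • m x = monomial (fs x.2) (monomial x.1.1.2 (t x)) := by
        simp only [m, smul_monomial, smul_eq_mul, mul_one]
      rw [this, nm_monomial SN_int.nm, nm_monomial SN_int]
    · rw [(SN_RR n).zero]; positivity
  obtain ⟨W', hW'⟩ := Polynomial.X_pow_dvd_iff.2
    (fun d (hd : d < W.natTrailingDegree) => Polynomial.coeff_eq_zero_of_lt_natTrailingDegree hd)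
  have hc0 : W'.coeff 0 = W.coeff W.natTrailingDegree := by
    have := congrArg (fun P => Polynomial.coeff P W.natTrailingDegree) hW'
    simp only [Polynomial.coeff_X_pow_mul', le_refl, if_true, Nat.sub_self] at this
    exact this.symm
  refine ⟨W', ?_, ?_, ?_⟩
  · have h1 := congrArg (Polynomial.eval₂ (map (psiZ F)) Y) hW'
    rw [hWe, Polynomial.eval₂_mul, Polynomial.eval₂_X_pow] at h1
    have hWe := h1.symm
    exact (mul_eq_zero.1 hWe).resolve_left (pow_ne_zero _ hY0)
  · rw [hc0]
    exact Polynomial.trailingCoeff_nonzero_iff_nonzero.2 hW0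
  · rw [hc0]; exact hWn _

end EN

namespace EN
open MvPolynomial

structure GS {A B : Type*} [CommRing A] [CommRing B] (ι : A →+* B) : Prop where
  inj : Function.Injective ι
  den : ∀ b, ∃ N : ℕ, N ≠ 0 ∧ ∃ a, ι a = N * b
  prime : ∀ p : ℕ, p.Prime → Prime (p : A)
  fin : ∀ a : A, a ≠ 0 → ∃ b : ℕ, ∀ N : ℕ, (N : A) ∣ a → N ≤ b

theorem GS_int : GS (Int.castRingHom ℚ) where
  inj := Int.cast_injective
  den b := ⟨b.den, b.den_nz, b.num, by
    rw [mul_comm]; exact (Rat.mul_den_eq_num b).symm⟩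
  prime p hp := Nat.prime_iff_prime_int.1 hp
  fin a ha := ⟨a.natAbs, fun N h => Nat.le_of_dvd (Int.natAbs_pos.2 ha)
    (Int.natCast_dvd.1 (by simpa using h))⟩

theorem GS.mv {A B : Type*} [CommRing A] [CommRing B] {ι : A →+* B} (h : GS ι) (τ : Type*) :
    GS (map ι : MvPolynomial τ A →+* MvPolynomial τ B) where
  inj := map_injective _ h.inj
  den b := by
    induction b using MvPolynomial.induction_on' with
    | monomial u a =>
      obtain ⟨N, hN, c, hc⟩ := h.den a
      refine ⟨N, hN, monomial u c, ?_⟩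
      rw [map_monomial, hc, ← nsmul_eq_mul, ← nsmul_eq_mul, map_nsmul]
    | add p q hp hq =>
      obtain ⟨N, hN, c, hc⟩ := hp
      obtain ⟨N', hN', c', hc'⟩ := hq
      refine ⟨N * N', mul_ne_zero hN hN', N' * c + N * c', ?_⟩
      rw [map_add, map_mul, map_mul, hc, hc', map_natCast, map_natCast]
      push_cast; ring
  prime p hp := by
    rw [← C_eq_coe_nat]
    exact (prime_C_iff _).2 (h.prime p hp)
  fin a ha := by
    obtain ⟨s, hs⟩ := ne_zero_iff.1 ha
    obtain ⟨b, hb⟩ := h.fin _ hs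
    refine ⟨b, fun N hN => hb N ?_⟩
    rw [← C_eq_coe_nat] at hN
    exact (C_dvd_iff_dvd_coeff _ _).1 hN s

theorem coeff_nat_mul {A τ : Type*} [CommRing A] (N : ℕ) (P : MvPolynomial τ A) (c : τ →₀ ℕ) :
    coeff c ((N : MvPolynomial τ A) * P) = N * coeff c P := by
  rw [← C_eq_coe_nat, coeff_C_mul]

def Prm {A : Type*} [CommRing A] (m : A) : Prop := ∀ p : ℕ, p.Prime → ¬ (p : A) ∣ m

theorem gauss {A : Type*} [CommRing A] [IsDomain A] (hp : ∀ p : ℕ, p.Prime → Prime (p : A))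
    {m : A} (hm : Prm m) (K : ℕ) (hK : K ≠ 0) (w u : A) (h : (K : A) * w = m * u) : m ∣ w := by
  induction K using Nat.recOnMul generalizing w u with
  | zero => exact absurd rfl hK
  | one => exact ⟨u, by simpa using h⟩
  | prime p hpp =>
    have h1 : (p : A) ∣ m * u := ⟨w, h.symm⟩
    obtain ⟨v, rfl⟩ := ((hp p hpp).dvd_or_dvd h1).resolve_left (hm p hpp)
    refine ⟨v, mul_left_cancel₀ (hp p hpp).ne_zero ?_⟩
    rw [h]; ring
  | mul a b iha ihb =>
    push_cast at h
    have ha : a ≠ 0 := fun h => hK (by simp [h])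
    have hb : b ≠ 0 := fun h => hK (by simp [h])
    obtain ⟨v, hv⟩ := iha ha ((b : A) * w) u (by rw [← h]; ring)
    exact ihb hb w v hv

theorem GS.prim {A B : Type*} [CommRing A] [CommRing B] {ι : A →+* B} (h : GS ι) (a : A)
    (ha : a ≠ 0) : ∃ (N : ℕ) (m : A), N ≠ 0 ∧ a = N * m ∧ Prm m := by
  obtain ⟨b, hb⟩ := h.fin a ha
  have hex : ∃ N, N ≤ b ∧ (N : A) ∣ a := ⟨1, hb 1 (by simp), by simp⟩
  have hP := Nat.findGreatest_spec (P := fun N : ℕ => (N : A) ∣ a) (hb 1 (by simp)) (by simp)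
  set N := Nat.findGreatest (fun N : ℕ => (N : A) ∣ a) b with hN
  obtain ⟨m, hm⟩ := hP
  have hN0 : N ≠ 0 := by
    intro h0
    rw [h0] at hm
    exact ha (by simpa using hm)
  refine ⟨N, m, hN0, hm, fun p hp ⟨v, hv⟩ => ?_⟩
  have h1 : ((N * p : ℕ) : A) ∣ a := ⟨v, by rw [hm, hv]; push_cast; ring⟩
  have h2 := Nat.le_findGreatest (P := fun N : ℕ => (N : A) ∣ a) (hb _ h1) h1
  rw [← hN] at h2
  have := hp.two_le
  have : 0 < N := Nat.pos_of_ne_zero hN0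
  nlinarith

theorem n1_le_of_LMS {τ : Type*} [Fintype τ] (L : MvPolynomial τ ℤ → ℝ)
    (hL : ∀ (P : MvPolynomial τ ℤ) (c : τ →₀ ℕ) (d : τ → ℕ), (∀ i, P.degreeOf i ≤ d i) →
      P.coeff c ≠ 0 → Real.log |((P.coeff c : ℤ) : ℝ)| ≤ L P + ∑ i, Real.log ((d i).choose (c i)))
    (P : MvPolynomial τ ℤ) (δ : ℕ) (hd : P.totalDegree ≤ δ) :
    n1 P ≤ Real.exp (L P) * 2 ^ (Fintype.card τ * δ) := by
  have hdeg : ∀ i, P.degreeOf i ≤ δ := fun i => (degreeOf_le_totalDegree P i).trans hd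
  have h1 : ∀ s ∈ P.support, |((P.coeff s : ℤ) : ℝ)| ≤
      Real.exp (L P) * ∏ i, (δ.choose (s i) : ℝ) := by
    intro s hs
    have hs0 := mem_support_iff.1 hs
    have hle : ∀ i, s i ≤ δ := fun i => (monomial_le_degreeOf i hs).trans (hdeg i)
    have h2 := hL P s (fun _ => δ) hdeg hs0
    have hpos : ∀ i, (0 : ℝ) < (δ.choose (s i) : ℝ) := fun i => by
      exact_mod_cast Nat.choose_pos (hle i)
    rw [← Real.log_prod (fun i _ => (hpos i).ne')] at h2
    have h3 : (0 : ℝ) < |((P.coeff s : ℤ) : ℝ)| := abs_pos.2 (by exact_mod_cast hs0)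
    have h4 := Real.exp_le_exp.2 h2
    rwa [Real.exp_log h3, Real.exp_add, Real.exp_log (Finset.prod_pos fun i _ => hpos i)] at h4
  have h5 : n1 P ≤ ∑ s ∈ P.support, Real.exp (L P) * ∏ i, (δ.choose (s i) : ℝ) :=
    Finset.sum_le_sum h1
  refine h5.trans ?_
  rw [← Finset.mul_sum]
  refine mul_le_mul_of_nonneg_left ?_ (Real.exp_pos _).le
  have h6 : (2 : ℝ) ^ (Fintype.card τ * δ) =
      ∑ x ∈ Fintype.piFinset (fun _ : τ => Finset.range (δ + 1)), ∏ i, (δ.choose (x i) : ℝ) := by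
    rw [← Finset.prod_univ_sum (fun _ : τ => Finset.range (δ + 1))
      (fun _ j => (δ.choose j : ℝ))]
    have : ∑ j ∈ Finset.range (δ + 1), (δ.choose j : ℝ) = 2 ^ δ := by
      exact_mod_cast Nat.sum_range_choose δ
    rw [this, Finset.prod_const, Finset.card_univ, ← pow_mul, mul_comm]
  rw [h6]
  have h7 : ∑ s ∈ P.support, ∏ i, (δ.choose (s i) : ℝ) =
      ∑ x ∈ P.support.map ⟨(fun s i => s i : (τ →₀ ℕ) → τ → ℕ), DFunLike.coe_injective⟩,
        ∏ i, (δ.choose (x i) : ℝ) := by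
    rw [Finset.sum_map]; rfl
  rw [h7]
  refine Finset.sum_le_sum_of_subset_of_nonneg ?_ (fun x _ _ => Finset.prod_nonneg fun i _ => by positivity)
  intro x hx
  obtain ⟨s, hs, rfl⟩ := Finset.mem_map.1 hx
  refine Fintype.mem_piFinset.2 fun i => Finset.mem_range.2 ?_
  have := (monomial_le_degreeOf i hs).trans (hdeg i)
  exact Nat.lt_succ_of_le this

theorem gauss_heights {n D d δ : ℕ} (hD : 2 ≤ D) (hd : 1 ≤ d) (Q : MvPolynomial (Pa n) (XQ n)) (a1 : MvPolynomial (Pa n) (XQ n))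
    (hQ0 : Q.coeff 0 ≠ 0)
    (hQ1 : ∀ c : Pa n →₀ ℕ, ∑ i, c (Sum.inl i) = 1 → Q.coeff c = Q.coeff 0 * a1.coeff c)
    (ha1 : ∀ c, a1.coeff c ≠ 0 → ∑ i, c (Sum.inl i) = 1 ∧ ∑ j, c (Sum.inr j) ≤ (D - 1) * (n + 1))
    (hQV : ∀ c, Q.coeff c ≠ 0 → c ∈ Vp n D ((n + 1) * d))
    (hQd : ∀ c a, (Q.coeff c).coeff a ≠ 0 → ∑ i, a i ≤ δ)
    (W : RR n) (hW : W ≠ 0) (hQW : Q ∣ map (cq n) W) :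
    ∃ (α : ℕ) (P : (Pa n →₀ ℕ) → XZ n), α ≠ 0 ∧ (α : ℝ) ≤ nm n1 W ∧
      ∀ c, a1.coeff c ≠ 0 → cq n (P c) = α * a1.coeff c ∧ (P c).totalDegree ≤ δ ∧
        n1 (P c) ≤ nm n1 W * (((n + 1) * d : ℕ) * (((D - 1) * ((n + 1) * d) : ℕ) : ℝ) ^ ((D - 1) * (n + 1)))
          * 2 ^ ((n + 1) * δ) := by
  have g1 : GS (cq n) := GS_int.mv _
  have g2 : GS (map (cq n) : RR n →+* _) := g1.mv _
  obtain ⟨L1, hL1, hL1c⟩ := LMS_int.mv (Option (Fin n))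
  obtain ⟨L2, hL2, hL2c⟩ := hL1.mv (Pa n)
  obtain ⟨N, hN, a, ha⟩ := g2.den Q
  have hNQ : ((N : ℕ) : MvPolynomial (Pa n) (XQ n)) ≠ 0 := by exact_mod_cast hN
  have hQ : Q ≠ 0 := fun h => hQ0 (by rw [h, coeff_zero])
  have ha0 : a ≠ 0 := by
    rintro rfl
    rw [map_zero] at ha
    exact mul_ne_zero hNQ hQ ha.symm
  obtain ⟨N', m, hN', rfl, hm⟩ := g2.prim a ha0
  rw [map_mul, map_natCast] at ha
  have hmW : m ∣ W := by
    obtain ⟨v, hv⟩ := hQW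
    obtain ⟨K, hK, u, hu⟩ := g2.den v
    refine gauss g2.prime hm (K * N) (mul_ne_zero hK hN) W (N' * u) (g2.inj ?_)
    rw [map_mul, map_mul, map_mul, map_natCast, map_natCast, hu, hv]
    push_cast
    linear_combination (-(K : MvPolynomial (Pa n) (XQ n)) * v) * ha
  have hc : ∀ c, (N' : XQ n) * cq n (m.coeff c) = N * Q.coeff c := by
    intro c
    have := congrArg (coeff c) ha
    rwa [coeff_nat_mul, coeff_nat_mul, coeff_map] at this
  have hNx : ((N : ℕ) : XQ n) ≠ 0 := by exact_mod_cast hN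
  have hNx' : ((N' : ℕ) : XQ n) ≠ 0 := by exact_mod_cast hN'
  have hmQ : ∀ c, m.coeff c ≠ 0 → Q.coeff c ≠ 0 := by
    intro c h1 h2
    have := hc c
    rw [h2, mul_zero] at this
    have := (mul_eq_zero.1 this).resolve_left hNx'
    exact h1 (g1.inj (by rw [this, map_zero]))
  have hm0 : m.coeff 0 ≠ 0 := by
    intro h
    have := hc 0
    rw [h, map_zero, mul_zero] at this
    exact mul_ne_zero hNx hQ0 this.symm
  obtain ⟨α, a0, hα, hα0, hpa⟩ := g1.prim _ hm0
  have ha00 : a0 ≠ 0 := by rintro rfl; exact hm0 (by rw [hα0, mul_zero])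
  have hαx : ((α : ℕ) : XZ n) ≠ 0 := by exact_mod_cast hα
  have hcc : ∀ c, a1.coeff c ≠ 0 → cq n (m.coeff c) = α * cq n a0 * a1.coeff c := by
    intro c h1
    have h2 := hc c
    have h3 := hc 0
    rw [hQ1 c (ha1 c h1).1] at h2
    rw [hα0, map_mul, map_natCast] at h3
    refine mul_left_cancel₀ hNx' ?_
    rw [h2]
    linear_combination (-(a1.coeff c)) * h3
  have hex : ∀ c, ∃ P, a1.coeff c ≠ 0 → m.coeff c = a0 * P := by
    intro c
    by_cases h1 : a1.coeff c = 0
    · exact ⟨0, fun h => absurd h1 h⟩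
    · obtain ⟨K, hK, u, hu⟩ := g1.den (a1.coeff c)
      obtain ⟨P, hP⟩ := gauss g1.prime hpa K hK (m.coeff c) (α * u) (g1.inj (by
        rw [map_mul, map_mul, map_mul, map_natCast, map_natCast, hcc c h1, hu]; ring))
      exact ⟨P, fun _ => hP⟩
  choose P hP using hex
  have hm00 : m ≠ 0 := fun h => hm0 (by rw [h, coeff_zero])
  have hL2m : L2 m ≤ Real.log (nm n1 W) := by
    obtain ⟨v, rfl⟩ := hmW
    have hv : v ≠ 0 := right_ne_zero_of_mul hW
    have h1 := hL2.mul _ _ hm00 hv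
    have h2 := hL2.nonneg _ hv
    have h3 := hL2.le _ hW
    linarith
  have hnmW : 0 < nm n1 W := by
    obtain ⟨c, hc⟩ := ne_zero_iff.1 hW
    obtain ⟨s, hs⟩ := ne_zero_iff.1 hc
    have h1 := (le_nm SN_int (W.coeff c) s).trans (le_nm SN_int.nm W c)
    exact lt_of_lt_of_le (abs_pos.2 (by exact_mod_cast hs)) h1
  let e : Pa n → ℕ := Sum.elim (fun _ => (n + 1) * d) (fun _ => (D - 1) * ((n + 1) * d))
  have hme : ∀ i, m.degreeOf i ≤ e i := by
    intro i
    rw [degreeOf_le_iff]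
    intro c hcs
    obtain ⟨h1, h2⟩ := hQV c (hmQ c (mem_support_iff.1 hcs))
    rcases i with i | j
    · exact (Finset.single_le_sum (f := fun i => c (Sum.inl i))
        (fun i _ => Nat.zero_le _) (Finset.mem_univ i)).trans h1
    · exact (Finset.single_le_sum (f := fun j => c (Sum.inr j))
        (fun i _ => Nat.zero_le _) (Finset.mem_univ j)).trans h2
  have hdegP : ∀ c, a1.coeff c ≠ 0 → (P c).totalDegree ≤ δ := by
    intro c h1
    by_cases h0 : P c = 0
    · simp [h0]
    have h2 : (m.coeff c).totalDegree ≤ δ := by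
      rw [tdeg_le_iff]
      intro s hs
      refine hQd c s fun h => hs ?_
      have h3 := congrArg (coeff s) (hc c)
      rw [coeff_nat_mul, coeff_nat_mul, h, mul_zero, cq, coeff_map] at h3
      have h4 := (mul_eq_zero.1 h3).resolve_left (by exact_mod_cast hN')
      simpa using h4
    rw [hP c h1, totalDegree_mul_of_isDomain ha00 h0] at h2
    omega
  refine ⟨α, P, hα, ?_, fun c h1 => ⟨?_, ?_, ?_⟩⟩
  · have h1 := hL2c m 0 e hme hm0
    have h2 := hL1c (α : XZ n) 0 (fun _ => 0) (fun i => by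
      rw [← C_eq_coe_nat, degreeOf_C]) (by
      rw [← C_eq_coe_nat, coeff_zero_C]; exact_mod_cast hα)
    rw [← C_eq_coe_nat, coeff_zero_C, C_eq_coe_nat] at h2
    have h3 := hL1.mul _ _ hαx ha00
    have h4 := hL1.nonneg _ ha00
    rw [hα0] at h1
    simp at h1 h2
    have h5 : Real.log α ≤ Real.log (nm n1 W) := by linarith
    exact (Real.log_le_log_iff (by positivity) hnmW).1 h5
  · refine mul_left_cancel₀ (a := cq n a0) (fun h => ha00 (g1.inj (by rw [h, map_zero]))) ?_
    rw [← map_mul, ← hP c h1, hcc c h1]; ring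
  · exact hdegP c h1
  · by_cases h0 : P c = 0
    · have h2 : n1 (0 : XZ n) = 0 := SN_int.nm.zero
      rw [h0, h2]; positivity
    have hmc : m.coeff c ≠ 0 := by rw [hP c h1]; exact mul_ne_zero ha00 h0
    have hle : ∀ i, c i ≤ e i := fun i =>
      (monomial_le_degreeOf i (mem_support_iff.2 hmc)).trans (hme i)
    have hpos : ∀ i, (0 : ℝ) < ((e i).choose (c i) : ℝ) := fun i => by
      exact_mod_cast Nat.choose_pos (hle i)
    have h2 := hL2c m c e hme hmc
    have h3 := hL1.mul _ _ ha00 h0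
    have h4 := hL1.nonneg _ ha00
    rw [← hP c h1] at h3
    rw [← Real.log_prod (fun i _ => (hpos i).ne')] at h2
    have h5 : Real.exp (L1 (P c)) ≤ nm n1 W * ∏ i, ((e i).choose (c i) : ℝ) := by
      have h6 : L1 (P c) ≤ Real.log (nm n1 W) + Real.log (∏ i, ((e i).choose (c i) : ℝ)) := by
        linarith
      have h7 := Real.exp_le_exp.2 h6
      rwa [Real.exp_add, Real.exp_log hnmW, Real.exp_log (Finset.prod_pos fun i _ => hpos i)] at h7
    have h8 : ∏ i, ((e i).choose (c i) : ℝ) ≤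
        (((n + 1) * d : ℕ) * (((D - 1) * ((n + 1) * d) : ℕ) : ℝ) ^ ((D - 1) * (n + 1))) := by
      rw [Fintype.prod_sum_type]
      have hch : ∀ i, ((e i).choose (c i) : ℝ) ≤ (e i : ℝ) ^ c i := fun i => by
        exact_mod_cast Nat.choose_le_pow _ _
      refine mul_le_mul ?_ ?_ (Finset.prod_nonneg fun i _ => by positivity) (by positivity)
      · refine (Finset.prod_le_prod (fun i _ => (hpos _).le) fun i _ => hch (Sum.inl i)).trans ?_
        simp only [e, Sum.elim_inl]
        rw [Finset.prod_pow_eq_pow_sum, (ha1 c h1).1, pow_one]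
      · refine (Finset.prod_le_prod (fun i _ => (hpos _).le) fun i _ => hch (Sum.inr i)).trans ?_
        simp only [e, Sum.elim_inr]
        rw [Finset.prod_pow_eq_pow_sum]
        refine pow_le_pow_right₀ ?_ (ha1 c h1).2
        have : 1 ≤ (D - 1) * ((n + 1) * d) := Nat.mul_pos (by omega) (Nat.mul_pos (by omega) hd)
        exact_mod_cast this
    have h9 := n1_le_of_LMS L1 hL1c (P c) δ (hdegP c h1)
    rw [Fintype.card_option, Fintype.card_fin] at h9
    refine h9.trans (mul_le_mul_of_nonneg_right ?_ (by positivity))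
    exact h5.trans (mul_le_mul_of_nonneg_left h8 hnmW.le)

end EN

namespace EN
open MvPolynomial

/-! ### Part 14: assembling the Bezout identity -/

theorem prod_pow_one {ι R : Type*} [Fintype ι] [CommRing R] (v : ι → ℕ) (hv : ∑ i, v i = 1)
    (x : ι → R) : ∏ i, x i ^ v i = ∑ i, if v i = 1 then x i else 0 := by
  obtain ⟨i0, h0, h1⟩ : ∃ i0, v i0 = 1 ∧ ∀ i, i ≠ i0 → v i = 0 := by
    obtain ⟨i0, -, hi0⟩ := Finset.exists_ne_zero_of_sum_ne_zero (by rw [hv]; exact one_ne_zero)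
    rw [← Finset.add_sum_erase _ _ (Finset.mem_univ i0)] at hv
    refine ⟨i0, by omega, fun i hi => ?_⟩
    have h2 : ∑ x ∈ Finset.univ.erase i0, v x = 0 := by omega
    exact Finset.sum_eq_zero_iff.1 h2 i (Finset.mem_erase.2 ⟨hi, Finset.mem_univ _⟩)
  rw [Finset.prod_eq_single i0 (fun i _ hi => by rw [h1 i hi, pow_zero]) (by simp),
    Finset.sum_eq_single i0 (fun i _ hi => by rw [h1 i hi]; simp) (by simp), h0]
  simp

theorem n1_aeval {τ τ' : Type*} [Fintype τ] (x : τ → MvPolynomial τ' ℤ) (hx : ∀ i, n1 (x i) ≤ 1)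
    (P : MvPolynomial τ ℤ) : n1 (aeval x P) ≤ n1 P := by
  rw [aeval_def, eval₂_eq']
  refine (nm_sum SN_int _ _).trans (Finset.sum_le_sum fun s _ => ?_)
  have h1 : n1 (∏ i, x i ^ s i) ≤ 1 := by
    refine (SN_int.nm.prod _ _).trans (Finset.prod_le_one (fun i _ => SN_int.nm.nonneg _) fun i _ => ?_)
    exact (SN_int.nm.pow _ _).trans (pow_le_one₀ (SN_int.nm.nonneg _) (hx i))
  have h2 := SN_int.nm.mul (C (P.coeff s)) (∏ i, x i ^ s i)
  rw [nm_C SN_int] at h2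
  exact h2.trans (mul_le_of_le_one_right (abs_nonneg _) h1)

theorem tdeg_aeval {τ τ' : Type*} [Fintype τ] (x : τ → MvPolynomial τ' ℤ)
    (hx : ∀ i, (x i).totalDegree ≤ 1) (P : MvPolynomial τ ℤ) :
    (aeval x P).totalDegree ≤ P.totalDegree := by
  rw [aeval_def, eval₂_eq']
  refine totalDegree_finsetSum_le fun s hs => ?_
  refine (totalDegree_mul _ _).trans ?_
  have h0 : (algebraMap ℤ (MvPolynomial τ' ℤ) (P.coeff s)).totalDegree = 0 := totalDegree_C _
  rw [h0, zero_add]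
  refine (totalDegree_finset_prod _ _).trans ?_
  have h1 := (tdeg_le_iff P P.totalDegree).1 le_rfl s (mem_support_iff.1 hs)
  refine le_trans (Finset.sum_le_sum fun i _ => ?_) h1
  refine (totalDegree_pow _ _).trans ?_
  have := Nat.mul_le_mul_left (s i) (hx i)
  simpa using this

theorem assemble {n E δ : ℕ} (F : Option (Fin n) → MvPolynomial (Fin n) ℤ)
    (a1 : MvPolynomial (Pa n) (XQ n))
    (ha1 : ∀ c, a1.coeff c ≠ 0 → ∑ i, c (Sum.inl i) = 1 ∧ ∑ j, c (Sum.inr j) ≤ E)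
    (hev : eval₂ (aeval (fun i : Option (Fin n) => i.elim 0 X) :
        XQ n →ₐ[ℚ] MvPolynomial (Fin n) ℚ).toRingHom (Sum.elim (FQ F) X) a1 = 1)
    (α : ℕ) (P : (Pa n →₀ ℕ) → XZ n) (B : ℝ)
    (hP : ∀ c, a1.coeff c ≠ 0 → cq n (P c) = α * a1.coeff c ∧ (P c).totalDegree ≤ δ ∧ n1 (P c) ≤ B) :
    ∃ G : Option (Fin n) → MvPolynomial (Fin n) ℤ, ∑ i, F i * G i = C (α : ℤ) ∧
      (∀ i, (G i).totalDegree ≤ δ + E) ∧ ∀ i, n1 (G i) ≤ (E + n).choose n * B := by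
  let e0 : XZ n →ₐ[ℤ] MvPolynomial (Fin n) ℤ := aeval (fun i : Option (Fin n) => i.elim 0 X)
  let eQ : XQ n →ₐ[ℚ] MvPolynomial (Fin n) ℚ := aeval (fun i : Option (Fin n) => i.elim 0 X)
  let ι : MvPolynomial (Fin n) ℤ →+* MvPolynomial (Fin n) ℚ := map (Int.castRingHom ℚ)
  have hcomm : ∀ p, ι (e0 p) = eQ (cq n p) := by
    intro p
    have : ι.comp e0.toRingHom = eQ.toRingHom.comp (cq n) := by
      refine ringHom_ext (fun a => ?_) (fun i => ?_)
      · simp [ι, e0, eQ, cq]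
      · rcases i with _ | i <;> simp [ι, e0, eQ, cq]
    exact RingHom.congr_fun this p
  let S : Option (Fin n) → Finset (Pa n →₀ ℕ) := fun i => a1.support.filter fun c => c (Sum.inl i) = 1
  let mo : (Pa n →₀ ℕ) → MvPolynomial (Fin n) ℤ := fun c => ∏ j, X j ^ c (Sum.inr j)
  have hS : ∀ i c, c ∈ S i → a1.coeff c ≠ 0 := fun i c hc =>
    mem_support_iff.1 (Finset.mem_filter.1 hc).1
  have hx0 : ∀ i : Option (Fin n), n1 (i.elim 0 X : MvPolynomial (Fin n) ℤ) ≤ 1 := by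
    rintro (_ | i)
    · have : n1 (0 : MvPolynomial (Fin n) ℤ) = 0 := SN_int.nm.zero
      simp only [Option.elim]
      rw [this]; exact zero_le_one
    · exact nm_X SN_int i
  have hx1 : ∀ i : Option (Fin n), (i.elim 0 X : MvPolynomial (Fin n) ℤ).totalDegree ≤ 1 := by
    rintro (_ | i)
    · simp
    · simp [totalDegree_X]
  refine ⟨fun i => ∑ c ∈ S i, mo c * e0 (P c), ?_, fun i => ?_, fun i => ?_⟩
  · apply map_injective (Int.castRingHom ℚ) Int.cast_injective
    show ι _ = ι _
    have hC : ι (C (α : ℤ)) = α * 1 := by simp [ι]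
    rw [hC, ← hev, eval₂_eq', Finset.mul_sum, map_sum]
    have h1 : ∀ i, ι (F i * ∑ c ∈ S i, mo c * e0 (P c)) = ∑ c ∈ a1.support,
        if c (Sum.inl i) = 1 then FQ F i * (ι (mo c) * (α * eQ (a1.coeff c))) else 0 := by
      intro i
      rw [map_mul, map_sum, Finset.mul_sum, ← Finset.sum_filter]
      refine Finset.sum_congr rfl fun c hc => ?_
      rw [map_mul, hcomm, (hP c (hS i c hc)).1, map_mul, map_natCast]
    rw [Finset.sum_congr rfl fun i _ => h1 i, Finset.sum_comm]
    refine Finset.sum_congr rfl fun c hc => ?_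
    rw [Fintype.prod_sum_type]
    simp only [Sum.elim_inl, Sum.elim_inr]
    rw [prod_pow_one (fun i => c (Sum.inl i)) (ha1 c (mem_support_iff.1 hc)).1, Finset.sum_mul,
      Finset.mul_sum, Finset.mul_sum]
    refine Finset.sum_congr rfl fun i _ => ?_
    have hmo : ι (mo c) = ∏ j, X j ^ c (Sum.inr j) := by simp [ι, mo]
    rw [hmo]
    show _ = (α : MvPolynomial (Fin n) ℚ) * (eQ (a1.coeff c) * _)
    split_ifs <;> ring
  · refine totalDegree_finsetSum_le fun c hc => ?_
    have h1 := hP c (hS i c hc)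
    refine (totalDegree_mul _ _).trans ?_
    have h2 : (mo c).totalDegree ≤ E := by
      refine (totalDegree_finset_prod _ _).trans (le_trans (Finset.sum_le_sum fun j _ => ?_)
        (ha1 c (hS i c hc)).2)
      rw [totalDegree_X_pow]
    have h3 := (tdeg_aeval _ hx1 (P c)).trans h1.2.1
    have h4 : (e0 (P c)).totalDegree ≤ δ := h3
    omega
  · refine (nm_sum SN_int _ _).trans ?_
    have h1 : ∀ c ∈ S i, n1 (mo c * e0 (P c)) ≤ B := by
      intro c hc
      have h2 : n1 (mo c) ≤ 1 := by
        refine (SN_int.nm.prod _ _).trans (Finset.prod_le_one (fun i _ => SN_int.nm.nonneg _) fun i _ => ?_)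
        exact (SN_int.nm.pow _ _).trans (pow_le_one₀ (SN_int.nm.nonneg _) (nm_X SN_int i))
      have h3 := (n1_aeval _ hx0 (P c)).trans (hP c (hS i c hc)).2.2
      refine (SN_int.nm.mul _ _).trans ((mul_le_of_le_one_left (SN_int.nm.nonneg _) h2).trans h3)
    refine (Finset.sum_le_card_nsmul _ _ _ h1).trans ?_
    rw [nsmul_eq_mul]
    by_cases hne : (S i).Nonempty
    · obtain ⟨c0, hc0⟩ := hne
      have hB : 0 ≤ B := (SN_int.nm.nonneg _).trans (h1 c0 hc0)
      refine mul_le_mul_of_nonneg_right ?_ hB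
      have h2 : (S i).card ≤ (Sx (Fin n) E).card := by
        refine Finset.card_le_card_of_injOn
          (fun c => c.comapDomain Sum.inr Sum.inr_injective.injOn) ?_ ?_
        · intro c hc
          rw [Finset.mem_coe, mem_Sx]
          exact (ha1 c (hS i c hc)).2
        · intro c hc c' hc' heq
          have key : ∀ c ∈ S i, ∀ i', c (Sum.inl i') = if i' = i then 1 else 0 := by
            intro c hc i'
            have h3 := (ha1 c (hS i c hc)).1
            have h4 := (Finset.mem_filter.1 hc).2
            rw [← Finset.add_sum_erase _ _ (Finset.mem_univ i), h4] at h3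
            split_ifs with h
            · rw [h, h4]
            · have h5 : ∑ x ∈ Finset.univ.erase i, c (Sum.inl x) = 0 := by omega
              exact Finset.sum_eq_zero_iff.1 h5 i' (Finset.mem_erase.2 ⟨h, Finset.mem_univ _⟩)
          ext i'
          rcases i' with i' | j
          · rw [key c hc, key c' hc']
          · exact DFunLike.congr_fun heq j
      rw [card_Sx, Fintype.card_fin] at h2
      exact_mod_cast h2
    · rw [Finset.not_nonempty_iff_eq_empty.1 hne]
      simp only [Finset.card_empty, Nat.cast_zero, zero_mul]
      by_cases hB : 0 ≤ B
      · positivity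
      · exfalso
        have hne : a1 ≠ 0 := by
          rintro rfl
          rw [eval₂_zero] at hev
          exact zero_ne_one hev
        obtain ⟨c, hc⟩ := ne_zero_iff.1 hne
        exact hB ((SN_int.nm.nonneg _).trans (hP c hc).2.2)

end EN

namespace EN
open MvPolynomial

theorem main_case {n D k : ℕ} (hD : 2 ≤ D) (f : Fin k → MvPolynomial (Fin n) ℤ)
    (hf : ∀ l, (f l).totalDegree ≤ D) (h : ∀ x : Fin n → ℂ, ∃ i, aeval x (f i) ≠ 0)
    (Φ Λ V : ℝ) (hΦ0 : 0 ≤ Φ)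
    (hΦ : ∀ γ : Fin k → ℕ, (∀ l, γ l ≤ (n + 2) * Nf D n) →
      n1 (∑ l, (γ l : MvPolynomial (Fin n) ℤ) * f l) ≤ Φ)
    (hΛ : Λ = (n + 1) * (D * (Φ + 1)))
    (N K U δ : ℕ) (hN : N = 32 * ((n + 1) * (n + 2) * Nf D n))
    (hK : K = 32 * ((2 * n + 1) * (D * N))) (hU : U = (UF n N).card * K ^ (2 * n + 1))
    (hδ : δ = (n + 1) * (Nf D n + 1) - 1)
    (hV : V = U * ((U : ℝ) * Λ ^ N) ^ ((1 : ℝ) / 30)) :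
    ∃ (g : Fin k → MvPolynomial (Fin n) ℤ) (α : ℕ), α ≠ 0 ∧ ∑ l, f l * g l = C (α : ℤ) ∧
      (∀ l, (g l).totalDegree ≤ δ + (D - 1) * (n + 1)) ∧ (α : ℝ) ≤ V ∧
      ∀ l, n1 (g l) ≤ (n + 1) * (((n + 2) * Nf D n : ℕ) *
        (((D - 1) * (n + 1) + n).choose n * (V * (((n + 1) * Nf D n : ℕ) *
        (((D - 1) * ((n + 1) * Nf D n) : ℕ) : ℝ) ^ ((D - 1) * (n + 1))) * 2 ^ ((n + 1) * δ)))) := by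
  obtain ⟨γ, hγ, hint⟩ := exists_gamma hD f hf h
  let F : Option (Fin n) → MvPolynomial (Fin n) ℤ := fun i => ∑ l, (γ i l : MvPolynomial _ ℤ) * f l
  have hF : ∀ i, (F i).totalDegree ≤ D := fun i => by
    refine totalDegree_finsetSum_le fun l _ => (totalDegree_mul _ _).trans ?_
    rw [← C_eq_coe_nat, totalDegree_C, zero_add]; exact hf l
  have hFΦ : ∀ i, n1 (F i) ≤ Φ := fun i => hΦ (γ i) (hγ i)
  obtain ⟨Y1, hY1, hfil, hfil0, hnm, hev⟩ := exists_Y1 (by omega) F hF Φ hFΦ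
  obtain ⟨M, a1, hmon, hdiv, hspec, hQ0, hQ1, ha1, hQV, hev1⟩ := exists_M F hint Y1 hY1 hfil hev
  set Y : RR n := C (X none * Jac (Psi F)) + C (X none) * Y1 with hYdef
  have hY : Y ∈ filP n D (n + 1) := AddSubgroup.add_mem _ hfil0 hfil
  have hY0 : Y ≠ 0 := by
    intro hY0
    obtain ⟨v, hv⟩ := hdiv Polynomial.X (by rw [Polynomial.eval₂_X, hY0, map_zero])
    have h1 := congrArg (fun P => Polynomial.coeff P 0) hv
    simp only [Polynomial.coeff_X_zero, Polynomial.mul_coeff_zero] at h1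
    have h2 := (mul_eq_zero.1 h1.symm).resolve_left (fun h => hQ0 (by rw [h, coeff_zero]))
    obtain ⟨v', rfl⟩ := Polynomial.X_dvd_iff.2 h2
    have h3 : M * v' = 1 := by
      refine mul_left_cancel₀ Polynomial.X_ne_zero ?_
      rw [mul_one]
      conv_rhs => rw [hv]
      ring
    have h4 : M = 1 := hmon.eq_one_of_isUnit (IsUnit.of_mul_eq_one _ h3)
    have h5 : a1 = 0 := by
      ext1 c
      by_contra hc
      have h6 := (ha1 c hc).1
      have h7 := hQ1 c h6
      have hc0 : (0 : Pa n →₀ ℕ) ≠ c := by rintro rfl; simp at h6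
      rw [h4, Polynomial.coeff_one_zero, coeff_one, if_neg hc0, coeff_one, if_pos rfl, one_mul] at h7
      exact hc h7.symm
    rw [h5, eval₂_zero] at hev1
    exact zero_ne_one hev1
  obtain ⟨hMd, hMδ⟩ := M_deg hD F hF Y hY M hmon hspec
  have hn1 : (1 : ℝ) ≤ (n + 1) * D := by
    have : 1 ≤ (n + 1) * D := Nat.mul_pos (by omega) (by omega)
    exact_mod_cast this
  have hΛΦ : Φ + 1 ≤ Λ := by rw [hΛ]; nlinarith
  obtain ⟨W, hWe, hW0, hWn⟩ := siegel_W hD F hF Y hY hY0 Λ (by linarith) (fun i => by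
      refine le_trans ?_ hΛΦ
      refine (SN_int.nm.add _ _).trans (add_le_add ?_ ?_)
      · refine (SN_int.nm.mul _ _).trans ?_
        have h1 := (n1_rename (F i)).trans (hFΦ i)
        exact (mul_le_of_le_one_right (SN_int.nm.nonneg _) (nm_X SN_int _)).trans h1
      · rcases i with _ | j
        · have : n1 (0 : XZ n) = 0 := SN_int.nm.zero
          simp only [Option.elim]
          exact this.le.trans zero_le_one
        · exact nm_X SN_int _) (by rw [hΛ]; exact hnm) N K U hN hK hU
  have hMW : M ∣ W.map (map (cq n)) := by
    apply hdiv
    rw [Polynomial.eval₂_map]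
    have h1 : (map (psi F) : MvPolynomial (Pa n) (XQ n) →+* _).comp (map (cq n)) =
        (map (cq n)).comp (map (psiZ F)) := by
      refine ringHom_ext (fun a => ?_) (fun i => ?_)
      · simp only [RingHom.comp_apply, map_C]
        congr 1
        have h2 : (psi F).comp (cq n) = (cq n).comp (psiZ F) := by
          refine ringHom_ext (fun a => ?_) (fun i => ?_)
          · simp [psi, cq, psiZ]
          · simp only [RingHom.comp_apply, cq, map_X, psi, psiZ]
            simp only [AlgHom.toRingHom_eq_coe, RingHom.coe_coe, aeval_X]
            exact (Psi_map _ F i).symm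
        exact RingHom.congr_fun h2 a
      · simp
    rw [h1, ← Polynomial.hom_eval₂, hWe, map_zero]
  have hQW : M.coeff 0 ∣ map (cq n) (W.coeff 0) := by
    obtain ⟨v, hv⟩ := hMW
    refine ⟨v.coeff 0, ?_⟩
    rw [← Polynomial.coeff_map, hv, Polynomial.mul_coeff_zero]
  have hNf : 1 ≤ Nf D n := by
    rw [Nf, Finset.sum_range_succ']; simp
  have hVp : ∀ c, (M.coeff 0).coeff c ≠ 0 → c ∈ Vp n D ((n + 1) * Nf D n) := by
    intro c hc
    obtain ⟨h1, h2⟩ := hQV c hc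
    have h3 := Nat.mul_le_mul_left (n + 1) hMd
    exact ⟨h1.trans h3, h2.trans (Nat.mul_le_mul_left _ h3)⟩
  obtain ⟨α, P, hα, hαW, hP⟩ := gauss_heights (d := Nf D n) (δ := δ) hD hNf (M.coeff 0) a1 hQ0 hQ1 ha1
    hVp (fun c a hca => by have := hMδ c a hca; omega) (W.coeff 0) hW0 hQW
  rw [← hV] at hWn
  obtain ⟨G, hG, hGd, hGn⟩ := assemble F a1 ha1 hev1 α P _ hP
  refine ⟨fun l => ∑ i, (γ i l : MvPolynomial _ ℤ) * G i, α, hα, ?_, fun l => ?_, hαW.trans hWn, fun l => ?_⟩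
  · rw [← hG]
    simp only [F, Finset.sum_mul, Finset.mul_sum]
    rw [Finset.sum_comm]
    exact Finset.sum_congr rfl fun i _ => Finset.sum_congr rfl fun l _ => by ring
  · refine totalDegree_finsetSum_le fun i _ => (totalDegree_mul _ _).trans ?_
    rw [← C_eq_coe_nat, totalDegree_C, zero_add]; exact hGd i
  · refine (nm_sum SN_int _ _).trans ?_
    have h1 : ∀ i ∈ (Finset.univ : Finset (Option (Fin n))), n1 ((γ i l : MvPolynomial _ ℤ) * G i) ≤
        ((n + 2) * Nf D n : ℕ) *
        (((D - 1) * (n + 1) + n).choose n * (V * (((n + 1) * Nf D n : ℕ) *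
        (((D - 1) * ((n + 1) * Nf D n) : ℕ) : ℝ) ^ ((D - 1) * (n + 1))) * 2 ^ ((n + 1) * δ))) := by
      intro i _
      refine (SN_int.nm.mul _ _).trans (mul_le_mul ?_ ((hGn i).trans ?_) (SN_int.nm.nonneg _) (by positivity))
      · rw [← C_eq_coe_nat, nm_C SN_int]
        have := hγ i l
        push_cast
        rw [abs_of_nonneg (by positivity)]
        exact_mod_cast this
      · gcongr
    have h2 := Finset.sum_le_card_nsmul _ _ _ h1
    rw [nsmul_eq_mul, Finset.card_univ, Fintype.card_option, Fintype.card_fin] at h2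
    push_cast at h2 ⊢
    exact h2

end EN

namespace EN

/-! ### Part 16: numerical estimates -/

theorem choose_le_pow_succ (m q : ℕ) : (m + q).choose q ≤ (m + 1) ^ q := by
  induction q with
  | zero => simp
  | succ q ih =>
    have h1 := Nat.add_one_mul_choose_eq (m + q) q
    have h2 : (m + q + 1).choose (q + 1) * (q + 1) ≤ (m + 1) ^ (q + 1) * (q + 1) := by
      rw [← h1, pow_succ]
      have h3 : m + q + 1 ≤ (m + 1) * (q + 1) := by nlinarith
      calc (m + q + 1) * (m + q).choose q ≤ ((m + 1) * (q + 1)) * (m + 1) ^ q := Nat.mul_le_mul h3 ih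
        _ = _ := by ring
    exact Nat.le_of_mul_le_mul_right h2 (by omega)

theorem card_UF_le (n N : ℕ) : (UF n N).card ≤ (N + 1) ^ (n + 2) := by
  rw [UF, Finset.card_sigma]
  have h1 : ∀ b ∈ Finset.range (N / (n + 1) + 1), (Sx (Option (Fin n)) (N - (n + 1) * b)).card ≤
      (N + 1) ^ (n + 1) := by
    intro b _
    rw [card_Sx, Fintype.card_option, Fintype.card_fin]
    exact (choose_le_pow_succ _ _).trans (Nat.pow_le_pow_left (by omega) _)
  refine (Finset.sum_le_card_nsmul _ _ _ h1).trans ?_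
  rw [Finset.card_range, smul_eq_mul, pow_succ' _ (n + 1)]
  exact Nat.mul_le_mul_right _ (Nat.succ_le_succ (Nat.div_le_self _ _))

theorem Nf_le_two {n D : ℕ} (hD : 2 ≤ D) : Nf D n ≤ 2 * D ^ n := by
  have h1 := Nf_mul D n (by omega)
  obtain ⟨d, rfl⟩ := Nat.exists_eq_add_of_le hD
  have h2 : (d + 1) * Nf (2 + d) n + 1 = (2 + d) ^ n * (2 + d) := by
    rw [← pow_succ, ← h1]; congr 2; omega
  have h3 : (d + 1) * Nf (2 + d) n ≤ (d + 1) * (2 * (2 + d) ^ n) := by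
    have : 0 ≤ (2 + d) ^ n * d := Nat.zero_le _
    nlinarith
  exact Nat.le_of_mul_le_mul_left h3 (by omega)

theorem Nf_le_three {n D : ℕ} (hD : 3 ≤ D) : 2 * Nf D n ≤ 3 * D ^ n := by
  have h1 := Nf_mul D n (by omega)
  obtain ⟨d, rfl⟩ := Nat.exists_eq_add_of_le hD
  have h2 : (d + 2) * Nf (3 + d) n + 1 = (3 + d) ^ n * (3 + d) := by
    rw [← pow_succ, ← h1]; congr 2; omega
  have h3 : (d + 2) * (2 * Nf (3 + d) n) ≤ (d + 2) * (3 * (3 + d) ^ n) := by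
    have : 0 ≤ (3 + d) ^ n * d := Nat.zero_le _
    nlinarith
  exact Nat.le_of_mul_le_mul_left h3 (by omega)

/-- coefficient of the height -/
theorem coef_H {n D : ℕ} (hn : 2 ≤ n) (hD : 2 ≤ D) : 16 * ((n + 2) * Nf D n) ≤ 15 * (4 * n * D ^ n) := by
  rcases Nat.lt_or_ge n 3 with h | h
  · have : n = 2 := by omega
    subst this
    simp only [Nf, Finset.sum_range_succ, Finset.sum_range_zero]
    nlinarith
  · have := Nf_le_two (n := n) hD
    calc 16 * ((n + 2) * Nf D n) ≤ 16 * ((n + 2) * (2 * D ^ n)) := by gcongr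
      _ = (32 * n + 64) * D ^ n := by ring
      _ ≤ (60 * n) * D ^ n := Nat.mul_le_mul_right _ (by omega)
      _ = _ := by ring

theorem d0_le {n D : ℕ} (hn : 2 ≤ n) (hD : 2 ≤ D) : (n + 2) * Nf D n ≤ ((n + 1) * D) ^ n := by
  have h1 := Nf_le_two (n := n) hD
  rw [mul_pow]
  have h2 : (n + 1) ^ 2 ≤ (n + 1) ^ n := Nat.pow_le_pow_right (by omega) hn
  calc (n + 2) * Nf D n ≤ (n + 2) * (2 * D ^ n) := by gcongr
    _ = (2 * n + 4) * D ^ n := by ring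
    _ ≤ (n + 1) ^ n * D ^ n := Nat.mul_le_mul_right _ (by nlinarith)

theorem log_le_mul {X : ℝ} (hX : 1 ≤ X) {a : ℝ} (ha : 0 ≤ a) (m : ℕ) (h : a ≤ X ^ m) :
    Real.log a ≤ m * Real.log X := by
  rcases ha.eq_or_lt with h0 | h0
  · rw [← h0, Real.log_zero]
    have := Real.log_nonneg hX
    positivity
  · rw [← Real.log_pow]; exact Real.log_le_log h0 h

/-- the product `Nf * log Lambda` -/
theorem log_Lam {n D : ℕ} (hn : 2 ≤ n) (hD : 2 ≤ D) :
    Nf D n * Real.log (2 * ((n + 1) * D) * (((n + 2) * Nf D n : ℕ) * ((n + D).choose n : ℝ))) ≤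
      (3 * n + 6) * (D : ℝ) ^ n * Real.log ((n + 1) * D) := by
  have hX1 : (1 : ℝ) ≤ (n + 1) * D := by
    have : 1 ≤ (n + 1) * D := Nat.mul_pos (by omega) (by omega)
    exact_mod_cast this
  have hl := Real.log_nonneg hX1
  have hch : (n + D).choose n ≤ (D + 1) ^ n := by
    rw [add_comm]; exact choose_le_pow_succ D n
  have h2 := Nf_le_two (n := n) hD
  have hc2 : (n + 1) ^ 2 ≤ (n + 1) ^ n := Nat.pow_le_pow_right (by omega) hn
  rcases Nat.lt_or_ge D 3 with h | h
  · have : D = 2 := by omega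
    subst this
    have h3 : 2 * ((n + 1) * 2) * (((n + 2) * Nf 2 n) * (n + 2).choose n) ≤ ((n + 1) * 2) ^ (n + 3) := by
      calc 2 * ((n + 1) * 2) * (((n + 2) * Nf 2 n) * (n + 2).choose n)
          ≤ 2 * ((n + 1) * 2) * (((n + 2) * (2 * 2 ^ n)) * 3 ^ n) := by gcongr
        _ = (n + 1) * 2 * (4 * (n + 2)) * 6 ^ n := by
            rw [show 6 = 2 * 3 by norm_num, mul_pow]; ring
        _ ≤ (n + 1) * 2 * (((n + 1) * 2) ^ 2) * ((n + 1) * 2) ^ n := by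
            gcongr
            · nlinarith
            · omega
        _ = _ := by ring
    have h4 := log_le_mul hX1 (a := 2 * ((n + 1) * (2 : ℕ)) * (((n + 2) * Nf 2 n : ℕ) * ((n + 2).choose n : ℝ)))
      (by positivity) (n + 3) (by exact_mod_cast h3)
    have h5 : (Nf 2 n : ℝ) ≤ 2 * ((2 : ℕ) : ℝ) ^ n := by exact_mod_cast h2
    calc _ ≤ (Nf 2 n : ℝ) * ((n + 3 : ℕ) * Real.log ((n + 1) * (2 : ℕ))) := by gcongr
      _ ≤ (2 * ((2 : ℕ) : ℝ) ^ n) * ((n + 3 : ℕ) * Real.log ((n + 1) * (2 : ℕ))) := by gcongr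
      _ ≤ _ := by
        push_cast at hl ⊢
        have hn' : (2 : ℝ) ≤ n := by exact_mod_cast hn
        have : 0 ≤ (2 : ℝ) ^ n * Real.log ((n + 1) * 2) := by positivity
        nlinarith
  · have h3 := Nf_le_three (n := n) h
    have h3' : 2 * ((n + 1) * D) * (((n + 2) * Nf D n) * (n + D).choose n) ≤ ((n + 1) * D) ^ (2 * n + 1) := by
      have h6 : 3 * (D + 1) ≤ 4 * D := by omega
      have h7 : 3 * (n + 2) * (4 * D) ^ n ≤ (n + 1) ^ n * ((n + 1) * (3 * D)) ^ n := by
        calc 3 * (n + 2) * (4 * D) ^ n ≤ ((n + 1) ^ n * 2 ^ n) * (4 * D) ^ n := by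
              refine Nat.mul_le_mul_right _ ?_
              have h8 : 2 ^ 2 ≤ 2 ^ n := Nat.pow_le_pow_right (by omega) hn
              calc 3 * (n + 2) ≤ (n + 1) ^ 2 * 2 ^ 2 := by nlinarith
                _ ≤ _ := Nat.mul_le_mul hc2 h8
          _ = (n + 1) ^ n * (2 * (4 * D)) ^ n := by rw [mul_pow 2]; ring
          _ ≤ _ := by
              refine Nat.mul_le_mul_left _ (Nat.pow_le_pow_left ?_ _)
              nlinarith
      have h8 : 3 ^ n * (2 * (((n + 2) * Nf D n) * (n + D).choose n)) ≤ 3 ^ n * ((n + 1) * D) ^ (2 * n) := by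
        calc 3 ^ n * (2 * (((n + 2) * Nf D n) * (n + D).choose n))
            = (n + 2) * (2 * Nf D n) * (3 ^ n * (n + D).choose n) := by ring
          _ ≤ (n + 2) * (3 * D ^ n) * (3 ^ n * (D + 1) ^ n) := by gcongr
          _ = D ^ n * (3 * (n + 2) * (3 * (D + 1)) ^ n) := by rw [mul_pow 3]; ring
          _ ≤ D ^ n * (3 * (n + 2) * (4 * D) ^ n) := by gcongr
          _ ≤ D ^ n * ((n + 1) ^ n * ((n + 1) * (3 * D)) ^ n) := by gcongr
          _ = _ := by rw [two_mul, pow_add, mul_pow, mul_pow, mul_pow]; ring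
      have h9 := Nat.le_of_mul_le_mul_left h8 (by positivity)
      calc _ = ((n + 1) * D) * (2 * (((n + 2) * Nf D n) * (n + D).choose n)) := by ring
        _ ≤ ((n + 1) * D) * ((n + 1) * D) ^ (2 * n) := by gcongr
        _ = _ := by ring
    have h4 := log_le_mul hX1 (a := 2 * ((n + 1) * D) * (((n + 2) * Nf D n : ℕ) * ((n + D).choose n : ℝ)))
      (by positivity) (2 * n + 1) (by exact_mod_cast h3')
    have h5 : 2 * (Nf D n : ℝ) ≤ 3 * (D : ℝ) ^ n := by exact_mod_cast h3
    calc _ ≤ (Nf D n : ℝ) * ((2 * n + 1 : ℕ) * Real.log ((n + 1) * D)) := by gcongr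
      _ ≤ (3 / 2 * (D : ℝ) ^ n) * ((2 * n + 1 : ℕ) * Real.log ((n + 1) * D)) := by
        gcongr; linarith
      _ ≤ _ := by
        push_cast
        have : 0 ≤ (D : ℝ) ^ n * Real.log ((n + 1) * D) := by positivity
        nlinarith

theorem log_U {n D : ℕ} (hn : 2 ≤ n) (hD : 2 ≤ D) (N K U : ℕ) (hN : N = 32 * ((n + 1) * (n + 2) * Nf D n))
    (hK : K = 32 * ((2 * n + 1) * (D * N))) (hU : U = (UF n N).card * K ^ (2 * n + 1)) :
    Real.log U ≤ (3 * n ^ 2 + 20 * n + 13) * Real.log ((n + 1) * D) := by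
  have hX6 : 6 ≤ (n + 1) * D := by nlinarith
  have hX1 : (1 : ℝ) ≤ (n + 1) * D := by
    have : 1 ≤ (n + 1) * D := by omega
    exact_mod_cast this
  have h0 := d0_le hn hD
  set X := (n + 1) * D with hX
  have hN1 : N + 1 ≤ 33 * X ^ (n + 1) := by
    have h1 : (n + 1) * ((n + 2) * Nf D n) ≤ X * X ^ n := Nat.mul_le_mul (by rw [hX]; nlinarith) h0
    have h2 : 1 ≤ X ^ (n + 1) := Nat.one_le_pow _ _ (by omega)
    have h3 : X * X ^ n = X ^ (n + 1) := by ring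
    rw [hN]
    nlinarith
  have h36 : 6 ^ 2 ≤ X ^ 2 := Nat.pow_le_pow_left hX6 2
  have hN2 : N + 1 ≤ X ^ (n + 3) := by
    calc N + 1 ≤ 33 * X ^ (n + 1) := hN1
      _ ≤ X ^ 2 * X ^ (n + 1) := by gcongr; omega
      _ = _ := by ring
  have hK2 : K ≤ X ^ (n + 7) := by
    have h5 : 6 ^ 5 ≤ X ^ 5 := Nat.pow_le_pow_left hX6 5
    calc K = 32 * ((2 * n + 1) * D * N) := by rw [hK]; ring
      _ ≤ 32 * ((2 * X) * (33 * X ^ (n + 1))) := by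
        refine Nat.mul_le_mul_left _ (Nat.mul_le_mul ?_ ?_)
        · rw [hX]; nlinarith
        · omega
      _ = 2112 * X ^ (n + 2) := by ring
      _ ≤ X ^ 5 * X ^ (n + 2) := by gcongr; omega
      _ = _ := by ring
  have hU2 : U ≤ X ^ (3 * n ^ 2 + 20 * n + 13) := by
    calc U ≤ (X ^ (n + 3)) ^ (n + 2) * (X ^ (n + 7)) ^ (2 * n + 1) := by
          rw [hU]
          refine Nat.mul_le_mul ((card_UF_le n N).trans (Nat.pow_le_pow_left hN2 _)) (Nat.pow_le_pow_left hK2 _)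
      _ = _ := by rw [← pow_mul, ← pow_mul, ← pow_add]; congr 1; ring
  have := log_le_mul hX1 (a := (U : ℝ)) (by positivity) (3 * n ^ 2 + 20 * n + 13) (by
    have h1 : ((X : ℕ) : ℝ) = (n + 1) * D := by rw [hX]; push_cast; ring
    rw [← h1]
    exact_mod_cast hU2)
  push_cast at this
  exact this

end EN

namespace EN

theorem Nf_pos (D n : ℕ) : 1 ≤ Nf D n := by
  rw [Nf, Finset.sum_range_succ']; simp

theorem log_V {n D k : ℕ} (hn : 2 ≤ n) (hD : 2 ≤ D) (hk : 1 ≤ k) (h : ℝ) (hh : 0 ≤ h) (Φ Λ V : ℝ)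
    (hΦ : Φ = k * (((n + 2) * Nf D n : ℕ) * ((n + D).choose n * Real.exp h)))
    (hΛ : Λ = (n + 1) * (D * (Φ + 1)))
    (N K U : ℕ) (hN : N = 32 * ((n + 1) * (n + 2) * Nf D n))
    (hK : K = 32 * ((2 * n + 1) * (D * N))) (hU : U = (UF n N).card * K ^ (2 * n + 1)) (hU0 : U ≠ 0)
    (hV : V = U * ((U : ℝ) * Λ ^ N) ^ ((1 : ℝ) / 30)) : 0 < V ∧ 
    Real.log V ≤ 4 * n * (n + 1) * (D : ℝ) ^ n * (h + Real.log k) +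
      (31 / 30 * (3 * n ^ 2 + 20 * n + 13) + 16 / 15 * (n + 1) * (n + 2) * ((3 * n + 6) * (D : ℝ) ^ n)) *
        Real.log ((n + 1) * D) := by
  have hU1 : (0 : ℝ) < U := by positivity
  have hn0 : (2 : ℝ) ≤ n := by exact_mod_cast hn
  have hD0 : (2 : ℝ) ≤ D := by exact_mod_cast hD
  have hk1 : (1 : ℝ) ≤ k := by exact_mod_cast hk
  have hNf : (1 : ℝ) ≤ Nf D n := by exact_mod_cast Nf_pos D n
  have hch : (1 : ℝ) ≤ (n + D).choose n := by
    exact_mod_cast Nat.choose_pos (Nat.le_add_right _ _)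
  have hd0 : (1 : ℝ) ≤ ((n + 2) * Nf D n : ℕ) := by
    exact_mod_cast Nat.mul_pos (by omega) (Nf_pos D n)
  have hΦ1 : 1 ≤ Φ := by
    rw [hΦ]
    have he := Real.one_le_exp hh
    have h1 := one_le_mul_of_one_le_of_one_le hch he
    exact one_le_mul_of_one_le_of_one_le hk1 (one_le_mul_of_one_le_of_one_le hd0 h1)
  have hΛ0 : 0 < Λ := by rw [hΛ]; positivity
  have hΛ1 : Real.log Λ ≤ (h + Real.log k) +
      Real.log (2 * ((n + 1) * D) * (((n + 2) * Nf D n : ℕ) * ((n + D).choose n : ℝ))) := by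
    have h1 : Λ ≤ (k * Real.exp h) *
        (2 * ((n + 1) * D) * (((n + 2) * Nf D n : ℕ) * ((n + D).choose n : ℝ))) := by
      calc Λ ≤ (n + 1) * (D * (Φ + Φ)) := by rw [hΛ]; gcongr
        _ = _ := by rw [hΦ]; ring
    have h2 := Real.log_le_log hΛ0 h1
    have hk0 : (k : ℝ) ≠ 0 := by positivity
    rw [Real.log_mul (by positivity) (by positivity), Real.log_mul hk0 (Real.exp_pos _).ne',
      Real.log_exp] at h2
    linarith
  have hV0 : 0 < V := by rw [hV]; positivity
  refine ⟨hV0, ?_⟩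
  have h1 : Real.log V = 31 / 30 * Real.log U + 16 / 15 * (n + 1) * (n + 2) * (Nf D n * Real.log Λ) := by
    rw [hV, Real.log_mul hU1.ne' (by positivity), Real.log_rpow (by positivity),
      Real.log_mul hU1.ne' (by positivity), Real.log_pow, hN]
    push_cast; ring
  have h2 := log_U hn hD N K U hN hK hU
  have h3 := log_Lam hn hD
  have h4 : (16 * ((n + 2) * Nf D n) : ℝ) ≤ 15 * (4 * n * D ^ n) := by exact_mod_cast coef_H hn hD
  have hH : 0 ≤ h + Real.log k := add_nonneg hh (Real.log_nonneg hk1)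
  set l := Real.log (((n : ℝ) + 1) * D)
  set lL := Real.log (2 * ((n + 1) * D) * (((n + 2) * Nf D n : ℕ) * ((n + D).choose n : ℝ)))
  have h5 : (Nf D n : ℝ) * Real.log Λ ≤ Nf D n * (h + Real.log k) + (3 * n + 6) * (D : ℝ) ^ n * l := by
    have := mul_le_mul_of_nonneg_left hΛ1 (by positivity : (0 : ℝ) ≤ Nf D n)
    linarith
  have h6 : (16 / 15 * (n + 1) * (n + 2) : ℝ) * (Nf D n * Real.log Λ) ≤ (16 / 15 * (n + 1) * (n + 2) : ℝ) *
      (Nf D n * (h + Real.log k) + (3 * n + 6) * (D : ℝ) ^ n * l) :=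
    mul_le_mul_of_nonneg_left h5 (by positivity)
  have h7 : (n + 1) * (h + Real.log k) * (16 * ((n + 2) * Nf D n) : ℝ) ≤
      (n + 1) * (h + Real.log k) * (15 * (4 * n * D ^ n)) :=
    mul_le_mul_of_nonneg_left h4 (by positivity)
  rw [h1]
  linarith

theorem log_final {n D : ℕ} (hn : 2 ≤ n) (hD : 2 ≤ D) (V : ℝ) (hV : 0 < V) (δ : ℕ)
    (hδ : δ = (n + 1) * (Nf D n + 1) - 1) :
    Real.log ((n + 1) * (((n + 2) * Nf D n : ℕ) *
        (((D - 1) * (n + 1) + n).choose n * (V * (((n + 1) * Nf D n : ℕ) *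
        (((D - 1) * ((n + 1) * Nf D n) : ℕ) : ℝ) ^ ((D - 1) * (n + 1))) * 2 ^ ((n + 1) * δ))))) ≤
    Real.log V + ((3 * n + 1) + (D - 1) * (n + 1) ^ 2 +
      2 / 5 * (n + 1) * (2 * n + 3) * (D : ℝ) ^ n) * Real.log ((n + 1) * D) := by
  have hX6 : 6 ≤ (n + 1) * D := by nlinarith
  have hX1 : (1 : ℝ) ≤ (n + 1) * D := by
    have : 1 ≤ (n + 1) * D := by omega
    exact_mod_cast this
  have h0 := d0_le hn hD
  have hXr : (((n + 1) * D : ℕ) : ℝ) = (n + 1) * D := by push_cast; ring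
  have hl := Real.log_nonneg hX1
  have hNf := Nf_pos D n
  obtain ⟨d, rfl⟩ := Nat.exists_eq_add_of_le hD
  set l := Real.log (((n : ℝ) + 1) * (2 + d : ℕ)) with hldef
  set X := (n + 1) * (2 + d) with hX
  have e1 : Real.log (n + 1 : ℝ) ≤ l := by
    have := log_le_mul hX1 (a := (n + 1 : ℝ)) (by positivity) 1 (by
      rw [← hXr, pow_one]
      have : n + 1 ≤ X := by rw [hX]; nlinarith
      exact_mod_cast this)
    rw [Nat.cast_one, one_mul] at this
    exact this
  have e2 : Real.log ((n + 2) * Nf (2 + d) n : ℕ) ≤ n * l :=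
    log_le_mul hX1 (by positivity) n (by rw [← hXr]; exact_mod_cast h0)
  have e3 : Real.log (((2 + d - 1) * (n + 1) + n).choose n : ℕ) ≤ n * l :=
    log_le_mul hX1 (by positivity) n (by
      rw [← hXr]
      have h1 := choose_le_pow_succ ((2 + d - 1) * (n + 1)) n
      have h2 : (2 + d - 1) * (n + 1) + 1 ≤ X := by
        rw [show 2 + d - 1 = d + 1 by omega, hX]; nlinarith
      exact_mod_cast h1.trans (Nat.pow_le_pow_left h2 n))
  have h1 : (n + 1) * Nf (2 + d) n ≤ X ^ n := le_trans (Nat.mul_le_mul_right _ (by omega)) h0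
  have e4 : Real.log ((n + 1) * Nf (2 + d) n : ℕ) ≤ n * l :=
    log_le_mul hX1 (by positivity) n (by rw [← hXr]; exact_mod_cast h1)
  have e5 : Real.log ((2 + d - 1) * ((n + 1) * Nf (2 + d) n) : ℕ) ≤ (n + 1 : ℕ) * l :=
    log_le_mul hX1 (by positivity) (n + 1) (by
      rw [← hXr]
      have h2 : (2 + d - 1) * ((n + 1) * Nf (2 + d) n) ≤ X * X ^ n := by
        refine Nat.mul_le_mul ?_ h1
        rw [show 2 + d - 1 = d + 1 by omega, hX]; nlinarith
      rw [pow_succ']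
      exact_mod_cast h2)
  have e6 : (δ : ℝ) ≤ (2 * n + 3) * ((2 + d : ℕ) : ℝ) ^ n := by
    have h2 := Nf_le_two (n := n) hD
    have h3 : n < (2 + d) ^ n := n.lt_pow_self (by omega)
    have h4 : δ ≤ (2 * n + 3) * (2 + d) ^ n := by
      rw [hδ]
      have : (n + 1) * Nf (2 + d) n ≤ (n + 1) * (2 * (2 + d) ^ n) := Nat.mul_le_mul_left _ h2
      have h5 : (n + 1) * (Nf (2 + d) n + 1) - 1 = (n + 1) * Nf (2 + d) n + n := by
        rw [mul_add, mul_one]; omega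
      rw [h5]
      nlinarith
    exact_mod_cast h4
  have e7 : 5 * Real.log 2 ≤ 2 * l := by
    have h2 : (2 : ℝ) ^ 5 ≤ (((n : ℝ) + 1) * (2 + d : ℕ)) ^ 2 := by
      rw [← hXr]
      have : 2 ^ 5 ≤ X ^ 2 := by nlinarith
      exact_mod_cast this
    have h3 := Real.log_le_log (by positivity) h2
    rw [Real.log_pow, Real.log_pow] at h3
    push_cast at h3 ⊢
    simpa [hldef] using h3
  have p2 : (0 : ℝ) < ((n + 2) * Nf (2 + d) n : ℕ) := by exact_mod_cast Nat.mul_pos (by omega) hNf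
  have p3 : (0 : ℝ) < (((2 + d - 1) * (n + 1) + n).choose n : ℕ) := by
    exact_mod_cast Nat.choose_pos (Nat.le_add_left _ _)
  have p4 : (0 : ℝ) < ((n + 1) * Nf (2 + d) n : ℕ) := by exact_mod_cast Nat.mul_pos (by omega) hNf
  have p5 : (0 : ℝ) < ((2 + d - 1) * ((n + 1) * Nf (2 + d) n) : ℕ) := by
    exact_mod_cast Nat.mul_pos (by omega) (Nat.mul_pos (by omega) hNf)
  rw [Real.log_mul (by positivity) (by positivity), Real.log_mul p2.ne' (by positivity),
    Real.log_mul p3.ne' (by positivity), Real.log_mul (by positivity) (by positivity),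
    Real.log_mul hV.ne' (by positivity), Real.log_mul p4.ne' (by positivity), Real.log_pow, Real.log_pow]
  have e8 : (((2 + d - 1) * (n + 1) : ℕ) : ℝ) * Real.log ((2 + d - 1) * ((n + 1) * Nf (2 + d) n) : ℕ) ≤
      (d + 1) * (n + 1) ^ 2 * l := by
    have h2 : (((2 + d - 1) * (n + 1) : ℕ) : ℝ) = (d + 1) * (n + 1) := by
      rw [show 2 + d - 1 = d + 1 by omega]; push_cast; ring
    rw [h2]
    calc _ ≤ ((d : ℝ) + 1) * (n + 1) * ((n + 1 : ℕ) * l) := by gcongr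
      _ = _ := by push_cast; ring
  have e9 : (((n + 1) * δ : ℕ) : ℝ) * Real.log 2 ≤ 2 / 5 * (n + 1) * (2 * n + 3) * ((2 + d : ℕ) : ℝ) ^ n * l := by
    have h2 : Real.log 2 ≤ 2 / 5 * l := by linarith
    have h3 := Real.log_nonneg (by norm_num : (1 : ℝ) ≤ 2)
    calc (((n + 1) * δ : ℕ) : ℝ) * Real.log 2 = (n + 1) * (δ * Real.log 2) := by push_cast; ring
      _ ≤ (n + 1) * ((2 * n + 3) * ((2 + d : ℕ) : ℝ) ^ n * (2 / 5 * l)) := by gcongr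
      _ = _ := by ring
  have e10 : (((2 + d : ℕ) : ℝ) - 1) * (n + 1) ^ 2 * l = (d + 1) * (n + 1) ^ 2 * l := by push_cast; ring
  nlinarith

theorem log_total {n D : ℕ} (hn : 2 ≤ n) (hD : 2 ≤ D) :
    (31 / 30 * (3 * n ^ 2 + 20 * n + 13) + 16 / 15 * (n + 1) * (n + 2) * ((3 * n + 6) * (D : ℝ) ^ n)) +
    ((3 * n + 1) + (D - 1) * (n + 1) ^ 2 + 2 / 5 * (n + 1) * (2 * n + 3) * (D : ℝ) ^ n) ≤
      4 * n * (n + 1) * (D : ℝ) ^ n * (n + 7) := by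
  have hn0 : (2 : ℝ) ≤ n := by exact_mod_cast hn
  have hD0 : (2 : ℝ) ≤ D := by exact_mod_cast hD
  have h1 : (D : ℝ) ^ 2 ≤ (D : ℝ) ^ n := pow_le_pow_right₀ (by linarith) hn
  set y := (D : ℝ) ^ n
  have hy : 4 ≤ y := by nlinarith
  have hDy : (D : ℝ) - 1 ≤ y / 4 := by nlinarith [sq_nonneg ((D : ℝ) - 2)]
  have h2 : ((D : ℝ) - 1) * (n + 1) ^ 2 ≤ y / 4 * (n + 1) ^ 2 :=
    mul_le_mul_of_nonneg_right hDy (by positivity)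
  obtain ⟨m, hm⟩ : ∃ m : ℝ, (n : ℝ) = 2 + m := ⟨n - 2, by ring⟩
  obtain ⟨z, hz⟩ : ∃ z : ℝ, y = 4 + z := ⟨y - 4, by ring⟩
  have hm0 : 0 ≤ m := by linarith
  have hz0 : 0 ≤ z := by linarith
  refine le_trans (add_le_add_right (add_le_add_left (add_le_add_right h2 _) _) _) ?_
  rw [hz, hm]
  have : 0 ≤ m ^ 3 * z := by positivity
  have : 0 ≤ m ^ 2 * z := by positivity
  have : 0 ≤ m * z := by positivity
  have : 0 ≤ m ^ 2 := by positivity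
  have : 0 ≤ m ^ 3 := by positivity
  nlinarith

end EN

namespace EN
open MvPolynomial

theorem cramer_int {R Cc : Type*} [Fintype R] [Fintype Cc] (A : Matrix R Cc ℤ) (b : R → ℤ) (B : ℝ)
    (hB : 1 ≤ B) (hA : ∀ i j, |(A i j : ℝ)| ≤ B) (hb : ∀ i, |(b i : ℝ)| ≤ B)
    (x : Cc → ℚ) (hx : ∀ i, ∑ j, (A i j : ℚ) * x j = b i) :
    ∃ (y : Cc → ℤ) (α : ℕ), α ≠ 0 ∧ (∀ i, ∑ j, A i j * y j = α * b i) ∧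
      (α : ℝ) ≤ (Fintype.card R).factorial * B ^ (Fintype.card R) ∧
      ∀ j, |(y j : ℝ)| ≤ (Fintype.card R).factorial * B ^ (Fintype.card R) := by
  let v0 : Cc ⊕ R → R → ℤ := Sum.elim (fun j i => A i j) (fun r i => if i = r then 1 else 0)
  have hv0 : ∀ s i, |(v0 s i : ℝ)| ≤ B := by
    rintro (j | r) i
    · exact hA i j
    · simp only [v0, Sum.elim_inr]
      split_ifs
      · simpa using hB
      · simp; linarith
  let v : Cc ⊕ R → R → ℚ := fun s i => (v0 s i : ℚ)
  obtain ⟨b0, hb0, -, hsp0, hli0⟩ := exists_linearIndepOn_extension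
    (K := ℚ) (v := v) (linearIndepOn_empty ℚ v) (Set.empty_subset (Set.range Sum.inl))
  obtain ⟨bb, -, hbb, hsp, hli⟩ := exists_linearIndepOn_extension
    (K := ℚ) (v := v) hli0 (Set.subset_univ _)
  have htop : ⊤ ≤ Submodule.span ℚ (Set.range fun s : bb => v s) := by
    rw [← (Pi.basisFun ℚ R).span_eq, Submodule.span_le]
    rintro _ ⟨r, rfl⟩
    have : (Pi.basisFun ℚ R) r = v (Sum.inr r) := by
      ext i
      simp [v, v0, Pi.single_apply]
    rw [this]
    have h2 : Set.range (fun s : bb => v s) = v '' bb := by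
      rw [Set.image_eq_range]
    rw [h2]
    exact hsp ⟨_, Set.mem_univ _, rfl⟩
  let Bs : Module.Basis bb ℚ (R → ℚ) := Module.Basis.mk hli htop
  let e : R ≃ bb := (Pi.basisFun ℚ R).indexEquiv Bs
  let M : Matrix R R ℤ := fun i r => v0 (e r) i
  have hdet : M.det ≠ 0 := by
    have h1 : LinearIndependent ℚ (M.map (Int.cast : ℤ → ℚ)).col := by
      have := hli.comp e e.injective
      exact this
    rw [Matrix.linearIndependent_cols_iff_isUnit, Matrix.isUnit_iff_isUnit_det, isUnit_iff_ne_zero] at h1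
    intro h0
    apply h1
    have := (Int.castRingHom ℚ).map_det M
    rw [h0, map_zero] at this
    exact this.symm
  let y0 : R → ℤ := M.cramer b
  have hy0 : ∀ i, ∑ r, M i r * y0 r = M.det * b i := by
    intro i
    have := congrFun (Matrix.mulVec_cramer M b) i
    simpa [Matrix.mulVec, dotProduct] using this
  let w : Cc ⊕ R → ℤ := fun s => if hs : s ∈ bb then y0 (e.symm ⟨s, hs⟩) else 0
  have hw : ∀ i, ∑ s, v0 s i * w s = M.det * b i := by
    intro i
    rw [← hy0]
    symm
    refine Fintype.sum_of_injective (fun r => ((e r : bb) : Cc ⊕ R))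
      (Subtype.val_injective.comp e.injective) _ _ ?_ ?_
    · intro s hs
      have : s ∉ bb := fun h => hs ⟨e.symm ⟨s, h⟩, by simp⟩
      simp [w, this]
    · intro r
      simp [w, M]
  have hbs : (fun i => (b i : ℚ)) ∈ Submodule.span ℚ (v '' b0) := by
    have : (fun i => (b i : ℚ)) = ∑ j, x j • v (Sum.inl j) := by
      ext i
      rw [← hx i, Finset.sum_apply]
      refine Finset.sum_congr rfl fun j _ => ?_
      simp [v, v0, mul_comm]
    rw [this]
    exact Submodule.sum_mem _ fun j _ => Submodule.smul_mem _ _ (hsp0 ⟨_, ⟨j, rfl⟩, rfl⟩)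
  obtain ⟨l, hl, hlb⟩ := (Finsupp.mem_span_image_iff_linearCombination ℚ).1 hbs
  have hwl : ∀ s, (w s : ℚ) = M.det * l s := by
    let wq : (Cc ⊕ R) →₀ ℚ := Finsupp.equivFunOnFinite.symm fun s => (w s : ℚ)
    have h1 : (M.det : ℚ) • l - wq = 0 := by
      refine linearIndepOn_iff.1 hli _ ?_ ?_
      · refine Submodule.sub_mem _ (Submodule.smul_mem _ _ (Finsupp.supported_mono hbb hl)) ?_
        rw [Finsupp.mem_supported']
        intro s hs
        simp [wq, w, hs]
      · rw [map_sub, map_smul, hlb, Finsupp.linearCombination_apply,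
          Finsupp.sum_fintype wq (fun i a => a • v i) (fun i => zero_smul _ _)]
        ext i
        have := congrArg (Int.cast : ℤ → ℚ) (hw i)
        simp only [Int.cast_sum, Int.cast_mul] at this
        simp only [Pi.sub_apply, Pi.smul_apply, smul_eq_mul, Finset.sum_apply, Pi.zero_apply, wq,
          Finsupp.equivFunOnFinite_symm_apply_apply, v]
        rw [sub_eq_zero]
        refine this.symm.trans (Finset.sum_congr rfl fun s _ => ?_)
        rw [mul_comm]
    intro s
    have := DFunLike.congr_fun h1 s
    simp [wq] at this
    linarith
  have hwr : ∀ r, w (Sum.inr r) = 0 := by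
    intro r
    have : l (Sum.inr r) = 0 := by
      refine (Finsupp.mem_supported' _ _).1 hl _ ?_
      intro h
      obtain ⟨j, hj⟩ := hb0 h
      cases hj
    have h2 := hwl (Sum.inr r)
    rw [this, mul_zero] at h2
    exact_mod_cast h2
  have hdb : |((M.det : ℤ) : ℝ)| ≤ (Fintype.card R).factorial * B ^ (Fintype.card R) := by
    refine (SN_int.det M (fun _ => B) fun i j => hv0 _ _).trans ?_
    simp
  have hyb : ∀ r, |(y0 r : ℝ)| ≤ (Fintype.card R).factorial * B ^ (Fintype.card R) := by
    intro r
    have : y0 r = (M.updateCol r b).det := Matrix.cramer_apply M b r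
    rw [this]
    refine (SN_int.det2 (M.updateCol r b) (fun _ => B) fun i j => ?_).trans ?_
    · by_cases h : j = r
      · subst h; simpa using hb i
      · simpa [Matrix.updateCol_ne h] using hv0 _ _
    · simp
  refine ⟨fun j => M.det.sign * w (Sum.inl j), M.det.natAbs, by simpa using hdet, ?_, ?_, ?_⟩
  · intro i
    have := hw i
    rw [Fintype.sum_sum_type] at this
    simp only [hwr, mul_zero, Finset.sum_const_zero, add_zero] at this
    have h2 : ((M.det.natAbs : ℕ) : ℤ) = M.det.sign * M.det := by
      rw [Int.sign_mul_self_eq_abs, Int.natCast_natAbs]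
    rw [h2, mul_assoc, ← this, Finset.mul_sum]
    refine Finset.sum_congr rfl fun j _ => ?_
    simp only [v0, Sum.elim_inl]
    ring
  · rw [Nat.cast_natAbs, Int.cast_abs]; exact hdb
  · intro j
    have hs : |((M.det.sign : ℤ) : ℝ)| ≤ 1 := by
      rcases lt_trichotomy M.det 0 with h | h | h
      · simp [Int.sign_eq_neg_one_of_neg h]
      · exact absurd h hdet
      · simp [Int.sign_eq_one_of_pos h]
    have hw' : |(w (Sum.inl j) : ℝ)| ≤ (Fintype.card R).factorial * B ^ (Fintype.card R) := by
      by_cases h : Sum.inl j ∈ bb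
      · simpa [w, h] using hyb _
      · simp only [w, h, dite_false, Int.cast_zero, abs_zero]; positivity
    rw [Int.cast_mul, abs_mul]
    nlinarith [abs_nonneg (w (Sum.inl j) : ℝ)]

theorem coeff_lin {R : Type*} [CommRing R] {n k : ℕ} (m : ℕ) (f : Fin k → MvPolynomial (Fin n) R)
    (c : Fin k × Sx (Fin n) m → R) (e : Fin n →₀ ℕ) :
    coeff e (∑ j, f j * ∑ s : Sx (Fin n) m, monomial (s : Fin n →₀ ℕ) (c (j, s))) =
      ∑ p : Fin k × Sx (Fin n) m, coeff e (f p.1 * monomial (p.2 : Fin n →₀ ℕ) 1) * c p := by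
  rw [coeff_sum, Fintype.sum_prod_type]
  refine Finset.sum_congr rfl fun j _ => ?_
  rw [Finset.mul_sum, coeff_sum]
  refine Finset.sum_congr rfl fun s _ => ?_
  rw [coeff_mul_monomial', coeff_mul_monomial']
  split_ifs <;> simp

theorem coeff_sum_mon {R : Type*} [CommRing R] {n : ℕ} (m : ℕ)
    (c : Sx (Fin n) m → R) (e : Fin n →₀ ℕ) :
    coeff e (∑ s : Sx (Fin n) m, monomial (s : Fin n →₀ ℕ) (c s)) =
      if h : e ∈ Sx (Fin n) m then c ⟨e, h⟩ else 0 := by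
  rw [coeff_sum]
  simp only [coeff_monomial]
  split_ifs with h
  · rw [Finset.sum_eq_single ⟨e, h⟩]
    · simp
    · intro b _ hb
      rw [if_neg]
      intro h2
      exact hb (Subtype.ext h2)
    · simp
  · refine Finset.sum_eq_zero fun s _ => ?_
    rw [if_neg]
    rintro rfl
    exact h s.2

theorem lin_bezout {n k D m : ℕ} (f : Fin k → MvPolynomial (Fin n) ℤ)
    (hf : ∀ j, (f j).totalDegree ≤ D) (B : ℝ) (hB : 1 ≤ B) (hfB : ∀ j s, |((coeff s (f j) : ℤ) : ℝ)| ≤ B)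
    (g : Fin k → MvPolynomial (Fin n) ℚ) (hg : ∀ j, (g j).totalDegree ≤ m)
    (h1 : ∑ j, map (Int.castRingHom ℚ) (f j) * g j = 1) :
    ∃ (g' : Fin k → MvPolynomial (Fin n) ℤ) (α : ℕ), α ≠ 0 ∧ ∑ j, f j * g' j = C (α : ℤ) ∧
      (∀ j, (g' j).totalDegree ≤ m) ∧
      (α : ℝ) ≤ ((D + m + n).choose n).factorial * B ^ ((D + m + n).choose n) ∧
      ∀ j s, |((coeff s (g' j) : ℤ) : ℝ)| ≤ ((D + m + n).choose n).factorial * B ^ ((D + m + n).choose n) := by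
  have hgs : ∀ j, g j = ∑ s : Sx (Fin n) m, monomial (s : Fin n →₀ ℕ) (coeff (s : Fin n →₀ ℕ) (g j)) := by
    intro j
    ext e
    rw [coeff_sum_mon m (fun s : Sx (Fin n) m => coeff (s : Fin n →₀ ℕ) (g j))]
    split_ifs with h
    · rfl
    · by_contra h0
      exact h (mem_Sx.2 ((tdeg_le_iff _ _).1 (hg j) e h0))
  obtain ⟨y, α, hα, hy, hαb, hyb⟩ := cramer_int (R := Sx (Fin n) (D + m)) (Cc := Fin k × Sx (Fin n) m)
    (fun e p => coeff (e : Fin n →₀ ℕ) (f p.1 * monomial (p.2 : Fin n →₀ ℕ) 1))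
    (fun e => if (e : Fin n →₀ ℕ) = 0 then 1 else 0) B hB (by
      intro e p
      simp only [coeff_mul_monomial']
      split_ifs
      · simpa using hfB _ _
      · simp; linarith) (by
      intro e
      split_ifs
      · simpa using hB
      · simp; linarith) (fun p => coeff (p.2 : Fin n →₀ ℕ) (g p.1)) (by
      intro e
      have h2 := congrArg (coeff (e : Fin n →₀ ℕ)) h1
      rw [Finset.sum_congr rfl (fun j _ => by rw [hgs j]),
        coeff_lin m _ (fun p : Fin k × Sx (Fin n) m => coeff (p.2 : Fin n →₀ ℕ) (g p.1))] at h2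
      rw [coeff_one] at h2
      simp only [eq_comm (a := (0 : Fin n →₀ ℕ))] at h2
      push_cast
      rw [← h2]
      refine Finset.sum_congr rfl fun p _ => ?_
      congr 1
      rw [coeff_mul_monomial', coeff_mul_monomial']
      split_ifs <;> simp [coeff_map])
  have hc : Fintype.card (Sx (Fin n) (D + m)) = (D + m + n).choose n := by
    rw [Fintype.card_coe, card_Sx, Fintype.card_fin]
  rw [hc] at hαb hyb
  have hdeg : ∀ j, (∑ s : Sx (Fin n) m, monomial (s : Fin n →₀ ℕ) (y (j, s))).totalDegree ≤ m := by
    intro j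
    rw [tdeg_le_iff]
    intro s hs
    rw [coeff_sum_mon m (fun s => y (j, s))] at hs
    split_ifs at hs with h
    · exact mem_Sx.1 h
    · exact absurd rfl hs
  refine ⟨fun j => ∑ s : Sx (Fin n) m, monomial (s : Fin n →₀ ℕ) (y (j, s)), α, hα, ?_, hdeg, hαb, ?_⟩
  · ext e
    by_cases he : e ∈ Sx (Fin n) (D + m)
    · rw [coeff_lin m f y e, hy ⟨e, he⟩, coeff_C]
      simp only [eq_comm (a := (0 : Fin n →₀ ℕ))]
      split_ifs <;> simp
    · have h0 : (0 : Fin n →₀ ℕ) ≠ e := by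
        rintro rfl
        exact he (mem_Sx.2 (by simp))
      rw [coeff_C, if_neg h0]
      by_contra hne
      refine he (mem_Sx.2 ((tdeg_le_iff _ _).1 ?_ e hne))
      refine totalDegree_finsetSum_le fun j _ => ?_
      exact (totalDegree_mul _ _).trans (Nat.add_le_add (hf j) (hdeg j))
  · intro j s
    rw [coeff_sum_mon m (fun s => y (j, s))]
    split_ifs
    · exact hyb _
    · simp only [Int.cast_zero, abs_zero]; positivity

end EN

namespace EN
open MvPolynomial

theorem eval_affine {n : ℕ} (φ : MvPolynomial (Fin n) ℚ →ₗ[ℚ] ℚ) (h1 : φ 1 ≠ 0)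
    (P : MvPolynomial (Fin n) ℚ) (hP : P.totalDegree ≤ 1) :
    φ P = φ 1 * aeval (fun i => φ (X i) / φ 1) P := by
  have hm : ∀ s ∈ P.support, ∀ c : ℚ,
      φ (monomial s c) = φ 1 * aeval (fun i => φ (X i) / φ 1) (monomial s c) := by
    intro s hs c
    have hs1 := (tdeg_le_iff _ _).1 hP s (mem_support_iff.1 hs)
    have e1 : (monomial s c : MvPolynomial (Fin n) ℚ) = c • monomial s 1 := by
      rw [smul_monomial, smul_eq_mul, mul_one]
    rw [e1, map_smul, map_smul]
    by_cases h0 : s = 0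
    · subst h0
      have e : (monomial (0 : Fin n →₀ ℕ) (1 : ℚ)) = 1 := rfl
      rw [e, map_one (aeval (R := ℚ) (fun i => φ (X i) / φ 1))]
      simp [mul_comm]
    · obtain ⟨i, hi⟩ : ∃ i, s i ≠ 0 := by
        by_contra hc
        push Not at hc
        exact h0 (Finsupp.ext hc)
      have hse : s = Finsupp.single i 1 := by
        have h2 := Finset.add_sum_erase Finset.univ (fun i => s i) (Finset.mem_univ i)
        have h3 : ∑ x ∈ Finset.univ.erase i, s x = 0 := by omega
        ext j
        by_cases hj : j = i
        · subst hj; simp; omega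
        · rw [Finset.sum_eq_zero_iff] at h3
          rw [Finsupp.single_eq_of_ne hj]
          exact h3 j (by simp [hj])
      subst hse
      have e : (monomial (Finsupp.single i 1) (1 : ℚ)) = X i := rfl
      rw [e, aeval_X]
      simp only [smul_eq_mul]
      field_simp
  conv_lhs => rw [P.as_sum]
  conv_rhs => rw [P.as_sum]
  rw [map_sum, map_sum, Finset.mul_sum]
  exact Finset.sum_congr rfl fun s hs => hm s hs _

theorem affine_rat {n k : ℕ} (f : Fin k → MvPolynomial (Fin n) ℤ) (hf : ∀ j, (f j).totalDegree ≤ 1)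
    (h : ∀ x : Fin n → ℂ, ∃ i, aeval x (f i) ≠ 0) :
    ∃ c : Fin k → ℚ, ∑ j, map (Int.castRingHom ℚ) (f j) * C (c j) = 1 := by
  by_cases h1 : (1 : MvPolynomial (Fin n) ℚ) ∈
      Submodule.span ℚ (Set.range fun j => map (Int.castRingHom ℚ) (f j))
  · obtain ⟨c, hc⟩ := (Submodule.mem_span_range_iff_exists_fun ℚ).1 h1
    refine ⟨c, ?_⟩
    rw [← hc]
    exact Finset.sum_congr rfl fun j _ => by rw [smul_eq_C_mul, mul_comm]
  · exfalso
    obtain ⟨φ, hφ, hk⟩ := Submodule.exists_le_ker_of_notMem h1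
    obtain ⟨j, hj⟩ := h fun i => ((φ (X i) / φ 1 : ℚ) : ℂ)
    apply hj
    have h2 : φ (map (Int.castRingHom ℚ) (f j)) = 0 := hk (Submodule.subset_span ⟨j, rfl⟩)
    rw [eval_affine φ hφ _ ((tdeg_map_le _ _).trans (hf j))] at h2
    have h3 := (mul_eq_zero.1 h2).resolve_left hφ
    rw [aeval_def, eval₂_map] at h3
    have h4 := congrArg (algebraMap ℚ ℂ) h3
    rw [map_zero, eval₂_comp_left] at h4
    rw [aeval_def]
    have e : algebraMap ℤ ℂ = (algebraMap ℚ ℂ).comp ((algebraMap ℚ ℚ).comp (Int.castRingHom ℚ)) :=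
      RingHom.ext_int _ _
    rw [e]
    exact h4

open Polynomial in
theorem reduce_one {k D : ℕ} (hD : 1 ≤ D) (p q : Fin k → ℚ[X]) (h : ∑ j, p j * q j = 1)
    (hp : ∀ j, (p j).natDegree ≤ D) (j0 : Fin k) (hj0 : D ≤ (p j0).natDegree) :
    ∃ q' : Fin k → ℚ[X], ∑ j, p j * q' j = 1 ∧ ∀ j, (q' j).natDegree ≤ D - 1 := by
  have hd0 : (p j0).natDegree = D := le_antisymm (hp _) hj0
  have hp0 : p j0 ≠ 0 := by rintro h0; rw [h0] at hd0; simp at hd0; omega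
  let S := Finset.univ.erase j0
  let q' : Fin k → ℚ[X] := fun j => if j = j0 then q j0 + ∑ i ∈ S, p i * (q i / p j0) else q j % p j0
  have hS : ∀ i ∈ S, q' i = q i % p j0 := by
    intro i hi
    simp only [q', if_neg (Finset.ne_of_mem_erase hi)]
  have hq0 : q' j0 = q j0 + ∑ i ∈ S, p i * (q i / p j0) := by simp [q']
  have hsum : ∑ j, p j * q' j = 1 := by
    rw [← h, ← Finset.add_sum_erase _ _ (Finset.mem_univ j0),
      ← Finset.add_sum_erase _ (fun j => p j * q j) (Finset.mem_univ j0), hq0, mul_add, add_assoc,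
      Finset.mul_sum, ← Finset.sum_add_distrib]
    congr 1
    refine Finset.sum_congr rfl fun i hi => ?_
    rw [hS i hi]
    conv_rhs => rw [← EuclideanDomain.div_add_mod (q i) (p j0)]
    ring
  have hdS : ∀ i ∈ S, (q' i).natDegree ≤ D - 1 := by
    intro i hi
    rw [hS i hi]
    have := Polynomial.natDegree_mod_lt (q i) (q := p j0) (by omega)
    omega
  refine ⟨q', hsum, fun j => ?_⟩
  by_cases hj : j = j0
  · subst hj
    by_cases hz : q' j = 0
    · rw [hz]; simp
    have h1 : p j * q' j = 1 - ∑ i ∈ S, p i * q' i := by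
      rw [← hsum, ← Finset.add_sum_erase _ _ (Finset.mem_univ j)]
      ring
    have h2 : (p j * q' j).natDegree ≤ D + (D - 1) := by
      rw [h1]
      refine (natDegree_sub_le _ _).trans (max_le (by simp) ?_)
      refine natDegree_sum_le_of_forall_le _ _ fun i hi => ?_
      exact natDegree_mul_le.trans (Nat.add_le_add (hp i) (hdS i hi))
    rw [natDegree_mul hp0 hz, hd0] at h2
    omega
  · exact hdS j (by simp [S, hj])

theorem one_rat {k D : ℕ} (hD : 1 ≤ D) (f : Fin k → MvPolynomial (Fin 1) ℤ)
    (hf : ∀ j, (f j).totalDegree ≤ D) (j0 : Fin k) (hj0 : D ≤ (f j0).totalDegree)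
    (h : ∀ x : Fin 1 → ℂ, ∃ i, aeval x (f i) ≠ 0) :
    ∃ g : Fin k → MvPolynomial (Fin 1) ℚ, (∀ j, (g j).totalDegree ≤ D - 1) ∧
      ∑ j, map (Int.castRingHom ℚ) (f j) * g j = 1 := by
  obtain ⟨g, hg⟩ := bezout_rat f h
  let φ : MvPolynomial (Fin 1) ℚ →ₐ[ℚ] Polynomial ℚ := aeval fun _ => Polynomial.X
  let ψ : Polynomial ℚ →ₐ[ℚ] MvPolynomial (Fin 1) ℚ := Polynomial.aeval (X 0)
  have hψφ : ∀ P, ψ (φ P) = P := by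
    intro P
    have : ψ.comp φ = AlgHom.id ℚ _ := by
      refine MvPolynomial.algHom_ext fun i => ?_
      simp [φ, ψ, Subsingleton.elim i 0]
    exact DFunLike.congr_fun this P
  have hψd : ∀ p : Polynomial ℚ, (ψ p).totalDegree ≤ p.natDegree := by
    intro p
    simp only [ψ, Polynomial.aeval_eq_sum_range]
    refine totalDegree_finsetSum_le fun i hi => ?_
    refine (totalDegree_smul_le _ _).trans ((totalDegree_pow _ _).trans ?_)
    rw [totalDegree_X]
    simp at hi
    omega
  have hφd : ∀ (N : ℕ) (P : MvPolynomial (Fin 1) ℚ), P.totalDegree ≤ N → (φ P).natDegree ≤ N := by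
    intro N P hP
    simp only [φ, aeval_def, eval₂_eq]
    refine Polynomial.natDegree_sum_le_of_forall_le _ _ fun s hs => ?_
    have := (tdeg_le_iff _ _).1 hP s (mem_support_iff.1 hs)
    refine Polynomial.natDegree_C_mul_le _ _ |>.trans ?_
    refine (Polynomial.natDegree_prod_le _ _).trans ?_
    refine le_trans (Finset.sum_le_sum fun i _ => Polynomial.natDegree_X_pow_le _) ?_
    refine le_trans ?_ this
    exact Finset.sum_le_sum_of_subset (Finset.subset_univ _)
  have hmap : (map (Int.castRingHom ℚ) (f j0)).totalDegree = (f j0).totalDegree := by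
    rw [totalDegree, totalDegree, support_map_of_injective _ (RingHom.injective_int _)]
  obtain ⟨q', h1, h2⟩ := reduce_one hD (fun j => φ (map (Int.castRingHom ℚ) (f j))) (fun j => φ (g j))
    (by
      rw [← map_one φ, ← hg, map_sum]
      exact Finset.sum_congr rfl fun j _ => by rw [map_mul, mul_comm])
    (fun j => hφd _ _ ((tdeg_map_le _ _).trans (hf j))) j0 (by
      have := hψd (φ (map (Int.castRingHom ℚ) (f j0)))
      rw [hψφ, hmap] at this
      exact hj0.trans this)
  refine ⟨fun j => ψ (q' j), fun j => (hψd _).trans (h2 j), ?_⟩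
  rw [← map_one ψ, ← h1, map_sum]
  exact Finset.sum_congr rfl fun j _ => by rw [map_mul, hψφ]

end EN

namespace EN
open MvPolynomial

theorem height_nonneg {n : ℕ} (g : MvPolynomial (Fin n) ℤ) : 0 ≤ height g :=
  Real.log_natCast_nonneg _

theorem coeff_le_height {n : ℕ} (g : MvPolynomial (Fin n) ℤ) (h : ℝ) (hg : height g ≤ h) (s : Fin n →₀ ℕ) :
    |((coeff s g : ℤ) : ℝ)| ≤ Real.exp h := by
  by_cases h0 : coeff s g = 0
  · rw [h0]; simp [Real.exp_nonneg]
  have h1 : (coeff s g).natAbs ≤ g.support.sup fun m => (g.coeff m).natAbs :=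
    Finset.le_sup (f := fun m => (g.coeff m).natAbs) (mem_support_iff.2 h0)
  have h2 : 1 ≤ (coeff s g).natAbs := by have := Int.natAbs_ne_zero.2 h0; omega
  refine le_trans ?_ (Real.exp_le_exp.2 hg)
  rw [height, Real.exp_log (by exact_mod_cast (h2.trans h1)), ← Int.cast_abs, ← Nat.cast_natAbs]
  exact_mod_cast h1

theorem height_le {n : ℕ} (g : MvPolynomial (Fin n) ℤ) (W T : ℝ)
    (hW : ∀ s, |((coeff s g : ℤ) : ℝ)| ≤ W) (hT : Real.log W ≤ T) (hT0 : 0 ≤ T) : height g ≤ T := by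
  have hW0 : 0 ≤ W := (abs_nonneg _).trans (hW 0)
  rw [height]
  set m := g.support.sup fun m => (g.coeff m).natAbs with hm
  by_cases h0 : m = 0
  · rw [h0]; simpa using hT0
  have h1 : m ≤ ⌊W⌋₊ := by
    refine Finset.sup_le fun s _ => Nat.le_floor ?_
    rw [Nat.cast_natAbs, Int.cast_abs]
    exact hW s
  have h2 : (m : ℝ) ≤ W := le_trans (by exact_mod_cast h1) (Nat.floor_le hW0)
  refine le_trans (Real.log_le_log ?_ h2) hT
  exact_mod_cast Nat.pos_of_ne_zero h0

/-- the common bound -/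
def TT (n k D : ℕ) (h : ℝ) : ℝ := 4 * n * (n + 1) * (D : ℝ) ^ n *
  (h + Real.log k + (n + 7) * Real.log ((n + 1) * D))

theorem TT_nonneg (n k D : ℕ) (h : ℝ) (h0 : 0 ≤ h) (hD : 1 ≤ D) : 0 ≤ TT n k D h := by
  have h1 : (1 : ℝ) ≤ D := by exact_mod_cast hD
  have h2 : 0 ≤ Real.log ((n + 1) * D) := Real.log_nonneg (by nlinarith [(Nat.cast_nonneg n : (0:ℝ) ≤ n)])
  have h3 : 0 ≤ Real.log k := Real.log_natCast_nonneg _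
  unfold TT
  positivity

def Concl (n k : ℕ) (F : Fin k → MvPolynomial (Fin n) ℤ) (d : ℕ) (T : ℝ) : Prop :=
  ∃ (g : Fin k → MvPolynomial (Fin n) ℤ) (α : ℕ+),
        (∑ i, F i * g i) = MvPolynomial.C ((α : ℕ) : ℤ) ∧
        (∀ i, (g i).totalDegree ≤ d) ∧
        Real.log ((α : ℕ) : ℝ) ≤ T ∧ ∀ i, height (g i) ≤ T

theorem Concl.mk {n k : ℕ} {F : Fin k → MvPolynomial (Fin n) ℤ} {d : ℕ} {T : ℝ} (hT : 0 ≤ T)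
    (g : Fin k → MvPolynomial (Fin n) ℤ) (α : ℕ) (hα : α ≠ 0) (h1 : ∑ i, F i * g i = C (α : ℤ))
    (h2 : ∀ i, (g i).totalDegree ≤ d) (V W : ℝ) (hV : (α : ℝ) ≤ V) (hVT : Real.log V ≤ T)
    (hW : ∀ i s, |((coeff s (g i) : ℤ) : ℝ)| ≤ W) (hWT : Real.log W ≤ T) : Concl n k F d T := by
  refine ⟨g, ⟨α, Nat.pos_of_ne_zero hα⟩, h1, h2, ?_, fun i => height_le _ W T (hW i) hWT hT⟩
  refine le_trans (Real.log_le_log ?_ hV) hVT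
  exact_mod_cast Nat.pos_of_ne_zero hα

theorem small_case {n k D m : ℕ} (hn : 1 ≤ n) (hD : 1 ≤ D) (F : Fin k → MvPolynomial (Fin n) ℤ)
    (hF : ∀ j, (F j).totalDegree ≤ D) (h : ℝ) (h0 : 0 ≤ h) (hh : ∀ j, height (F j) ≤ h)
    (g : Fin k → MvPolynomial (Fin n) ℚ) (hg : ∀ j, (g j).totalDegree ≤ m)
    (h1 : ∑ j, map (Int.castRingHom ℚ) (F j) * g j = 1)
    (hr : (D + m + n).choose n = (n + 1) * D) (hm : m ≤ 4 * n * D ^ n) :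
    Concl n k F (4 * n * D ^ n) (TT n k D h) := by
  obtain ⟨g', α, hα, e, hd, hb, hc⟩ := lin_bezout F hF (Real.exp h) (Real.one_le_exp h0)
    (fun j s => coeff_le_height _ h (hh j) s) g hg h1
  have hT0 := TT_nonneg n k D h h0 hD
  have hlog : Real.log (((D + m + n).choose n).factorial * Real.exp h ^ ((D + m + n).choose n)) ≤ TT n k D h := by
    rw [hr]
    set r := (n + 1) * D with hrr
    have hr1 : 1 ≤ r := Nat.mul_pos (by omega) hD
    have hrR : (r : ℝ) = (n + 1) * D := by rw [hrr]; push_cast; ring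
    rw [Real.log_mul (by positivity) (by positivity), Real.log_pow, Real.log_exp]
    have e1 : Real.log (r.factorial : ℝ) ≤ r * Real.log r := by
      rw [← Real.log_pow]
      refine Real.log_le_log (by positivity) ?_
      exact_mod_cast Nat.factorial_le_pow r
    have e2 : (r : ℝ) ≤ 4 * n * (n + 1) * (D : ℝ) ^ n := by
      have : r ≤ 4 * n * (n + 1) * D ^ n := by
        rw [hrr]
        have : D ≤ D ^ n := Nat.le_self_pow (by omega) _
        nlinarith [Nat.mul_le_mul hn this]
      exact_mod_cast this
    have e3 : 0 ≤ Real.log r := Real.log_natCast_nonneg _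
    have e4 : 0 ≤ Real.log k := Real.log_natCast_nonneg _
    unfold TT
    rw [← hrR]
    have e5 : Real.log r + h ≤ h + Real.log k + (n + 7) * Real.log r := by
      nlinarith [mul_nonneg (Nat.cast_nonneg n : (0:ℝ) ≤ n) e3]
    calc _ ≤ (r : ℝ) * (Real.log r + h) := by linarith
      _ ≤ _ := by gcongr
  exact Concl.mk hT0 g' α hα e (fun i => (hd i).trans hm) _ _ hb hlog hc hlog

theorem n1_le_height {n D : ℕ} (f : MvPolynomial (Fin n) ℤ) (hf : f.totalDegree ≤ D) (h : ℝ)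
    (hh : height f ≤ h) : n1 f ≤ (n + D).choose n * Real.exp h := by
  have hS : f.support ⊆ Sx (Fin n) D := fun s hs =>
    mem_Sx.2 ((tdeg_le_iff _ _).1 hf s (mem_support_iff.1 hs))
  rw [n1, nm_eq SN_int f _ hS]
  refine (Finset.sum_le_card_nsmul _ _ _ fun s _ => coeff_le_height f h hh s).trans ?_
  rw [card_Sx, Fintype.card_fin, nsmul_eq_mul, add_comm D n]

theorem n1_comb {n k D d : ℕ} (F : Fin k → MvPolynomial (Fin n) ℤ) (hF : ∀ j, (F j).totalDegree ≤ D)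
    (h : ℝ) (hh : ∀ j, height (F j) ≤ h) (γ : Fin k → ℕ) (hγ : ∀ l, γ l ≤ d) :
    n1 (∑ l, (γ l : MvPolynomial (Fin n) ℤ) * F l) ≤ k * (d * ((n + D).choose n * Real.exp h)) := by
  refine (nm_sum SN_int _ _).trans ?_
  refine (Finset.sum_le_card_nsmul _ _ (d * ((n + D).choose n * Real.exp h)) (fun l _ => ?_)).trans
    (le_of_eq (b := (k : ℝ) * (d * ((n + D).choose n * Real.exp h))) ?_)
  · refine (SN_int.nm.mul _ _).trans ?_
    have e1 : nm (fun a : ℤ => |(a : ℝ)|) (γ l : MvPolynomial (Fin n) ℤ) ≤ d := by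
      have : (γ l : MvPolynomial (Fin n) ℤ) = C (γ l : ℤ) := by simp
      rw [this, nm_C SN_int]
      simp only [Int.cast_natCast, Nat.abs_cast]
      exact_mod_cast hγ l
    exact mul_le_mul e1 (n1_le_height _ (hF l) h (hh l)) (SN_int.nm.nonneg _) (by positivity)
  · simp

theorem deg_fin_bound {n D : ℕ} (hn : 2 ≤ n) (hD : 2 ≤ D) :
    (n + 1) * (Nf D n + 1) - 1 + (D - 1) * (n + 1) ≤ 4 * n * D ^ n := by
  have h1 := Nf_le_two (n := n) hD
  have h2 : D ^ 2 ≤ D ^ n := Nat.pow_le_pow_right (by omega) hn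
  have h3 : 2 * D ≤ D ^ n := by nlinarith
  obtain ⟨d, rfl⟩ : ∃ d, D = d + 1 := ⟨D - 1, by omega⟩
  simp only [Nat.add_sub_cancel]
  generalize (d + 1) ^ n = y at *
  generalize Nf (d + 1) n = w at *
  have h4 : 2 * ((n + 1) * (w + (d + 1))) ≤ (n + 1) * (5 * y) := by nlinarith
  have h5 : (n + 1) * (5 * y) ≤ 2 * (4 * n * y) := by nlinarith
  have h6 : (n + 1) * (w + 1) - 1 + d * (n + 1) ≤ (n + 1) * (w + (d + 1)) := by
    have : (n + 1) * (w + (d + 1)) = (n + 1) * (w + 1) + d * (n + 1) := by ring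
    omega
  omega

theorem big_case {n k D : ℕ} (hn : 2 ≤ n) (hD : 2 ≤ D) (hk : 1 ≤ k) (F : Fin k → MvPolynomial (Fin n) ℤ)
    (hF : ∀ j, (F j).totalDegree ≤ D) (h : ℝ) (h0 : 0 ≤ h) (hh : ∀ j, height (F j) ≤ h)
    (hx : ∀ x : Fin n → ℂ, ∃ i, aeval x (F i) ≠ 0) :
    Concl n k F (4 * n * D ^ n) (TT n k D h) := by
  obtain ⟨Φ, hΦ⟩ : ∃ Φ : ℝ, Φ = k * (((n + 2) * Nf D n : ℕ) * ((n + D).choose n * Real.exp h)) := ⟨_, rfl⟩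
  obtain ⟨Λ, hΛ⟩ : ∃ Λ : ℝ, Λ = (n + 1) * (D * (Φ + 1)) := ⟨_, rfl⟩
  obtain ⟨N, hN⟩ : ∃ N : ℕ, N = 32 * ((n + 1) * (n + 2) * Nf D n) := ⟨_, rfl⟩
  obtain ⟨K, hK⟩ : ∃ K : ℕ, K = 32 * ((2 * n + 1) * (D * N)) := ⟨_, rfl⟩
  obtain ⟨U, hU⟩ : ∃ U : ℕ, U = (UF n N).card * K ^ (2 * n + 1) := ⟨_, rfl⟩
  obtain ⟨δ, hδ⟩ : ∃ δ : ℕ, δ = (n + 1) * (Nf D n + 1) - 1 := ⟨_, rfl⟩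
  obtain ⟨V, hV⟩ : ∃ V : ℝ, V = U * ((U : ℝ) * Λ ^ N) ^ ((1 : ℝ) / 30) := ⟨_, rfl⟩
  have hΦ0 : 0 ≤ Φ := by rw [hΦ]; positivity
  obtain ⟨g, α, hα, e, hd, hαV, hg⟩ := main_case hD F hF hx Φ Λ V hΦ0
    (fun γ hγ => by rw [hΦ]; exact n1_comb F hF h hh γ hγ) hΛ N K U δ hN hK hU hδ hV
  have hU0 : U ≠ 0 := by
    intro hU0
    rw [hU0] at hV
    have h1 : (1 : ℝ) ≤ α := by exact_mod_cast Nat.one_le_iff_ne_zero.2 hα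
    simp at hV
    linarith
  obtain ⟨hV0, hVl⟩ := log_V hn hD hk h h0 Φ Λ V hΦ hΛ N K U hN hK hU hU0 hV
  have hfin := log_final hn hD V hV0 δ hδ
  have htot := log_total hn hD
  have hX : (1 : ℝ) ≤ (n + 1) * D := by
    have : 1 ≤ (n + 1) * D := by nlinarith
    exact_mod_cast this
  have hl := Real.log_nonneg hX
  have hD1 : (1 : ℝ) ≤ D := by exact_mod_cast (by omega : 1 ≤ D)
  have hT : TT n k D h = 4 * n * (n + 1) * (D : ℝ) ^ n * (h + Real.log k) +
      4 * n * (n + 1) * (D : ℝ) ^ n * (n + 7) * Real.log ((n + 1) * D) := by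
    unfold TT; ring
  have hm := mul_le_mul_of_nonneg_right htot hl
  rw [add_mul] at hm
  have hpos : 0 ≤ ((3 * n + 1) + (D - 1) * (n + 1) ^ 2 +
      2 / 5 * (n + 1) * (2 * n + 3) * (D : ℝ) ^ n) * Real.log ((n + 1) * D) := by
    have : (0 : ℝ) ≤ D - 1 := by linarith
    positivity
  refine Concl.mk (TT_nonneg n k D h h0 (by omega)) g α hα e
    (fun i => (hd i).trans (by rw [hδ]; exact deg_fin_bound hn hD)) V _ hαV ?_
    (fun i s => (le_nm SN_int (g i) s).trans (hg i)) ?_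
  · rw [hT]; linarith
  · rw [hT]; linarith

end EN

/-- Effective arithmetic Nullstellensatz (after D'Andrea–Krick–Sombra): the system has no
common complex zero iff there is a Bézout identity `f₁g₁ + ⋯ + f_kg_k = α` with explicit
degree and height bounds. -/
theorem effective_nullstellensatz (n k : ℕ) (hn : 0 < n) (hk : 0 < k)
    (F : Fin k → MvPolynomial (Fin n) ℤ) (hF : ∀ i, F i ≠ 0)
    (D : ℕ) (hD : D = Finset.univ.sup fun i => (F i).totalDegree) (hD1 : 1 ≤ D)
    (h : ℝ) (hh : (∀ i, height (F i) ≤ h) ∧ ∃ i, height (F i) = h) :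
    (∀ x : Fin n → ℂ, ∃ i, MvPolynomial.aeval x (F i) ≠ 0) ↔
      ∃ (g : Fin k → MvPolynomial (Fin n) ℤ) (α : ℕ+),
        (∑ i, F i * g i) = MvPolynomial.C ((α : ℕ) : ℤ) ∧
        (∀ i, (g i).totalDegree ≤ 4 * n * D ^ n) ∧
        Real.log ((α : ℕ) : ℝ) ≤
          4 * n * (n + 1) * (D : ℝ) ^ n *
            (h + Real.log k + (n + 7) * Real.log ((n + 1) * D)) ∧
        ∀ i, height (g i) ≤
          4 * n * (n + 1) * (D : ℝ) ^ n *
            (h + Real.log k + (n + 7) * Real.log ((n + 1) * D)) := by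
  constructor
  · intro hx
    obtain ⟨hh1, i0, hi0⟩ := hh
    have h0 : 0 ≤ h := hi0 ▸ EN.height_nonneg _
    have hFd : ∀ j, (F j).totalDegree ≤ D := fun j => by
      rw [hD]; exact Finset.le_sup (f := fun i => (F i).totalDegree) (Finset.mem_univ j)
    change EN.Concl n k F (4 * n * D ^ n) (EN.TT n k D h)
    by_cases hD2 : D = 1
    · subst hD2
      obtain ⟨c, hc⟩ := EN.affine_rat F hFd hx
      refine EN.small_case (m := 0) hn hD1 F hFd h h0 hh1 (fun j => MvPolynomial.C (c j)) (by simp) hc ?_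
        (Nat.zero_le _)
      rw [show 1 + 0 + n = n + 1 by ring, Nat.choose_succ_self_right, mul_one]
    by_cases hn2 : n = 1
    · subst hn2
      have hne : (Finset.univ : Finset (Fin k)).Nonempty := ⟨⟨0, hk⟩, Finset.mem_univ _⟩
      obtain ⟨j0, -, hj0⟩ := Finset.exists_mem_eq_sup _ hne fun i => (F i).totalDegree
      obtain ⟨g, hg1, hg2⟩ := EN.one_rat hD1 F hFd j0 (by rw [hD, hj0]) hx
      refine EN.small_case (m := D - 1) hn hD1 F hFd h h0 hh1 g hg1 hg2 ?_ (by rw [pow_one]; omega)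
      rw [Nat.choose_one_right]
      omega
    exact EN.big_case (by omega) (by omega) hk F hFd h h0 hh1 hx
  · rintro ⟨g, α, hg, -⟩ x
    by_contra hc
    push Not at hc
    have h1 := congrArg (MvPolynomial.aeval x) hg
    rw [map_sum, Finset.sum_eq_zero (fun i _ => by rw [map_mul, hc i, zero_mul])] at h1
    simp only [MvPolynomial.aeval_C, map_natCast] at h1
    exact α.pos.ne (by exact_mod_cast h1)

end
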